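/- arXiv:2510.04501 — 3 statements merged into one kernel-verified Lean document; each statement's English description precedes it below -/
import Mathlib

section
/- Assume a = b > 0, a < 1/c with c > 0, and d > 0. Then for every s ≥ s* := max{2, 2√(a·d)} there exists a non-trivial front-pulse solution: twice continuously differentiable functions u, v : ℝ → ℝ with u(ξ) > 0, v(ξ) ≥ 0 on ℝ, v not identically zero, satisfying u'' − s·u' + u·(1 − u − c·v) = 0 and d·v'' − s·v' + v·(a·(1 − u) − v) = 0 on ℝ, together with lim_{ξ→−∞}(u(ξ), v(ξ)) = (0, 0), lim_{ξ→+∞}(u(ξ), v(ξ)) = (1, 0); in particular v(ξ) → 0 as |ξ| → +∞. -/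
open Filter Real
open MeasureTheory Set Topology

noncomputable def LL (p : ℝ) (h : ℝ → ℝ) (x : ℝ) : ℝ :=
  exp (-(p * x)) * ∫ t in Iic x, exp (p * t) * h t

lemma LL_int {p M : ℝ} (hp : 0 < p) {h : ℝ → ℝ} (hm : Measurable h) (hb : ∀ x, |h x| ≤ M) (x : ℝ) :
    IntegrableOn (fun t => exp (p * t) * h t) (Iic x) := by
  refine Integrable.mono' ((integrableOn_exp_mul_Iic hp x).mul_const M) ?_ ?_
  · exact (Measurable.mul (by fun_prop) hm).aestronglyMeasurable
  · refine Eventually.of_forall fun t => ?_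
    rw [norm_mul, Real.norm_eq_abs, Real.norm_eq_abs, abs_of_pos (exp_pos _)]
    exact mul_le_mul_of_nonneg_left (hb t) (exp_pos _).le

lemma LL_mono {p M N : ℝ} (hp : 0 < p) {h g : ℝ → ℝ} (hm : Measurable h) (hb : ∀ x, |h x| ≤ M)
    (gm : Measurable g) (gb : ∀ x, |g x| ≤ N) (hg : ∀ x, h x ≤ g x) (x : ℝ) :
    LL p h x ≤ LL p g x := by
  refine mul_le_mul_of_nonneg_left ?_ (exp_pos _).le
  refine setIntegral_mono (LL_int hp hm hb x) (LL_int hp gm gb x) fun t => ?_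
  exact mul_le_mul_of_nonneg_left (hg t) (exp_pos _).le

lemma LL_const {p : ℝ} (hp : 0 < p) (M x : ℝ) : LL p (fun _ => M) x = M / p := by
  unfold LL
  rw [integral_mul_const, integral_exp_mul_Iic hp, exp_neg]
  have := exp_pos (p * x)
  field_simp

lemma LL_neg (p : ℝ) (h : ℝ → ℝ) (x : ℝ) : LL p (fun t => - h t) x = - LL p h x := by
  unfold LL
  simp only [mul_neg, integral_neg]

lemma LL_bd {p M : ℝ} (hp : 0 < p) {h : ℝ → ℝ} (hm : Measurable h) (hb : ∀ x, |h x| ≤ M) (x : ℝ) :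
    |LL p h x| ≤ M / p := by
  have hc : ∀ y : ℝ, |M| ≤ |M| := fun _ => le_rfl
  rw [abs_le']
  constructor
  · rw [← LL_const hp M x]
    exact LL_mono hp hm hb measurable_const hc (fun t => (abs_le'.1 (hb t)).1) x
  · rw [← LL_neg, ← LL_const hp M x]
    exact LL_mono hp hm.neg (M := M) (by simpa using hb) measurable_const hc
      (fun t => (abs_le'.1 (hb t)).2) x

lemma LL_eq {p M : ℝ} (hp : 0 < p) {h : ℝ → ℝ} (hm : Measurable h) (hb : ∀ x, |h x| ≤ M) :
    LL p h = fun x => exp (-(p * x)) *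
      ((∫ t in Iic 0, exp (p * t) * h t) + ∫ t in (0:ℝ)..x, exp (p * t) * h t) := by
  funext x
  unfold LL
  rw [← intervalIntegral.integral_Iic_sub_Iic (LL_int hp hm hb 0) (LL_int hp hm hb x)]
  ring

lemma LL_cont {p M : ℝ} (hp : 0 < p) {h : ℝ → ℝ} (hm : Measurable h) (hb : ∀ x, |h x| ≤ M) :
    Continuous (LL p h) := by
  rw [LL_eq hp hm hb]
  refine Continuous.mul (by fun_prop) (continuous_const.add ?_)
  refine intervalIntegral.continuous_primitive (fun a b => ?_) 0
  rw [intervalIntegrable_iff]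
  refine (LL_int hp hm hb (max a b)).mono_set ?_
  intro t ht
  exact ht.2

lemma LL_deriv {p M : ℝ} (hp : 0 < p) {h : ℝ → ℝ} (hm : Continuous h) (hb : ∀ x, |h x| ≤ M) (x : ℝ) :
    HasDerivAt (LL p h) (h x - p * LL p h x) x := by
  have hc : Continuous (fun t => exp (p * t) * h t) := by fun_prop
  have h1 : HasDerivAt (fun x => ∫ t in (0:ℝ)..x, exp (p * t) * h t) (exp (p * x) * h x) x :=
    intervalIntegral.integral_hasDerivAt_right (hc.intervalIntegrable _ _)
      (hc.stronglyMeasurableAtFilter _ _) hc.continuousAt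
  have h2 : HasDerivAt (fun x => exp (-(p * x))) (exp (-(p * x)) * (-(p * 1))) x :=
    (((hasDerivAt_id x).const_mul p).neg).exp
  have h3 := h2.mul (h1.const_add (∫ t in Iic 0, exp (p * t) * h t))
  rw [LL_eq hp hm.measurable hb]
  refine h3.congr_deriv ?_
  have : exp (-(p * x)) * exp (p * x) = 1 := by rw [← exp_add]; simp
  linear_combination (h x) * this

lemma LL_tendsto {p M : ℝ} (hp : 0 < p) {h : ℕ → ℝ → ℝ} {g : ℝ → ℝ} (hm : ∀ n, Measurable (h n))
    (hb : ∀ n x, |h n x| ≤ M) (hg : ∀ x, Tendsto (fun n => h n x) atTop (𝓝 (g x))) (x : ℝ) :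
    Tendsto (fun n => LL p (h n) x) atTop (𝓝 (LL p g x)) := by
  refine Tendsto.const_mul _ ?_
  refine tendsto_integral_of_dominated_convergence (fun t => exp (p * t) * M) ?_ ?_ ?_ ?_
  · intro n; exact (LL_int hp (hm n) (hb n) x).aestronglyMeasurable
  · exact (integrableOn_exp_mul_Iic hp x).mul_const M
  · intro n
    refine Eventually.of_forall fun t => ?_
    rw [norm_mul, Real.norm_eq_abs, Real.norm_eq_abs, abs_of_pos (exp_pos _)]
    exact mul_le_mul_of_nonneg_left (hb n t) (exp_pos _).le
  · exact Eventually.of_forall fun t => (hg t).const_mul _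

/-- Green operator -/
noncomputable def GG (D p m : ℝ) (h : ℝ → ℝ) (x : ℝ) : ℝ :=
  1 / (D * (p + m)) * (LL p h x + LL m (fun t => h (-t)) (-x))

noncomputable def GG' (D p m : ℝ) (h : ℝ → ℝ) (x : ℝ) : ℝ :=
  1 / (D * (p + m)) * (-(p * LL p h x) + m * LL m (fun t => h (-t)) (-x))

section
variable {D p m M N : ℝ} (hD : 0 < D) (hp : 0 < p) (hm : 0 < m)
include hD hp hm

lemma GG_mono {h g : ℝ → ℝ} (hh : Measurable h) (hb : ∀ x, |h x| ≤ M)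
    (gh : Measurable g) (gb : ∀ x, |g x| ≤ N) (hg : ∀ x, h x ≤ g x) (x : ℝ) :
    GG D p m h x ≤ GG D p m g x := by
  refine mul_le_mul_of_nonneg_left (add_le_add ?_ ?_) (by positivity)
  · exact LL_mono hp hh hb gh gb hg x
  · exact LL_mono hm (hh.comp measurable_neg) (fun _ => hb _) (gh.comp measurable_neg)
      (fun _ => gb _) (fun _ => hg _) _

omit hD hp hm in
lemma GG_neg (h : ℝ → ℝ) (x : ℝ) : GG D p m (fun t => - h t) x = - GG D p m h x := by
  unfold GG
  rw [LL_neg, LL_neg m (fun t => h (-t))]; ring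

lemma GG_bd {h : ℝ → ℝ} (hh : Measurable h) (hb : ∀ x, |h x| ≤ M) (x : ℝ) :
    |GG D p m h x| ≤ 1 / (D * (p + m)) * (M / p + M / m) := by
  unfold GG
  rw [abs_mul, abs_of_pos (show 0 < 1 / (D * (p + m)) by positivity)]
  refine mul_le_mul_of_nonneg_left ?_ (by positivity)
  exact (abs_add_le _ _).trans (add_le_add (LL_bd hp hh hb x)
    (LL_bd hm (hh.comp measurable_neg) (fun _ => hb _) _))

omit hD in
lemma GG_cont {h : ℝ → ℝ} (hh : Measurable h) (hb : ∀ x, |h x| ≤ M) : Continuous (GG D p m h) := by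
  have h1 := LL_cont hp hh hb
  have h2 : Continuous (LL m (fun t => h (-t))) :=
    LL_cont hm (hh.comp measurable_neg) (fun _ => hb _)
  unfold GG
  fun_prop

omit hD in
lemma GG_tendsto {h : ℕ → ℝ → ℝ} {g : ℝ → ℝ} (hh : ∀ n, Measurable (h n))
    (hb : ∀ n x, |h n x| ≤ M) (hg : ∀ x, Tendsto (fun n => h n x) atTop (𝓝 (g x))) (x : ℝ) :
    Tendsto (fun n => GG D p m (h n) x) atTop (𝓝 (GG D p m g x)) := by
  refine Tendsto.const_mul _ (Tendsto.add ?_ ?_)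
  · exact LL_tendsto hp hh hb hg x
  · exact LL_tendsto hm (h := fun n t => h n (-t)) (fun n => (hh n).comp measurable_neg)
      (fun _ _ => hb _ _) (fun _ => hg _) _

omit hD hp in
lemma LL_refl_deriv {h : ℝ → ℝ} (hh : Continuous h) (hb : ∀ x, |h x| ≤ M) (x : ℝ) :
    HasDerivAt (fun x => LL m (fun t => h (-t)) (-x)) (m * LL m (fun t => h (-t)) (-x) - h x) x := by
  have h1 : HasDerivAt (LL m (fun t => h (-t))) _ (-x) :=
    LL_deriv (h := fun t => h (-t)) hm (hh.comp continuous_neg) (fun _ => hb _) (-x)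
  have := h1.comp x (hasDerivAt_neg x)
  refine this.congr_deriv ?_
  simp

omit hD in
lemma GG_deriv {h : ℝ → ℝ} (hh : Continuous h) (hb : ∀ x, |h x| ≤ M) (x : ℝ) :
    HasDerivAt (GG D p m h) (GG' D p m h x) x := by
  have := ((LL_deriv hp hh hb x).add (LL_refl_deriv hm hh hb x)).const_mul (1 / (D * (p + m)))
  refine this.congr_deriv ?_
  unfold GG'; ring

lemma GG'_deriv {h : ℝ → ℝ} (hh : Continuous h) (hb : ∀ x, |h x| ≤ M) (x : ℝ) :
    HasDerivAt (GG' D p m h) (((m - p) * D * GG' D p m h x + D * p * m * GG D p m h x - h x) / D) x := by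
  have := (((LL_deriv hp hh hb x).const_mul p).neg.add
    ((LL_refl_deriv hm hh hb x).const_mul m)).const_mul (1 / (D * (p + m)))
  refine this.congr_deriv ?_
  unfold GG' GG
  have : p + m ≠ 0 := by positivity
  field_simp
  ring

end

def TouchSup (D s : ℝ) (f : ℝ → ℝ) (x y : ℝ) : Prop :=
  ∃ (ψ ψ' : ℝ → ℝ) (p2 : ℝ), (∀ᶠ t in 𝓝 x, HasDerivAt ψ (ψ' t) t) ∧ HasDerivAt ψ' p2 x ∧
    ψ x = f x ∧ (∀ᶠ t in 𝓝 x, f t ≤ ψ t) ∧ D * p2 - s * ψ' x + y ≤ 0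

def TouchSub (D s : ℝ) (f : ℝ → ℝ) (x y : ℝ) : Prop :=
  ∃ (ψ ψ' : ℝ → ℝ) (p2 : ℝ), (∀ᶠ t in 𝓝 x, HasDerivAt ψ (ψ' t) t) ∧ HasDerivAt ψ' p2 x ∧
    ψ x = f x ∧ (∀ᶠ t in 𝓝 x, ψ t ≤ f t) ∧ 0 ≤ D * p2 - s * ψ' x + y

lemma TouchSub.neg {D s : ℝ} {f : ℝ → ℝ} {x y : ℝ} (h : TouchSub D s f x y) :
    TouchSup D s (fun t => - f t) x (-y) := by
  obtain ⟨ψ, ψ', p2, h1, h2, h3, h4, h5⟩ := h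
  refine ⟨fun t => - ψ t, fun t => - ψ' t, -p2, h1.mono fun t ht => ht.neg, h2.neg, by simp [h3],
    h4.mono fun t ht => neg_le_neg ht, by linarith⟩

lemma second_test {g g' : ℝ → ℝ} {x g2 : ℝ} (h1 : ∀ᶠ t in 𝓝 x, HasDerivAt g (g' t) t)
    (h2 : HasDerivAt g' g2 x) (hmax : IsLocalMax g x) : g' x = 0 ∧ g2 ≤ 0 := by
  have e : deriv g =ᶠ[𝓝 x] g' := h1.mono fun t ht => ht.deriv
  have z : g' x = 0 := hmax.hasDerivAt_eq_zero h1.self_of_nhds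
  refine ⟨z, ?_⟩
  by_contra hc
  push Not at hc
  have d2 : deriv (deriv g) x = g2 := by rw [e.deriv_eq, h2.deriv]
  have hmin : IsLocalMin g x := isLocalMin_of_deriv_deriv_pos (by rw [d2]; exact hc)
    (by rw [e.self_of_nhds, z]) h1.self_of_nhds.continuousAt
  have hc' : g =ᶠ[𝓝 x] fun _ => g x := by
    filter_upwards [hmax, hmin] with t a b using le_antisymm a b
  have := hc'.deriv.deriv_eq
  rw [d2] at this
  simp at this
  linarith

lemma compare_up {D s β : ℝ} (hD : 0 < D) (hβ : 0 < β) {U U' U2 f h : ℝ → ℝ} {M : ℝ}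
    (hU : ∀ x, HasDerivAt U (U' x) x) (hU' : ∀ x, HasDerivAt U' (U2 x) x)
    (heq : ∀ x, D * U2 x - s * U' x - β * U x + h x = 0)
    (hUb : ∀ x, |U x| ≤ M) (hf : Continuous f) (hfb : ∀ x, |f x| ≤ M)
    (ht : ∀ x, TouchSup D s f x (h x - β * f x)) (x : ℝ) : U x ≤ f x := by
  by_contra hc
  push Not at hc
  obtain ⟨ν, hν, hν1⟩ : ∃ ν : ℝ, 0 < ν ∧ D * ν ^ 2 + |s| * ν ≤ β := by
    refine ⟨min 1 (β / (D + |s|)), by positivity, ?_⟩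
    set ν := min 1 (β / (D + |s|))
    have h1 : ν ≤ 1 := min_le_left _ _
    have h2 : ν ≤ β / (D + |s|) := min_le_right _ _
    have h0 : 0 < ν := by positivity
    rw [le_div_iff₀ (by positivity)] at h2
    nlinarith [mul_nonneg hD.le (mul_nonneg h0.le (sub_nonneg.2 h1))]
  obtain ⟨ε, hε, hε1⟩ : ∃ ε : ℝ, 0 < ε ∧ ε * cosh (ν * x) < U x - f x := by
    refine ⟨(U x - f x) / (2 * cosh (ν * x)), div_pos (by linarith) (by have := cosh_pos (ν * x); positivity), ?_⟩
    have := cosh_pos (ν * x)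
    field_simp
    linarith
  set g : ℝ → ℝ := fun t => U t - f t - ε * cosh (ν * t) with hg
  have hUc : Continuous U := continuous_iff_continuousAt.2 fun t => (hU t).continuousAt
  have hgc : Continuous g := by fun_prop
  have hlim : ∀ᶠ t in cocompact ℝ, g t ≤ g x := by
    have h0 : ∀ᶠ t : ℝ in cocompact ℝ, 2 * M / (ε * ν) < |t| := by
      have : Tendsto (fun t : ℝ => ‖t‖) (cocompact ℝ) atTop := tendsto_norm_cocompact_atTop
      exact this.eventually (eventually_gt_atTop _)
    filter_upwards [h0] with t ht
    rw [div_lt_iff₀ (by positivity)] at ht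
    have h1 : |ν * t| ≤ cosh (ν * t) := by
      rw [← cosh_abs]
      have h2 : |ν * t| + 1 ≤ exp |ν * t| := add_one_le_exp _
      have h3 := exp_pos (-|ν * t|)
      have h4 : |ν*t| ≤ sinh |ν * t| := self_le_sinh_iff.2 (abs_nonneg _)
      have h5 := sinh_lt_cosh |ν * t|
      linarith
    rw [abs_mul, abs_of_pos hν] at h1
    have h2 := mul_le_mul_of_nonneg_left h1 hε.le
    have h3 := (abs_le.1 (hUb t)).2
    have h4 := (abs_le.1 (hfb t)).1
    have h5 : 0 < g x := by simp only [hg]; linarith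
    have : g t ≤ 0 := by simp only [hg]; nlinarith
    linarith
  obtain ⟨x0, hx0⟩ := hgc.exists_forall_ge' x hlim
  have hpos : 0 < g x0 := by
    have h5 : 0 < g x := by simp only [hg]; linarith
    exact h5.trans_le (hx0 x)
  obtain ⟨ψ, ψ', p2, h1, h2, h3, h4, h5⟩ := ht x0
  have hcosh : ∀ t, HasDerivAt (fun t => ε * cosh (ν * t)) (ε * (sinh (ν * t) * (ν * 1))) t :=
    fun t => (((hasDerivAt_id t).const_mul ν).cosh).const_mul ε
  have hsinh : ∀ t, HasDerivAt (fun t => ε * (sinh (ν * t) * (ν * 1))) (ε * (cosh (ν * t) * (ν * 1) * (ν * 1))) t :=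
    fun t => ((((hasDerivAt_id t).const_mul ν).sinh).mul_const (ν * 1)).const_mul ε
  have hmax : IsLocalMax (fun t => U t - ψ t - ε * cosh (ν * t)) x0 := by
    filter_upwards [h4] with t ht
    have := hx0 t
    simp only [hg] at this
    rw [h3]
    linarith
  obtain ⟨e1, e2⟩ := second_test (h1.mono fun t ht => ((hU t).sub ht).sub (hcosh t))
    (((hU' x0).sub h2).sub (hsinh x0)) hmax
  have h6 := heq x0
  have h7 : |sinh (ν * x0)| ≤ cosh (ν * x0) := by
    rw [abs_le]
    constructor
    · have := sinh_lt_cosh (-(ν * x0)); rw [sinh_neg, cosh_neg] at this; linarith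
    · exact (sinh_lt_cosh _).le
  have h8 : -(s * sinh (ν * x0)) ≤ |s| * cosh (ν * x0) := by
    calc -(s * sinh (ν * x0)) ≤ |s * sinh (ν * x0)| := neg_le_abs _
      _ = |s| * |sinh (ν * x0)| := abs_mul _ _
      _ ≤ _ := mul_le_mul_of_nonneg_left h7 (abs_nonneg _)
  have hch := cosh_pos (ν * x0)
  simp only [hg] at hpos
  set C := cosh (ν * x0)
  set S := sinh (ν * x0)
  have h9 : D * (ε * (C * (ν * 1) * (ν * 1))) - s * (ε * (S * (ν * 1))) ≤ β * (ε * C) := by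
    have k1 : D * (C * (ν * 1) * (ν * 1)) - s * (S * (ν * 1)) ≤ β * C := by
      nlinarith [mul_le_mul_of_nonneg_right h8 hν.le, mul_le_mul_of_nonneg_right hν1 hch.le]
    have := mul_le_mul_of_nonneg_left k1 hε.le
    linarith
  have h10 : D * (U2 x0 - p2 - ε * (C * (ν * 1) * (ν * 1))) ≤ 0 :=
    mul_nonpos_of_nonneg_of_nonpos hD.le e2
  have h11 : s * (U' x0 - ψ' x0 - ε * (S * (ν * 1))) = 0 := by
    have : U' x0 - ψ' x0 - ε * (S * (ν * 1)) = 0 := e1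
    rw [this, mul_zero]
  have h12 := mul_pos hβ hpos
  nlinarith

lemma exists_roots (D s β : ℝ) (hD : 0 < D) (hβ : 0 < β) :
    ∃ p m : ℝ, 0 < p ∧ 0 < m ∧ (m - p) * D = s ∧ D * p * m = β := by
  set R := √(s ^ 2 + 4 * D * β)
  have h1 : R ^ 2 = s ^ 2 + 4 * D * β := Real.sq_sqrt (by positivity)
  have h2 : |s| < R := by
    rw [← Real.sqrt_sq_eq_abs]
    exact Real.sqrt_lt_sqrt (by positivity) (by nlinarith [mul_pos hD hβ])
  obtain ⟨h3, h4⟩ := abs_lt.1 h2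
  refine ⟨(-s + R) / (2 * D), (s + R) / (2 * D), div_pos (by linarith) (by positivity),
    div_pos (by linarith) (by positivity), ?_, ?_⟩
  · field_simp; ring
  · field_simp
    nlinarith

section
variable {D s β p m M N : ℝ} (hD : 0 < D) (hβ : 0 < β) (hp : 0 < p) (hm : 0 < m)
  (e1 : (m - p) * D = s) (e2 : D * p * m = β)
include hD hβ hp hm e1 e2

omit hβ in
lemma GG_eqn {h : ℝ → ℝ} (hh : Continuous h) (hb : ∀ x, |h x| ≤ M) :
    ∃ U2 : ℝ → ℝ, (∀ x, HasDerivAt (GG' D p m h) (U2 x) x) ∧ Continuous U2 ∧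
      ∀ x, D * U2 x - s * GG' D p m h x - β * GG D p m h x + h x = 0 := by
  refine ⟨_, fun x => GG'_deriv hD hp hm hh hb x, ?_, fun x => ?_⟩
  · have h1 : Continuous (GG D p m h) := GG_cont hp hm hh.measurable hb
    have h2 : Continuous (GG' D p m h) :=
      continuous_iff_continuousAt.2 fun x => (GG'_deriv hD hp hm hh hb x).continuousAt
    fun_prop
  · rw [← e1, ← e2]; field_simp; ring

lemma GG_le_super {h f : ℝ → ℝ} (hh : Continuous h) (hb : ∀ x, |h x| ≤ M) (hf : Continuous f)
    (hfb : ∀ x, |f x| ≤ N) (ht : ∀ x, TouchSup D s f x (h x - β * f x)) (x : ℝ) :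
    GG D p m h x ≤ f x := by
  obtain ⟨U2, h1, -, h2⟩ := GG_eqn hD hp hm e1 e2 hh hb
  refine compare_up (M := max N (1 / (D * (p + m)) * (M / p + M / m))) hD hβ
    (fun x => GG_deriv hp hm hh hb x) h1 h2 (fun x => ?_) hf
    (fun x => (hfb x).trans (le_max_left _ _)) ht x
  exact (GG_bd hD hp hm hh.measurable hb x).trans (le_max_right _ _)

lemma GG_ge_sub {h f : ℝ → ℝ} (hh : Continuous h) (hb : ∀ x, |h x| ≤ M) (hf : Continuous f)
    (hfb : ∀ x, |f x| ≤ N) (ht : ∀ x, TouchSub D s f x (h x - β * f x)) (x : ℝ) :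
    f x ≤ GG D p m h x := by
  have := GG_le_super hD hβ hp hm e1 e2 (h := fun t => - h t) (f := fun t => - f t) hh.neg
    (M := M) (by simpa using hb) hf.neg (N := N) (by simpa using hfb) (fun x => by
      have := (ht x).neg
      convert this using 1
      ring) x
  rw [GG_neg] at this
  linarith

end

lemma contDiff_two {u u' u2 : ℝ → ℝ} (h1 : ∀ x, HasDerivAt u (u' x) x)
    (h2 : ∀ x, HasDerivAt u' (u2 x) x) (h3 : Continuous u2) :
    ContDiff ℝ 2 u ∧ deriv u = u' ∧ deriv (deriv u) = u2 := by
  have e1 : deriv u = u' := funext fun x => (h1 x).deriv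
  have e2 : deriv u' = u2 := funext fun x => (h2 x).deriv
  refine ⟨?_, e1, by rw [e1, e2]⟩
  have k : ContDiff ℝ 1 u' := contDiff_one_iff_deriv.2 ⟨fun x => (h2 x).differentiableAt, by rwa [e2]⟩
  have := (contDiff_succ_iff_deriv (𝕜 := ℝ) (n := 1) (f := u)).2
    ⟨fun x => (h1 x).differentiableAt, by simp, by rwa [e1]⟩
  simpa [one_add_one_eq_two] using this

lemma TouchSup.mono {D s : ℝ} {f : ℝ → ℝ} {x y y' : ℝ} (h : TouchSup D s f x y) (hy : y' ≤ y) :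
    TouchSup D s f x y' := by
  obtain ⟨ψ, ψ', p2, h1, h2, h3, h4, h5⟩ := h
  exact ⟨ψ, ψ', p2, h1, h2, h3, h4, by linarith⟩

lemma TouchSub.mono {D s : ℝ} {f : ℝ → ℝ} {x y y' : ℝ} (h : TouchSub D s f x y) (hy : y ≤ y') :
    TouchSub D s f x y' := by
  obtain ⟨ψ, ψ', p2, h1, h2, h3, h4, h5⟩ := h
  exact ⟨ψ, ψ', p2, h1, h2, h3, h4, by linarith⟩

theorem exists_sol (a c d s q : ℝ) (ha : 0 < a) (hc : 0 < c) (hd : 0 < d) (hq : 0 < q)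
    (ul uu vl vu : ℝ → ℝ) (cul : Continuous ul) (cuu : Continuous uu) (cvl : Continuous vl)
    (cvu : Continuous vu) (ul0 : ∀ x, 0 ≤ ul x) (huu : ∀ x, ul x ≤ uu x) (uu1 : ∀ x, uu x ≤ 1)
    (vl0 : ∀ x, 0 ≤ vl x) (hvv : ∀ x, vl x ≤ vu x) (vuq : ∀ x, vu x ≤ q)
    (t1 : ∀ x, TouchSub 1 s ul x (ul x * (1 - ul x - c * vu x)))
    (t2 : ∀ x, TouchSup d s vu x (vu x * (a * (1 - ul x) - vu x)))
    (t3 : ∀ x, TouchSup 1 s uu x (uu x * (1 - uu x - c * vl x)))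
    (t4 : ∀ x, TouchSub d s vl x (vl x * (a * (1 - uu x) - vl x))) :
    ∃ u v : ℝ → ℝ, ContDiff ℝ 2 u ∧ ContDiff ℝ 2 v ∧
      (∀ x, ul x ≤ u x ∧ u x ≤ uu x ∧ vl x ≤ v x ∧ v x ≤ vu x) ∧
      (∀ ξ : ℝ, deriv (deriv u) ξ - s * deriv u ξ + u ξ * (1 - u ξ - c * v ξ) = 0) ∧
      (∀ ξ : ℝ, d * deriv (deriv v) ξ - s * deriv v ξ + v ξ * (a * (1 - u ξ) - v ξ) = 0) := by
  obtain ⟨β, hβ, hβ1, hβ2⟩ : ∃ β : ℝ, 0 < β ∧ 2 + c * q ≤ β ∧ 2 * q ≤ β :=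
    ⟨2 + c * q + 2 * q, by positivity, by linarith, by nlinarith [mul_pos hc hq]⟩
  obtain ⟨p1, m1, hp1, hm1, e1, e1'⟩ := exists_roots 1 s β one_pos hβ
  obtain ⟨p2, m2, hp2, hm2, e2, e2'⟩ := exists_roots d s β hd hβ
  set H1 : (ℝ → ℝ) → (ℝ → ℝ) → ℝ → ℝ := fun u v t => β * u t + u t * (1 - u t - c * v t) with hH1
  set H2 : (ℝ → ℝ) → (ℝ → ℝ) → ℝ → ℝ := fun u v t => β * v t + v t * (a * (1 - u t) - v t) with hH2
  set M1 := β + (1 + 1 + c * q) with hM1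
  set M2 := β * q + q * (a + q) with hM2
  have b1 : ∀ u v : ℝ → ℝ, ∀ x, 0 ≤ u x → u x ≤ 1 → 0 ≤ v x → v x ≤ q → |H1 u v x| ≤ M1 := by
    intro u v x h1 h2 h3 h4
    have k1 : |1 - u x - c * v x| ≤ 1 + 1 + c * q := by
      have := mul_le_mul_of_nonneg_left h4 hc.le
      have := mul_nonneg hc.le h3
      rw [abs_le]; constructor <;> linarith
    calc |H1 u v x| ≤ |β * u x| + |u x * (1 - u x - c * v x)| := abs_add_le _ _
      _ = β * u x + u x * |1 - u x - c * v x| := by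
          rw [abs_mul, abs_mul, abs_of_pos hβ, abs_of_nonneg h1]
      _ ≤ β * 1 + 1 * (1 + 1 + c * q) := by gcongr
      _ = M1 := by rw [hM1]; ring
  have b2 : ∀ u v : ℝ → ℝ, ∀ x, 0 ≤ u x → u x ≤ 1 → 0 ≤ v x → v x ≤ q → |H2 u v x| ≤ M2 := by
    intro u v x h1 h2 h3 h4
    have k1 : |a * (1 - u x) - v x| ≤ a + q := by
      have := mul_nonneg ha.le (sub_nonneg.2 h2)
      have := mul_nonneg ha.le h1
      rw [abs_le]; constructor <;> nlinarith
    calc |H2 u v x| ≤ |β * v x| + |v x * (a * (1 - u x) - v x)| := abs_add_le _ _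
      _ = β * v x + v x * |a * (1 - u x) - v x| := by
          rw [abs_mul, abs_mul, abs_of_pos hβ, abs_of_nonneg h3]
      _ ≤ β * q + q * (a + q) := by gcongr
  have mono1 : ∀ u v u' v' : ℝ → ℝ, ∀ x, 0 ≤ u x → u x ≤ u' x → u' x ≤ 1 → 0 ≤ v' x → v' x ≤ v x →
      v x ≤ q → H1 u v x ≤ H1 u' v' x := by
    intro u v u' v' x h1 h2 h3 h4 h5 h6
    have k1 : c * v' x ≤ c * q := mul_le_mul_of_nonneg_left (h5.trans h6) hc.le
    have k2 := mul_nonneg (sub_nonneg.2 h2) (show 0 ≤ β + 1 - (u x + u' x) - c * v' x by linarith)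
    have k3 := mul_nonneg (mul_nonneg hc.le h1) (sub_nonneg.2 h5)
    simp only [hH1]
    nlinarith
  have mono2 : ∀ u v u' v' : ℝ → ℝ, ∀ x, 0 ≤ u x → u x ≤ u' x → u' x ≤ 1 → 0 ≤ v' x → v' x ≤ v x →
      v x ≤ q → H2 u' v' x ≤ H2 u v x := by
    intro u v u' v' x h1 h2 h3 h4 h5 h6
    have k1 : 0 ≤ a * (1 - u x) := mul_nonneg ha.le (by linarith)
    have k2 := mul_nonneg (sub_nonneg.2 h5) (show 0 ≤ β + a * (1 - u x) - (v x + v' x) by linarith)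
    have k3 := mul_nonneg (mul_nonneg ha.le h4) (sub_nonneg.2 h2)
    simp only [hH2]
    nlinarith
  have c1 : ∀ u v : ℝ → ℝ, Continuous u → Continuous v → Continuous (H1 u v) := by
    intro u v _ _; simp only [hH1]; fun_prop
  have c2 : ∀ u v : ℝ → ℝ, Continuous u → Continuous v → Continuous (H2 u v) := by
    intro u v _ _; simp only [hH2]; fun_prop
  set T1 : (ℝ → ℝ) → (ℝ → ℝ) → ℝ → ℝ := fun u v => GG 1 p1 m1 (H1 u v) with hT1
  set T2 : (ℝ → ℝ) → (ℝ → ℝ) → ℝ → ℝ := fun u v => GG d p2 m2 (H2 u v) with hT2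
  -- box
  let Box : (ℝ → ℝ) → (ℝ → ℝ) → Prop := fun u v => Continuous u ∧ Continuous v ∧
    ∀ x, ul x ≤ u x ∧ u x ≤ uu x ∧ vl x ≤ v x ∧ v x ≤ vu x
  have box4 : ∀ u v, Box u v → ∀ x, 0 ≤ u x ∧ u x ≤ 1 ∧ 0 ≤ v x ∧ v x ≤ q := by
    intro u v h x
    obtain ⟨h1, h2, h3, h4⟩ := h.2.2 x
    exact ⟨(ul0 x).trans h1, h2.trans (uu1 x), (vl0 x).trans h3, h4.trans (vuq x)⟩
  have bb1 : ∀ u v, Box u v → ∀ x, |H1 u v x| ≤ M1 := fun u v h x =>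
    have k := box4 u v h x
    b1 u v x k.1 k.2.1 k.2.2.1 k.2.2.2
  have bb2 : ∀ u v, Box u v → ∀ x, |H2 u v x| ≤ M2 := fun u v h x =>
    have k := box4 u v h x
    b2 u v x k.1 k.2.1 k.2.2.1 k.2.2.2
  have boxlo : Box ul vu := ⟨cul, cvu, fun x => ⟨le_rfl, huu x, hvv x, le_rfl⟩⟩
  have boxhi : Box uu vl := ⟨cuu, cvl, fun x => ⟨huu x, le_rfl, le_rfl, hvv x⟩⟩
  have Tm : ∀ u v u' v', Box u v → Box u' v' → (∀ x, u x ≤ u' x ∧ v' x ≤ v x) →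
      ∀ x, T1 u v x ≤ T1 u' v' x ∧ T2 u' v' x ≤ T2 u v x := by
    intro u v u' v' h h' hle x
    constructor
    · refine GG_mono one_pos hp1 hm1 (c1 u v h.1 h.2.1).measurable (bb1 u v h)
        (c1 u' v' h'.1 h'.2.1).measurable (bb1 u' v' h') (fun t => ?_) x
      exact mono1 u v u' v' t (box4 u v h t).1 (hle t).1 (box4 u' v' h' t).2.1
        (box4 u' v' h' t).2.2.1 (hle t).2 (box4 u v h t).2.2.2
    · refine GG_mono hd hp2 hm2 (c2 u' v' h'.1 h'.2.1).measurable (bb2 u' v' h')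
        (c2 u v h.1 h.2.1).measurable (bb2 u v h) (fun t => ?_) x
      exact mono2 u v u' v' t (box4 u v h t).1 (hle t).1 (box4 u' v' h' t).2.1
        (box4 u' v' h' t).2.2.1 (hle t).2 (box4 u v h t).2.2.2
  have s1 : ∀ x, ul x ≤ T1 ul vu x := by
    refine GG_ge_sub one_pos hβ hp1 hm1 e1 e1' (c1 _ _ cul cvu) (bb1 _ _ boxlo) cul (N := 1) (fun x => ?_)
      (fun x => (t1 x).mono (by simp only [hH1]; linarith))
    rw [abs_of_nonneg (ul0 x)]; exact (box4 _ _ boxlo x).2.1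
  have s2 : ∀ x, T2 ul vu x ≤ vu x := by
    refine GG_le_super hd hβ hp2 hm2 e2 e2' (c2 _ _ cul cvu) (bb2 _ _ boxlo) cvu (N := q) (fun x => ?_)
      (fun x => (t2 x).mono (by simp only [hH2]; linarith))
    rw [abs_of_nonneg (box4 _ _ boxlo x).2.2.1]; exact (box4 _ _ boxlo x).2.2.2
  have s3 : ∀ x, T1 uu vl x ≤ uu x := by
    refine GG_le_super one_pos hβ hp1 hm1 e1 e1' (c1 _ _ cuu cvl) (bb1 _ _ boxhi) cuu (N := 1) (fun x => ?_)
      (fun x => (t3 x).mono (by simp only [hH1]; linarith))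
    rw [abs_of_nonneg (box4 _ _ boxhi x).1]; exact (box4 _ _ boxhi x).2.1
  have s4 : ∀ x, vl x ≤ T2 uu vl x := by
    refine GG_ge_sub hd hβ hp2 hm2 e2 e2' (c2 _ _ cuu cvl) (bb2 _ _ boxhi) cvl (N := q) (fun x => ?_)
      (fun x => (t4 x).mono (by simp only [hH2]; linarith))
    rw [abs_of_nonneg (vl0 x)]; exact (box4 _ _ boxhi x).2.2.2
  have Tbox : ∀ u v, Box u v → Box (T1 u v) (T2 u v) := by
    intro u v h
    refine ⟨GG_cont hp1 hm1 (c1 u v h.1 h.2.1).measurable (bb1 u v h),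
      GG_cont hp2 hm2 (c2 u v h.1 h.2.1).measurable (bb2 u v h), fun x => ?_⟩
    have k1 := Tm ul vu u v boxlo h (fun x => ⟨(h.2.2 x).1, (h.2.2 x).2.2.2⟩) x
    have k2 := Tm u v uu vl h boxhi (fun x => ⟨(h.2.2 x).2.1, (h.2.2 x).2.2.1⟩) x
    exact ⟨(s1 x).trans k1.1, k2.1.trans (s3 x), (s4 x).trans k2.2, k1.2.trans (s2 x)⟩
  let X : ℕ → (ℝ → ℝ) × (ℝ → ℝ) := fun n =>
    Nat.rec (ul, vu) (fun _ w => (T1 w.1 w.2, T2 w.1 w.2)) n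
  have X0 : X 0 = (ul, vu) := rfl
  have XS : ∀ n, X (n + 1) = (T1 (X n).1 (X n).2, T2 (X n).1 (X n).2) := fun n => rfl
  have Xbox : ∀ n, Box (X n).1 (X n).2 := by
    intro n
    induction n with
    | zero => exact boxlo
    | succ k ih => rw [XS]; exact Tbox _ _ ih
  have Xmono : ∀ n x, (X n).1 x ≤ (X (n + 1)).1 x ∧ (X (n + 1)).2 x ≤ (X n).2 x := by
    intro n
    induction n with
    | zero => intro x; exact ⟨s1 x, s2 x⟩
    | succ k ih =>
      intro x
      rw [XS (k + 1)]
      nth_rewrite 1 [XS k]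
      nth_rewrite 5 [XS k]
      exact Tm _ _ _ _ (Xbox k) (Xbox (k + 1)) ih x
  have lim1 : ∀ x, ∃ l, Tendsto (fun n => (X n).1 x) atTop (𝓝 l) := fun x =>
    ⟨_, tendsto_atTop_ciSup (monotone_nat_of_le_succ fun n => (Xmono n x).1)
      ⟨1, by rintro _ ⟨n, rfl⟩; exact (box4 _ _ (Xbox n) x).2.1⟩⟩
  have lim2 : ∀ x, ∃ l, Tendsto (fun n => (X n).2 x) atTop (𝓝 l) := fun x =>
    ⟨_, tendsto_atTop_ciInf (antitone_nat_of_succ_le fun n => (Xmono n x).2)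
      ⟨0, by rintro _ ⟨n, rfl⟩; exact (box4 _ _ (Xbox n) x).2.2.1⟩⟩
  choose u hu using lim1
  choose v hv using lim2
  have l1 : ∀ x, Tendsto (fun n => H1 (X n).1 (X n).2 x) atTop (𝓝 (H1 u v x)) := by
    intro x
    simp only [hH1]
    exact ((hu x).const_mul β).add ((hu x).mul (((hu x).const_sub 1).sub ((hv x).const_mul c)))
  have l2 : ∀ x, Tendsto (fun n => H2 (X n).1 (X n).2 x) atTop (𝓝 (H2 u v x)) := by
    intro x
    simp only [hH2]
    exact ((hv x).const_mul β).add ((hv x).mul ((((hu x).const_sub 1).const_mul a).sub (hv x)))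
  have mm1 : ∀ n, Measurable (H1 (X n).1 (X n).2) := fun n =>
    (c1 _ _ (Xbox n).1 (Xbox n).2.1).measurable
  have mm2 : ∀ n, Measurable (H2 (X n).1 (X n).2) := fun n =>
    (c2 _ _ (Xbox n).1 (Xbox n).2.1).measurable
  have q1 : u = GG 1 p1 m1 (H1 u v) := by
    funext x
    have := GG_tendsto (D := 1) hp1 hm1 mm1 (fun n => bb1 _ _ (Xbox n)) l1 x
    exact tendsto_nhds_unique ((tendsto_add_atTop_iff_nat 1).2 (hu x)) this
  have q2 : v = GG d p2 m2 (H2 u v) := by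
    funext x
    have := GG_tendsto (D := d) hp2 hm2 mm2 (fun n => bb2 _ _ (Xbox n)) l2 x
    exact tendsto_nhds_unique ((tendsto_add_atTop_iff_nat 1).2 (hv x)) this
  have bx : ∀ x, ul x ≤ u x ∧ u x ≤ uu x ∧ vl x ≤ v x ∧ v x ≤ vu x := fun x =>
    ⟨ge_of_tendsto' (hu x) fun n => ((Xbox n).2.2 x).1,
     le_of_tendsto' (hu x) fun n => ((Xbox n).2.2 x).2.1,
     ge_of_tendsto' (hv x) fun n => ((Xbox n).2.2 x).2.2.1,
     le_of_tendsto' (hv x) fun n => ((Xbox n).2.2 x).2.2.2⟩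
  have M1m : Measurable (H1 u v) := measurable_of_tendsto_metrizable mm1 (tendsto_pi_nhds.2 l1)
  have M2m : Measurable (H2 u v) := measurable_of_tendsto_metrizable mm2 (tendsto_pi_nhds.2 l2)
  have B1 : ∀ x, |H1 u v x| ≤ M1 := fun x =>
    le_of_tendsto' (l1 x).abs fun n => bb1 _ _ (Xbox n) x
  have B2 : ∀ x, |H2 u v x| ≤ M2 := fun x =>
    le_of_tendsto' (l2 x).abs fun n => bb2 _ _ (Xbox n) x
  have cu : Continuous u := by rw [q1]; exact GG_cont hp1 hm1 M1m B1
  have cv : Continuous v := by rw [q2]; exact GG_cont hp2 hm2 M2m B2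
  have C1 := c1 u v cu cv
  have C2 := c2 u v cu cv
  obtain ⟨U2, f1, f2, f3⟩ := GG_eqn one_pos hp1 hm1 e1 e1' C1 B1
  obtain ⟨V2, g1, g2, g3⟩ := GG_eqn hd hp2 hm2 e2 e2' C2 B2
  have du : ∀ x, HasDerivAt u (GG' 1 p1 m1 (H1 u v) x) x := by
    intro x
    have := GG_deriv (D := 1) hp1 hm1 C1 B1 x
    rwa [← q1] at this
  have dv : ∀ x, HasDerivAt v (GG' d p2 m2 (H2 u v) x) x := by
    intro x
    have := GG_deriv (D := d) hp2 hm2 C2 B2 x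
    rwa [← q2] at this
  obtain ⟨k1, k2, k3⟩ := contDiff_two du f1 f2
  obtain ⟨j1, j2, j3⟩ := contDiff_two dv g1 g2
  refine ⟨u, v, k1, j1, bx, fun x => ?_, fun x => ?_⟩
  · have := f3 x
    rw [← q1] at this
    rw [k3, k2]
    simp only [hH1] at this ⊢
    linarith
  · have := g3 x
    rw [← q2] at this
    rw [j3, j2]
    simp only [hH2] at this ⊢
    linarith

lemma tail_core (D s r : ℝ) (hD : 0 < D) (hs : 0 < s) (hr : 0 < r) (h : 4 * D * r ≤ s ^ 2) :
    ∃ (η C : ℝ) (φ φ' φ2 : ℝ → ℝ), 0 < η ∧ 0 < C ∧ (∀ x, HasDerivAt φ (φ' x) x) ∧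
      (∀ x, HasDerivAt φ' (φ2 x) x) ∧ (∀ x < 0, 0 < φ x) ∧ (∀ x ≤ 0, φ x ≤ C * exp (η * x)) ∧
      (∀ x, D * φ2 x - s * φ' x + r * φ x = 0) ∧
      ∀ K η' : ℝ, 0 < K → 0 < η' → η' ≤ η → ∃ (w w' w2 : ℝ → ℝ) (x1 : ℝ),
        (∀ x, HasDerivAt w (w' x) x) ∧ (∀ x, HasDerivAt w' (w2 x) x) ∧ x1 < 0 ∧
        (∀ x ≤ 0, w x ≤ φ x) ∧ w 0 ≤ 0 ∧ (∀ x ≤ x1, 0 < w x) ∧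
        ∀ x < 0, K * exp (η' * x) * φ x ≤ D * w2 x - s * w' x + r * w x := by
  have hE : ∀ (l x : ℝ), HasDerivAt (fun t => exp (l * t)) (l * exp (l * x)) x := by
    intro l x
    have := ((hasDerivAt_id x).const_mul l).exp
    refine this.congr_deriv ?_
    simp; ring
  rcases h.lt_or_eq with h | h
  · -- noncritical
    set Δ := √(s ^ 2 - 4 * D * r) with hΔ
    have hΔ2 : Δ ^ 2 = s ^ 2 - 4 * D * r := Real.sq_sqrt (by linarith)
    have hΔ0 : 0 < Δ := Real.sqrt_pos.2 (by linarith)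
    have hΔs : Δ < s := by
      have := mul_pos hD hr
      nlinarith
    set l := (s - Δ) / (2 * D) with hl
    have hl0 : 0 < l := div_pos (by linarith) (by positivity)
    have hl1 : 2 * D * l = s - Δ := by rw [hl]; field_simp
    have hl2 : D * l ^ 2 - s * l + r = 0 := by
      have : 4 * D * (D * l ^ 2 - s * l + r) = (2 * D * l) ^ 2 - 2 * s * (2 * D * l) + 4 * D * r := by ring
      rw [hl1] at this
      have h0 : 4 * D * (D * l ^ 2 - s * l + r) = 0 := by rw [this]; nlinarith
      have h4 : (4 * D) ≠ 0 := by positivity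
      exact (mul_eq_zero.1 h0).resolve_left h4
    refine ⟨min l (Δ / (2 * D)), 1, fun x => exp (l * x), fun x => l * exp (l * x),
      fun x => l * (l * exp (l * x)), by positivity, one_pos, hE l, fun x => (hE l x).const_mul l,
      fun x _ => exp_pos _, fun x hx => ?_, fun x => ?_, ?_⟩
    · rw [one_mul]
      exact exp_le_exp.2 (mul_le_mul_of_nonpos_right (min_le_left _ _) hx)
    · linear_combination exp (l * x) * hl2
    · intro K e hK he heη
      have he2 : 2 * D * e ≤ Δ := by
        have := heη.trans (min_le_right _ _)
        rw [le_div_iff₀ (by positivity)] at this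
        linarith
      set M := max 1 (2 * K / (e * Δ)) with hM
      have hM1 : 1 ≤ M := le_max_left _ _
      have hM2 : 2 * K ≤ M * (e * Δ) := by
        have := le_max_right 1 (2 * K / (e * Δ))
        rwa [div_le_iff₀ (by positivity)] at this
      refine ⟨fun x => exp (l * x) - M * exp ((l + e) * x),
        fun x => l * exp (l * x) - M * ((l + e) * exp ((l + e) * x)),
        fun x => l * (l * exp (l * x)) - M * ((l + e) * ((l + e) * exp ((l + e) * x))),
        -(Real.log M + 1) / e, fun x => (hE l x).sub ((hE (l + e) x).const_mul M),
        fun x => ((hE l x).const_mul l).sub (((hE (l + e) x).const_mul (l + e)).const_mul M), ?_, ?_, ?_, ?_, ?_⟩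
      · exact div_neg_of_neg_of_pos (by have := Real.log_nonneg hM1; linarith) he
      · intro x _
        have := exp_pos ((l + e) * x)
        nlinarith
      · simp; exact hM1
      · intro x hx
        rw [le_div_iff₀ he] at hx
        have k : M * exp (e * x) < 1 := by
          rw [← Real.exp_log (by linarith : 0 < M), ← exp_add, exp_lt_one_iff]
          linarith
        beta_reduce
        rw [add_mul l e x, exp_add]
        have := exp_pos (l * x)
        nlinarith
      · intro x _
        beta_reduce
        rw [add_mul l e x, exp_add]
        have k1 := exp_pos (l * x)
        have k2 := exp_pos (e * x)
        have k3 := mul_pos k1 k2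
        set P := exp (l * x)
        set Q := exp (e * x)
        have k4 : D * (l * (l * P) - M * ((l + e) * ((l + e) * (P * Q)))) - s * (l * P - M * ((l + e) * (P * Q)))
            + r * (P - M * (P * Q)) = (M * e * (Δ - D * e)) * (P * Q) := by
          linear_combination (P - M * P * Q) * hl2 - M * P * Q * e * hl1
        rw [k4]
        have k5 : K ≤ M * e * (Δ - D * e) := by
          have : M * e * (Δ / 2) ≤ M * e * (Δ - D * e) :=
            mul_le_mul_of_nonneg_left (by linarith) (by positivity)
          linarith
        nlinarith [mul_le_mul_of_nonneg_right k5 k3.le]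
  · -- critical
    set l := s / (2 * D) with hl
    have hl0 : 0 < l := by positivity
    have hl1 : 2 * D * l = s := by rw [hl]; field_simp
    have hl2 : r = D * l ^ 2 := by
      have : 4 * D * r = 4 * D * (D * l ^ 2) := by rw [h, ← hl1]; ring
      exact mul_left_cancel₀ (by positivity) this
    have hbd : ∀ k x : ℝ, 0 < k → x ≤ 0 → -x * exp (k * x) ≤ 1 / k := by
      intro k x hk hx
      have h1 := add_one_le_exp (-(k * x))
      have h2 : exp (-(k * x)) * exp (k * x) = 1 := by rw [← exp_add]; simp
      have h3 := exp_pos (k * x)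
      rw [le_div_iff₀ hk]
      nlinarith
    refine ⟨l / 2, 2 / l, fun x => -x * exp (l * x), fun x => -1 * exp (l * x) + -x * (l * exp (l * x)),
      fun x => -1 * (l * exp (l * x)) + (-1 * (l * exp (l * x)) + -x * (l * (l * exp (l * x)))),
      by positivity, by positivity, fun x => (hasDerivAt_neg x).mul (hE l x),
      fun x => ((hE l x).const_mul (-1)).add ((hasDerivAt_neg x).mul ((hE l x).const_mul l)),
      fun x hx => mul_pos (by linarith) (exp_pos _), fun x hx => ?_, fun x => ?_, ?_⟩
    · have h1 := hbd (l / 2) x (by positivity) hx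
      have h2 : exp (l * x) = exp (l / 2 * x) * exp (l / 2 * x) := by rw [← exp_add]; ring_nf
      beta_reduce
      rw [h2, ← mul_assoc]
      refine mul_le_mul_of_nonneg_right (h1.trans_eq (by field_simp)) (exp_pos _).le
    · rw [hl2, ← hl1]; ring
    · intro K e hK he heη
      set n := e / 2 with hn
      have hn0 : 0 < n := by positivity
      set M := K / (D * n ^ 3) with hM
      have hM0 : 0 < M := by positivity
      refine ⟨fun x => (-x - M * (1 - exp (n * x))) * exp (l * x),
        fun x => (-1 - M * (-(n * exp (n * x)))) * exp (l * x) + (-x - M * (1 - exp (n * x))) * (l * exp (l * x)),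
        fun x => ((- (M * (-(n * (n * exp (n * x)))))) * exp (l * x) + (-1 - M * (-(n * exp (n * x)))) * (l * exp (l * x)))
          + ((-1 - M * (-(n * exp (n * x)))) * (l * exp (l * x)) + (-x - M * (1 - exp (n * x))) * (l * (l * exp (l * x)))),
        -(M + 1), fun x => ?_, fun x => ?_, by linarith, ?_, by simp, ?_, ?_⟩
      · exact ((hasDerivAt_neg x).sub (((hE n x).const_sub 1).const_mul M)).mul (hE l x)
      · exact ((((((hE n x).const_mul n).neg).const_mul M).const_sub (-1)).mul (hE l x)).add
          (((hasDerivAt_neg x).sub (((hE n x).const_sub 1).const_mul M)).mul ((hE l x).const_mul l))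
      · intro x hx
        have : exp (n * x) ≤ 1 := exp_le_one_iff.2 (mul_nonpos_of_nonneg_of_nonpos hn0.le hx)
        exact mul_le_mul_of_nonneg_right (by nlinarith) (exp_pos _).le
      · intro x hx
        refine mul_pos ?_ (exp_pos _)
        have := exp_pos (n * x)
        nlinarith
      · intro x hx
        have k0 : D * (((- (M * (-(n * (n * exp (n * x)))))) * exp (l * x) + (-1 - M * (-(n * exp (n * x)))) * (l * exp (l * x)))
          + ((-1 - M * (-(n * exp (n * x)))) * (l * exp (l * x)) + (-x - M * (1 - exp (n * x))) * (l * (l * exp (l * x)))))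
          - s * ((-1 - M * (-(n * exp (n * x)))) * exp (l * x) + (-x - M * (1 - exp (n * x))) * (l * exp (l * x)))
          + r * ((-x - M * (1 - exp (n * x))) * exp (l * x)) = D * M * n ^ 2 * exp (n * x) * exp (l * x) := by
          rw [hl2, ← hl1]; ring
        rw [k0]
        have k1 : exp (e * x) = exp (n * x) * exp (n * x) := by rw [← exp_add, hn]; ring_nf
        have k2 := hbd n x hn0 hx.le
        have k3 : D * M * n ^ 2 = K * (1 / n) := by rw [hM]; field_simp
        rw [k1, k3]
        have k4 : 0 ≤ K * exp (n * x) * exp (l * x) := by positivity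
        nlinarith [mul_le_mul_of_nonneg_left k2 k4]

lemma tail (D s r B : ℝ) (hD : 0 < D) (hs : 0 < s) (hr : 0 < r) (h : 4 * D * r ≤ s ^ 2) (hB : 0 < B) :
    ∃ (η C : ℝ) (P : ℝ → ℝ), 0 < η ∧ 0 < C ∧ Continuous P ∧ (∀ x, 0 < P x) ∧ (∀ x, P x ≤ B) ∧
      (∀ x ≥ 0, P x = B) ∧ (∀ x ≤ 0, P x ≤ C * exp (η * x)) ∧
      (∀ x, P x < B → TouchSup D s P x (r * P x)) ∧
      ∀ K η' b : ℝ, 0 < K → 0 < η' → η' ≤ η → 0 < b → ∃ (p : ℝ → ℝ) (x1 : ℝ), Continuous p ∧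
        x1 < 0 ∧ (∀ x, 0 ≤ p x) ∧ (∀ x, p x ≤ b) ∧ (∀ x, p x ≤ P x) ∧ (∀ x ≥ 0, p x = 0) ∧
        (∀ x ≤ x1, 0 < p x) ∧
        ∀ x, 0 < p x → TouchSub D s p x ((r - K * exp (η' * x)) * p x) := by
  obtain ⟨η, C, φ, φ', φ2, hη, hC, d1, d2, hpos, hle, heq, hsub⟩ := tail_core D s r hD hs hr h
  have cφ : Continuous φ := continuous_iff_continuousAt.2 fun x => (d1 x).continuousAt
  have hφ1 : 0 < φ (-1) := hpos _ (by norm_num)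
  set A := max 1 (B / φ (-1)) with hA
  have hA1 : 1 ≤ A := le_max_left _ _
  have hA2 : B ≤ A * φ (-1) := by
    have := le_max_right 1 (B / φ (-1))
    rwa [div_le_iff₀ hφ1] at this
  set P : ℝ → ℝ := fun x => min (A * φ (min x (-1))) B with hP
  have P1 : ∀ x, -1 ≤ x → P x = B := by
    intro x hx
    simp only [hP, min_eq_right hx, min_eq_right hA2]
  have P2 : ∀ x, x ≤ -1 → P x = min (A * φ x) B := by
    intro x hx
    simp only [hP, min_eq_left hx]
  refine ⟨η, A * C + B * exp η, P, hη, by positivity, by fun_prop, fun x => ?_, fun x => min_le_right _ _,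
    fun x hx => P1 x (by linarith), fun x hx => ?_, fun x hx => ?_, ?_⟩
  · refine lt_min (mul_pos (by linarith) (hpos _ ?_)) hB
    exact (min_le_right _ _).trans_lt (by norm_num)
  · rcases le_total x (-1) with h1 | h1
    · rw [P2 x h1]
      have k1 := mul_le_mul_of_nonneg_left (hle x hx) (by linarith : 0 ≤ A)
      have k2 : 0 ≤ B * exp η * exp (η * x) := by positivity
      have := min_le_left (A * φ x) B
      nlinarith
    · rw [P1 x h1]
      have k1 : 1 ≤ exp η * exp (η * x) := by
        rw [← exp_add]; exact one_le_exp (by nlinarith)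
      have k2 : 0 ≤ A * C * exp (η * x) := by positivity
      nlinarith
  · have h1 : x < -1 := by
      by_contra hc
      push Not at hc
      rw [P1 x hc] at hx
      exact lt_irrefl _ hx
    have h2 : P x = A * φ x := by
      rw [P2 x h1.le] at hx ⊢
      rcases min_lt_iff.1 hx with h | h
      · exact min_eq_left h.le
      · exact absurd h (lt_irrefl _)
    refine ⟨fun t => A * φ t, fun t => A * φ' t, A * φ2 x, Eventually.of_forall fun t => (d1 t).const_mul A,
      (d2 x).const_mul A, h2.symm, ?_, ?_⟩
    · filter_upwards [eventually_lt_nhds h1] with t ht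
      rw [P2 t ht.le]; exact min_le_left _ _
    · rw [h2]
      have := heq x
      have e : D * (A * φ2 x) - s * (A * φ' x) + r * (A * φ x) = A * (D * φ2 x - s * φ' x + r * φ x) := by ring
      rw [e, this, mul_zero]
  · intro K e b hK he heη hb
    obtain ⟨w, w', w2, x1, f1, f2, hx1, f3, f4, f5, f6⟩ := hsub K e hK he heη
    have cw : Continuous w := continuous_iff_continuousAt.2 fun x => (f1 x).continuousAt
    set i := min 1 (min b B / C) with hi
    have hi0 : 0 < i := by positivity
    have hi1 : i ≤ 1 := min_le_left _ _
    have hi2 : i * C ≤ min b B := by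
      have := min_le_right 1 (min b B / C)
      rwa [le_div_iff₀ hC] at this
    set p : ℝ → ℝ := fun x => i * max 0 (w (min x 0)) with hp
    have p1 : ∀ x ≥ 0, p x = 0 := by
      intro x hx
      simp only [hp, min_eq_right hx, max_eq_left f4, mul_zero]
    have p2 : ∀ x ≤ 0, p x = i * max 0 (w x) := by
      intro x hx
      simp only [hp, min_eq_left hx]
    have p3 : ∀ x, p x ≤ min b B := by
      intro x
      rcases le_total 0 x with hx | hx
      · rw [p1 x hx]; positivity
      · rw [p2 x hx]
        refine le_trans ?_ hi2
        refine mul_le_mul_of_nonneg_left (max_le hC.le ?_) hi0.le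
        refine (f3 x hx).trans ((hle x hx).trans ?_)
        have : exp (η * x) ≤ 1 := exp_le_one_iff.2 (mul_nonpos_of_nonneg_of_nonpos hη.le hx)
        nlinarith
    refine ⟨p, x1, by fun_prop, hx1, fun x => by positivity, fun x => (p3 x).trans (min_le_left _ _),
      fun x => ?_, p1, fun x hx => ?_, fun x hx => ?_⟩
    · rcases le_total x (-1) with h1 | h1
      · rw [P2 x h1]
        refine le_min ?_ ((p3 x).trans (min_le_right _ _))
        rw [p2 x (by linarith)]
        have k1 : max 0 (w x) ≤ φ x := max_le (hpos x (by linarith)).le (f3 x (by linarith))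
        have k2 := hpos x (by linarith)
        calc i * max 0 (w x) ≤ 1 * φ x := by gcongr
          _ ≤ A * φ x := by gcongr
      · rw [P1 x h1]; exact (p3 x).trans (min_le_right _ _)
    · rw [p2 x (by linarith)]
      exact mul_pos hi0 (lt_max_of_lt_right (f5 x hx))
    · have h1 : x < 0 := by
        by_contra hc
        push Not at hc
        rw [p1 x hc] at hx
        exact lt_irrefl _ hx
      have h2 : p x = i * w x := by
        rw [p2 x h1.le] at hx ⊢
        rcases lt_max_iff.1 (pos_of_mul_pos_right hx hi0.le) with h | h
        · exact absurd h (lt_irrefl _)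
        · rw [max_eq_right h.le]
      refine ⟨fun t => i * w t, fun t => i * w' t, i * w2 x, Eventually.of_forall fun t => (f1 t).const_mul i,
        (f2 x).const_mul i, h2.symm, ?_, ?_⟩
      · filter_upwards [eventually_lt_nhds h1] with t ht
        rw [p2 t ht.le]; exact mul_le_mul_of_nonneg_left (le_max_right _ _) hi0.le
      · rw [h2]
        have k1 := f6 x h1
        have k2 := f3 x h1.le
        have k3 : 0 ≤ K * exp (e * x) := by positivity
        have k4 := mul_le_mul_of_nonneg_left k2 k3
        have k5 : 0 ≤ i * (D * w2 x - s * w' x + r * w x - K * exp (e * x) * w x) :=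
          mul_nonneg hi0.le (by linarith)
        linarith

lemma slow (s d ε δ τ : ℝ) (hs : 0 < s) (hd : 0 < d) (hε : 0 < ε) (hδ : 0 < δ) (hτ : 0 < τ) :
    ∃ y y' y2 : ℝ → ℝ, (∀ x, HasDerivAt y (y' x) x) ∧ (∀ x, HasDerivAt y' (y2 x) x) ∧
      (∀ x, 0 < y x) ∧ (∀ x, y x < 1) ∧ Monotone y ∧ y 0 ≤ τ ∧ Tendsto y atTop (𝓝 1) ∧
      (∀ x, 0 ≤ y2 x - s * y' x + ε * (y x * (1 - y x))) ∧
      (∀ x, -(d * y2 x) + s * y' x ≤ δ * (1 - y x) ^ 2) := by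
  obtain ⟨κ, hκ, hκ1, hκ2⟩ : ∃ κ : ℝ, 0 < κ ∧ 2 * κ ^ 2 + s * κ ≤ ε ∧ 2 * d * κ ^ 2 + s * κ ≤ δ := by
    have h1 : Tendsto (fun k : ℝ => 2 * k ^ 2 + s * k) (𝓝[>] 0) (𝓝 (2 * 0 ^ 2 + s * 0)) :=
      ((by fun_prop : Continuous fun k : ℝ => 2 * k ^ 2 + s * k).tendsto 0).mono_left nhdsWithin_le_nhds
    have h2 : Tendsto (fun k : ℝ => 2 * d * k ^ 2 + s * k) (𝓝[>] 0) (𝓝 (2 * d * 0 ^ 2 + s * 0)) :=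
      ((by fun_prop : Continuous fun k : ℝ => 2 * d * k ^ 2 + s * k).tendsto 0).mono_left nhdsWithin_le_nhds
    have e1 := h1.eventually (eventually_lt_nhds (b := ε) (by simpa using hε))
    have e2 := h2.eventually (eventually_lt_nhds (b := δ) (by simpa using hδ))
    obtain ⟨k, ⟨k1, k2⟩, k3⟩ := ((e1.and e2).and self_mem_nhdsWithin).exists
    exact ⟨k, k3, k1.le, k2.le⟩
  set F : ℝ → ℝ := fun x => τ * exp (κ * x) with hF
  have F0 : ∀ x, 0 < F x := fun x => by simp only [hF]; positivity
  have dF : ∀ x, HasDerivAt F (κ * F x) x := by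
    intro x
    have := (((hasDerivAt_id x).const_mul κ).exp).const_mul τ
    refine this.congr_deriv ?_
    simp [hF]; ring
  set E : ℝ → ℝ := fun x => Real.log (1 + F x) with hE
  set E1 : ℝ → ℝ := fun x => κ * F x / (1 + F x) with hE1
  set E2 : ℝ → ℝ := fun x => κ ^ 2 * F x / (1 + F x) ^ 2 with hE2
  have E0 : ∀ x, 0 < E x := fun x => Real.log_pos (by have := F0 x; linarith)
  have dE : ∀ x, HasDerivAt E (E1 x) x := fun x =>
    ((dF x).const_add 1).log (by have := F0 x; positivity)
  have dE1 : ∀ x, HasDerivAt E1 (E2 x) x := by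
    intro x
    have h0 := F0 x
    have := ((dF x).const_mul κ).div ((dF x).const_add 1) (by positivity)
    refine this.congr_deriv ?_
    simp only [hE2]
    field_simp
    ring
  have E1nn : ∀ x, 0 ≤ E1 x := fun x => by have := F0 x; simp only [hE1]; positivity
  have E2nn : ∀ x, 0 ≤ E2 x := fun x => by have := F0 x; simp only [hE2]; positivity
  have E1k : ∀ x, E1 x ≤ κ := fun x => by
    have := F0 x
    simp only [hE1]
    rw [div_le_iff₀ (by positivity)]; nlinarith
  have E1E : ∀ x, E1 x ≤ κ * E x := fun x => by
    have h0 := F0 x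
    have := Real.one_sub_inv_le_log_of_pos (show 0 < 1 + F x by positivity)
    simp only [hE1, hE]
    have e : κ * F x / (1 + F x) = κ * (1 - (1 + F x)⁻¹) := by field_simp; ring
    rw [e]
    exact mul_le_mul_of_nonneg_left this hκ.le
  have dy : ∀ x, HasDerivAt (fun x => 1 - (1 + E x)⁻¹) (E1 x / (1 + E x) ^ 2) x := by
    intro x
    have h0 := E0 x
    have := (((dE x).const_add 1).inv (by positivity)).const_sub 1
    refine this.congr_deriv ?_
    ring
  have dy2 : ∀ x, HasDerivAt (fun x => E1 x / (1 + E x) ^ 2)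
      (E2 x / (1 + E x) ^ 2 - 2 * E1 x ^ 2 / (1 + E x) ^ 3) x := by
    intro x
    have h0 := E0 x
    have := (dE1 x).div (((dE x).const_add 1).pow 2) (by change (1 + E x) ^ 2 ≠ 0; positivity)
    refine this.congr_deriv ?_
    simp
    field_simp
  have hy1 : ∀ x, 1 - (1 - (1 + E x)⁻¹) = 1 / (1 + E x) := fun x => by simp
  have hy0 : ∀ x, 1 - (1 + E x)⁻¹ = E x / (1 + E x) := fun x => by
    have := E0 x
    field_simp; ring
  refine ⟨fun x => 1 - (1 + E x)⁻¹, fun x => E1 x / (1 + E x) ^ 2,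
    fun x => E2 x / (1 + E x) ^ 2 - 2 * E1 x ^ 2 / (1 + E x) ^ 3, dy, dy2, fun x => ?_, fun x => ?_,
    ?_, ?_, ?_, fun x => ?_, fun x => ?_⟩
  · have := E0 x; beta_reduce; rw [hy0]; positivity
  · have := E0 x
    have : 0 < (1 + E x)⁻¹ := by positivity
    beta_reduce; linarith
  · refine monotone_of_deriv_nonneg (fun x => (dy x).differentiableAt) fun x => ?_
    rw [(dy x).deriv]
    have := E1nn x
    positivity
  · beta_reduce
    rw [hy0]
    have h0 := E0 0
    have h1 : E 0 ≤ τ := by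
      have := Real.log_le_sub_one_of_pos (show 0 < 1 + F 0 by have := F0 0; positivity)
      have e : F 0 = τ := by simp [hF]
      rw [e] at this
      simp only [hE, e]; linarith
    rw [div_le_iff₀ (by positivity)]
    nlinarith
  · have h1 : Tendsto F atTop atTop := by
      have : Tendsto (fun x => κ * x) atTop atTop := tendsto_id.const_mul_atTop hκ
      exact (tendsto_exp_atTop.comp this).const_mul_atTop hτ
    have h2 : Tendsto E atTop atTop :=
      Real.tendsto_log_atTop.comp (tendsto_atTop_add_const_left _ 1 h1)
    have h3 : Tendsto (fun x => 1 + E x) atTop atTop := tendsto_atTop_add_const_left _ 1 h2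
    have := (tendsto_inv_atTop_zero.comp h3).const_sub 1
    simpa using this
  · beta_reduce
    rw [hy1, hy0]
    have h0 := E0 x
    have h1 := E1nn x
    have h2 := E2nn x
    have h3 := E1k x
    have h4 := E1E x
    have k1 : 2 * E1 x ^ 2 / (1 + E x) ≤ 2 * κ * (κ * E x) := by
      rw [div_le_iff₀ (by positivity)]
      have : E1 x ^ 2 ≤ κ * (κ * E x) := by
        rw [sq]; exact mul_le_mul h3 h4 h1 hκ.le
      have : 0 ≤ 2 * κ * (κ * E x) * E x := by positivity
      nlinarith
    have k2 : s * E1 x ≤ s * (κ * E x) := mul_le_mul_of_nonneg_left h4 hs.le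
    have k3 : 0 ≤ E2 x - 2 * E1 x ^ 2 / (1 + E x) - s * E1 x + ε * E x := by
      nlinarith [mul_le_mul_of_nonneg_right hκ1 h0.le]
    have e : E2 x / (1 + E x) ^ 2 - 2 * E1 x ^ 2 / (1 + E x) ^ 3 - s * (E1 x / (1 + E x) ^ 2)
        + ε * (E x / (1 + E x) * (1 / (1 + E x)))
        = (E2 x - 2 * E1 x ^ 2 / (1 + E x) - s * E1 x + ε * E x) / (1 + E x) ^ 2 := by
      field_simp
    rw [e]
    positivity
  · beta_reduce
    rw [hy1]
    have h0 := E0 x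
    have h1 := E1nn x
    have h2 := E2nn x
    have h3 := E1k x
    have k1 : 2 * E1 x ^ 2 / (1 + E x) ≤ 2 * κ ^ 2 := by
      rw [div_le_iff₀ (by positivity)]
      have : E1 x ^ 2 ≤ κ ^ 2 := by gcongr
      have : 0 ≤ 2 * κ ^ 2 * E x := by positivity
      nlinarith
    have k2 : s * E1 x ≤ s * κ := mul_le_mul_of_nonneg_left h3 hs.le
    have k3 : -(d * E2 x) + d * (2 * E1 x ^ 2 / (1 + E x)) + s * E1 x ≤ δ := by
      nlinarith [mul_le_mul_of_nonneg_left k1 hd.le, mul_nonneg hd.le h2]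
    have e : -(d * (E2 x / (1 + E x) ^ 2 - 2 * E1 x ^ 2 / (1 + E x) ^ 3)) + s * (E1 x / (1 + E x) ^ 2)
        = (-(d * E2 x) + d * (2 * E1 x ^ 2 / (1 + E x)) + s * E1 x) / (1 + E x) ^ 2 := by
      field_simp
      ring
    have e' : δ * (1 / (1 + E x)) ^ 2 = δ / (1 + E x) ^ 2 := by field_simp
    rw [e, e']
    gcongr

lemma TouchSup.of_le {D s : ℝ} {f g : ℝ → ℝ} {x y : ℝ} (h : TouchSup D s f x y)
    (hle : ∀ᶠ t in 𝓝 x, g t ≤ f t) (he : g x = f x) : TouchSup D s g x y := by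
  obtain ⟨ψ, ψ', p2, h1, h2, h3, h4, h5⟩ := h
  exact ⟨ψ, ψ', p2, h1, h2, h3.trans he.symm, by filter_upwards [h4, hle] with t a b using b.trans a, h5⟩

lemma TouchSub.of_le {D s : ℝ} {f g : ℝ → ℝ} {x y : ℝ} (h : TouchSub D s f x y)
    (hle : ∀ᶠ t in 𝓝 x, f t ≤ g t) (he : g x = f x) : TouchSub D s g x y := by
  obtain ⟨ψ, ψ', p2, h1, h2, h3, h4, h5⟩ := h
  exact ⟨ψ, ψ', p2, h1, h2, h3.trans he.symm, by filter_upwards [h4, hle] with t a b using a.trans b, h5⟩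

lemma touchSup_const (D s k x y : ℝ) (hy : y ≤ 0) : TouchSup D s (fun _ => k) x y :=
  ⟨fun _ => k, fun _ => 0, 0, Eventually.of_forall fun t => hasDerivAt_const t k, hasDerivAt_const x 0,
    rfl, Eventually.of_forall fun _ => le_rfl, by simpa using hy⟩

lemma touchSub_const (D s k x y : ℝ) (hy : 0 ≤ y) : TouchSub D s (fun _ => k) x y :=
  ⟨fun _ => k, fun _ => 0, 0, Eventually.of_forall fun t => hasDerivAt_const t k, hasDerivAt_const x 0,
    rfl, Eventually.of_forall fun _ => le_rfl, by simpa using hy⟩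

lemma tendsto_tail {f : ℝ → ℝ} {C η : ℝ} (hη : 0 < η) (h0 : ∀ x, 0 ≤ f x)
    (h : ∀ x ≤ 0, f x ≤ C * exp (η * x)) : Tendsto f atBot (𝓝 0) := by
  have h1 : Tendsto (fun x => C * exp (η * x)) atBot (𝓝 0) := by
    have : Tendsto (fun x => η * x) atBot atBot := tendsto_id.const_mul_atBot hη
    simpa using (tendsto_exp_atBot.comp this).const_mul C
  exact tendsto_of_tendsto_of_tendsto_of_le_of_le' tendsto_const_nhds h1
    (Eventually.of_forall h0) ((eventually_le_atBot 0).mono h)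

set_option maxHeartbeats 1000000 in
/-- Existence of a non-trivial front-pulse solution in the degenerate case
`b = a < 1/c`: the `v`-component is a nontrivial pulse tending to `0` at both
ends, while `u` connects `0` to `1`. -/
theorem front_pulse_v
    (a c d : ℝ) (ha : 0 < a) (hc : 0 < c) (hac : a < 1 / c) (hd : 0 < d)
    (s : ℝ) (hs : max 2 (2 * Real.sqrt (a * d)) ≤ s) :
    ∃ u v : ℝ → ℝ, ContDiff ℝ 2 u ∧ ContDiff ℝ 2 v ∧
      (∀ ξ : ℝ, 0 < u ξ) ∧ (∀ ξ : ℝ, 0 ≤ v ξ) ∧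
      (∃ ξ : ℝ, v ξ ≠ 0) ∧
      (∀ ξ : ℝ, deriv (deriv u) ξ - s * deriv u ξ + u ξ * (1 - u ξ - c * v ξ) = 0) ∧
      (∀ ξ : ℝ, d * deriv (deriv v) ξ - s * deriv v ξ + v ξ * (a * (1 - u ξ) - v ξ) = 0) ∧
      Tendsto u atBot (nhds 0) ∧ Tendsto v atBot (nhds 0) ∧
      Tendsto u atTop (nhds 1) ∧ Tendsto v atTop (nhds 0) := by
  have hs2 : 2 ≤ s := (le_max_left _ _).trans hs
  have hs0 : 0 < s := by linarith
  have hs3 : 4 * d * a ≤ s ^ 2 := by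
    have h1 := (le_max_right _ _).trans hs
    have h2 := Real.sq_sqrt (mul_pos ha hd).le
    have h3 := Real.sqrt_nonneg (a * d)
    nlinarith
  obtain ⟨q, hq1, hq2⟩ := exists_between hac
  have hq0 : 0 < q := ha.trans hq1
  have hcq : c * q < 1 := by rw [lt_div_iff₀ hc] at hq2; linarith
  obtain ⟨ηu, Cu, Pu, hηu, hCu, cPu, Pu0, Pu1, Pu2, Pu3, Pu4, hsubu⟩ :=
    tail 1 s 1 1 one_pos hs0 one_pos (by nlinarith) one_pos
  obtain ⟨ηv, Cv, Pv, hηv, hCv, cPv, Pv0, Pv1, Pv2, Pv3, Pv4, hsubv⟩ :=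
    tail d s a q hd hs0 ha hs3 hq0
  set η := min ηu ηv with hη
  have hη0 : 0 < η := lt_min hηu hηv
  have Pu3' : ∀ x ≤ 0, Pu x ≤ Cu * exp (η * x) := fun x hx => (Pu3 x hx).trans <|
    mul_le_mul_of_nonneg_left (exp_le_exp.2 (mul_le_mul_of_nonpos_right (min_le_left _ _) hx)) hCu.le
  have Pv3' : ∀ x ≤ 0, Pv x ≤ Cv * exp (η * x) := fun x hx => (Pv3 x hx).trans <|
    mul_le_mul_of_nonneg_left (exp_le_exp.2 (mul_le_mul_of_nonpos_right (min_le_right _ _) hx)) hCv.le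
  obtain ⟨pu, xa, cpu, hxa, pu0, -, pu1, pu2, pu3, pu4⟩ :=
    hsubu (Cu + c * Cv) η 1 (by positivity) hη0 (min_le_left _ _) one_pos
  obtain ⟨pv, xb, cpv, hxb, pv0, pvb, pv1, pv2, pv3, pv4⟩ :=
    hsubv (a * Cu + Cv) η (q / 2) (by positivity) hη0 (min_le_right _ _) (by positivity)
  obtain ⟨m, hm0, hm⟩ : ∃ m > 0, ∀ x ∈ Icc xa 0, m ≤ Pu x := by
    obtain ⟨xm, -, h⟩ := isCompact_Icc.exists_isMinOn (nonempty_Icc.2 hxa.le) cPu.continuousOn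
    exact ⟨Pu xm, Pu0 xm, fun x hx => h hx⟩
  set δ := q - a with hδ
  have hδ0 : 0 < δ := sub_pos.2 hq1
  obtain ⟨τ, hτ0, hτ1, hτ2, hτ3, hτ4⟩ : ∃ τ : ℝ, 0 < τ ∧ τ ≤ m ∧ τ ≤ pu xa / 2 ∧ τ ≤ 1 / 2 ∧
      a ≤ (a + δ / 2) * (1 - τ) := by
    have hpa := pu3 xa le_rfl
    refine ⟨min (min m (pu xa / 2)) (min (1 / 2) ((δ / 2) / (a + δ / 2))), by positivity,
      (min_le_left _ _).trans (min_le_left _ _), (min_le_left _ _).trans (min_le_right _ _),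
      (min_le_right _ _).trans (min_le_left _ _), ?_⟩
    set τ := min (min m (pu xa / 2)) (min (1 / 2) ((δ / 2) / (a + δ / 2)))
    have : τ ≤ (δ / 2) / (a + δ / 2) := (min_le_right _ _).trans (min_le_right _ _)
    rw [le_div_iff₀ (by positivity)] at this
    linarith
  obtain ⟨y, y', y2, dy, dy', y0, y1, ymono, yτ, ylim, yA, yB⟩ :=
    slow s d (1 - c * q) (δ / 2) τ hs0 hd (by linarith) (by positivity) hτ0
  have cy : Continuous y := continuous_iff_continuousAt.2 fun x => (dy x).continuousAt
  have yneg : ∀ x ≤ 0, y x ≤ τ := fun x hx => (ymono hx).trans yτ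
  set ul : ℝ → ℝ := fun x => if x ≤ xa then pu x else max (pu x) (y x) with hul
  set uu : ℝ → ℝ := fun x => min (Pu x) 1 with huu
  set vu : ℝ → ℝ := fun x => min (Pv x) (q * (1 - y x)) with hvu
  have cul : Continuous ul := by
    refine Continuous.if_le cpu (cpu.max cy) continuous_id continuous_const fun x hx => ?_
    have hx' : x = xa := hx
    rw [hx', max_eq_left]
    have := yneg xa hxa.le
    have := pu0 xa
    linarith
  have ul1 : ∀ x ≤ xa, ul x = pu x := fun x hx => if_pos hx
  have ul2 : ∀ x, xa < x → ul x = max (pu x) (y x) := fun x hx => if_neg (not_le.2 hx)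
  have ulpu : ∀ x, pu x ≤ ul x := fun x => by
    rcases le_or_gt x xa with h | h
    · rw [ul1 x h]
    · rw [ul2 x h]; exact le_max_left _ _
  have uly : ∀ x, xa < x → y x ≤ ul x := fun x h => by rw [ul2 x h]; exact le_max_right _ _
  have ul0 : ∀ x, 0 < ul x := fun x => by
    rcases le_or_gt x xa with h | h
    · rw [ul1 x h]; exact pu3 x h
    · exact (y0 x).trans_le (uly x h)
  have z0 : ∀ x, 0 < 1 - y x := fun x => sub_pos.2 (y1 x)
  have vu0 : ∀ x, 0 < vu x := fun x => lt_min (Pv0 x) (mul_pos hq0 (z0 x))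
  have hneg_u : ∀ x, 0 < pu x → x < 0 := fun x hx => by
    by_contra h; push Not at h; rw [pu2 x h] at hx; exact lt_irrefl _ hx
  have hneg_v : ∀ x, 0 < pv x → x < 0 := fun x hx => by
    by_contra h; push Not at h; rw [pv2 x h] at hx; exact lt_irrefl _ hx
  have T1 : ∀ x, TouchSub 1 s ul x (ul x * (1 - ul x - c * vu x)) := by
    intro x
    have caseA : 0 < pu x → ul x = pu x → TouchSub 1 s ul x (ul x * (1 - ul x - c * vu x)) := by
      intro hp he
      have hx := hneg_u x hp
      refine ((pu4 x hp).of_le (Eventually.of_forall ulpu) he).mono ?_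
      rw [he, mul_comm (pu x)]
      refine mul_le_mul_of_nonneg_right ?_ hp.le
      have k1 := (pu1 x).trans (Pu3' x hx.le)
      have k2 := mul_le_mul_of_nonneg_left ((min_le_left (Pv x) (q * (1 - y x))).trans (Pv3' x hx.le)) hc.le
      simp only [hvu]
      linarith
    rcases le_or_gt x xa with h | h
    · exact caseA (pu3 x h) (ul1 x h)
    · rcases le_or_gt (y x) (pu x) with h' | h'
      · exact caseA ((y0 x).trans_le h') (by rw [ul2 x h, max_eq_left h'])
      · have e : ul x = y x := by rw [ul2 x h, max_eq_right h'.le]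
        refine ⟨y, y', y2 x, Eventually.of_forall dy, dy' x, e.symm, ?_, ?_⟩
        · filter_upwards [eventually_gt_nhds h] with t ht using uly t ht
        · rw [e]
          have k1 := yA x
          have k2 : c * vu x ≤ c * (q * (1 - y x)) := mul_le_mul_of_nonneg_left (min_le_right _ _) hc.le
          have k3 : (1 - c * q) * (y x * (1 - y x)) ≤ y x * (1 - y x - c * vu x) := by
            nlinarith [mul_le_mul_of_nonneg_left k2 (y0 x).le]
          linarith
  have T2 : ∀ x, TouchSup d s vu x (vu x * (a * (1 - ul x) - vu x)) := by
    intro x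
    rcases lt_or_ge (Pv x) (q * (1 - y x)) with h | h
    · have e : vu x = Pv x := min_eq_left h.le
      have hlt : Pv x < q := h.trans (by nlinarith [y0 x])
      refine ((Pv4 x hlt).of_le (g := vu) (Eventually.of_forall fun t => min_le_left _ _) e).mono ?_
      rw [e]
      have k1 := Pv0 x
      have k2 := ul0 x
      nlinarith [mul_pos k1 (mul_pos ha k2), mul_pos k1 k1]
    · have e : vu x = q * (1 - y x) := min_eq_right h
      refine ⟨fun t => q * (1 - y t), fun t => q * (-(y' t)), q * (-(y2 x)),
        Eventually.of_forall fun t => ((dy t).const_sub 1).const_mul q, ((dy' x).neg).const_mul q, e.symm,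
        Eventually.of_forall fun t => min_le_right _ _, ?_⟩
      rw [e]
      have k1 : a * (1 - ul x) ≤ (a + δ / 2) * (1 - y x) := by
        rcases le_or_gt x xa with h | h
        · have j1 := yneg x (h.trans hxa.le)
          have j2 : (a + δ / 2) * (1 - τ) ≤ (a + δ / 2) * (1 - y x) :=
            mul_le_mul_of_nonneg_left (by linarith) (by positivity)
          nlinarith [mul_pos ha (ul0 x)]
        · have j1 := uly x h
          nlinarith [mul_nonneg ha.le (sub_nonneg.2 j1), mul_pos hδ0 (z0 x)]
      have k2 := yB x
      have k3 : q * (1 - y x) * (a * (1 - ul x) - q * (1 - y x)) ≤ q * (1 - y x) * (-(δ / 2) * (1 - y x)) := by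
        refine mul_le_mul_of_nonneg_left ?_ (mul_pos hq0 (z0 x)).le
        have : q * (1 - y x) = (a + δ / 2) * (1 - y x) + δ / 2 * (1 - y x) := by rw [hδ]; ring
        linarith
      have k4 := mul_le_mul_of_nonneg_left k2 hq0.le
      linarith
  have T3 : ∀ x, TouchSup 1 s uu x (uu x * (1 - uu x - c * pv x)) := by
    intro x
    rcases lt_or_ge (Pu x) 1 with h | h
    · have e : uu x = Pu x := min_eq_left h.le
      refine ((Pu4 x h).of_le (g := uu) (Eventually.of_forall fun t => min_le_left _ _) e).mono ?_
      rw [e, mul_comm]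
      refine mul_le_mul_of_nonneg_right ?_ (Pu0 x).le
      have := mul_nonneg hc.le (pv0 x)
      have := Pu0 x
      linarith
    · have e : uu x = 1 := min_eq_right h
      refine (touchSup_const 1 s 1 x _ ?_).of_le (Eventually.of_forall fun t => min_le_right _ _) e
      rw [e]
      have := mul_nonneg hc.le (pv0 x)
      linarith
  have T4 : ∀ x, TouchSub d s pv x (pv x * (a * (1 - uu x) - pv x)) := by
    intro x
    rcases (pv0 x).eq_or_lt with h | h
    · refine (touchSub_const d s 0 x _ ?_).of_le (Eventually.of_forall pv0) h.symm
      rw [← h]; simp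
    · have hx := hneg_v x h
      refine (pv4 x h).mono ?_
      rw [mul_comm (pv x)]
      refine mul_le_mul_of_nonneg_right ?_ h.le
      have k1 := (pv1 x).trans (Pv3' x hx.le)
      have k2 := mul_le_mul_of_nonneg_left ((min_le_left (Pu x) 1).trans (Pu3' x hx.le)) ha.le
      simp only [huu]
      linarith
  have ord1 : ∀ x, ul x ≤ uu x := by
    intro x
    refine le_min ?_ ?_
    · rcases le_or_gt x xa with h | h
      · rw [ul1 x h]; exact pu1 x
      · rw [ul2 x h]
        refine max_le (pu1 x) ?_
        rcases le_total x 0 with h0 | h0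
        · exact (yneg x h0).trans (hτ1.trans (hm x ⟨h.le, h0⟩))
        · rw [Pu2 x h0]; exact (y1 x).le
    · rcases le_or_gt x xa with h | h
      · rw [ul1 x h]; exact (pu1 x).trans (Pu1 x)
      · rw [ul2 x h]; exact max_le ((pu1 x).trans (Pu1 x)) (y1 x).le
  have ord2 : ∀ x, pv x ≤ vu x := by
    intro x
    refine le_min (pv1 x) ?_
    rcases le_total 0 x with h | h
    · rw [pv2 x h]; exact (mul_pos hq0 (z0 x)).le
    · have k1 := yneg x h
      have k2 := pvb x
      nlinarith
  obtain ⟨u, v, hu, hv, hbox, eu, ev⟩ := exists_sol a c d s q ha hc hd hq0 ul uu pv vu cul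
    (by fun_prop) cpv (by fun_prop) (fun x => (ul0 x).le) ord1 (fun x => min_le_right _ _) pv0
    ord2 (fun x => (min_le_left _ _).trans (Pv1 x)) T1 T2 T3 T4
  · have u0 : ∀ x, 0 < u x := fun x => (ul0 x).trans_le (hbox x).1
    have v0 : ∀ x, 0 ≤ v x := fun x => (pv0 x).trans (hbox x).2.2.1
    refine ⟨u, v, hu, hv, u0, v0, ⟨xb, ?_⟩, eu, ev, ?_, ?_, ?_, ?_⟩
    · exact ((pv3 xb le_rfl).trans_le (hbox xb).2.2.1).ne'
    · exact tendsto_tail hη0 (fun x => (u0 x).le) fun x hx =>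
        ((hbox x).2.1.trans (min_le_left _ _)).trans (Pu3' x hx)
    · exact tendsto_tail hη0 v0 fun x hx =>
        ((hbox x).2.2.2.trans (min_le_left _ _)).trans (Pv3' x hx)
    · refine tendsto_of_tendsto_of_tendsto_of_le_of_le' ylim tendsto_const_nhds ?_
        (Eventually.of_forall fun x => (hbox x).2.1.trans (min_le_right _ _))
      filter_upwards [eventually_gt_atTop xa] with x hx
      exact (uly x hx).trans (hbox x).1
    · have h1 : Tendsto (fun x => q * (1 - y x)) atTop (𝓝 0) := by
        simpa using (ylim.const_sub 1).const_mul q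
      exact tendsto_of_tendsto_of_tendsto_of_le_of_le tendsto_const_nhds h1 v0
        (fun x => (hbox x).2.2.2.trans (min_le_right _ _))
end

section
/- Assume d > 0, strict weak competition 0 < b < a < 1/c, and s > s* := max{2, 2√(a·d)}. Set λ₁ := (s − √(s² − 4))/2 and λ₂ := (s − √(s² − 4·a·d))/(2d). Then there exists a positive twice continuously differentiable solution (u, v) of u'' − s·u' + u·(1 − u − c·v) = 0 and d·v'' − s·v' + v·(a − b·u − v) = 0 on ℝ satisfying: u(ξ) ≤ min{1, e^{λ₁·ξ}} and v(ξ) ≤ min{a, a·e^{λ₂·ξ}} for all ξ ∈ ℝ; there exist constants δ₁, δ₂ > 0 and Ξ ∈ ℝ with u(ξ) ≥ δ₁ and v(ξ) ≥ δ₂ for all ξ ≥ Ξ; and lim_{ξ→−∞}(u(ξ), v(ξ)) = (0, 0). -/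
open Filter Real

noncomputable def lvP (μ : ℝ) (h : ℝ → ℝ) (x : ℝ) : ℝ :=
  Real.exp (μ * x) * ∫ y in Set.Ioi x, Real.exp (-μ * y) * h y

noncomputable def lvN (ν : ℝ) (h : ℝ → ℝ) (x : ℝ) : ℝ := lvP ν (fun y => h (-y)) (-x)

noncomputable def lvT (μ ν : ℝ) (h : ℝ → ℝ) : ℝ → ℝ := lvN ν (lvP μ h)

lemma lv_integrable {μ M : ℝ} (hμ : 0 < μ) {h : ℝ → ℝ} (hc : Continuous h)
    (hM : ∀ x, |h x| ≤ M) (x : ℝ) :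
    MeasureTheory.IntegrableOn (fun y => Real.exp (-μ * y) * h y) (Set.Ioi x) := by
  have h1 : MeasureTheory.IntegrableOn (fun y => Real.exp (-μ * y) * M) (Set.Ioi x) :=
    (integrableOn_exp_mul_Ioi (by linarith) x).mul_const M
  refine MeasureTheory.Integrable.mono' h1 (by fun_prop) ?_
  refine Filter.Eventually.of_forall fun y => ?_
  rw [Real.norm_eq_abs, abs_mul, abs_of_pos (Real.exp_pos _)]
  exact mul_le_mul_of_nonneg_left (hM y) (Real.exp_pos _).le

lemma lvP_bound {μ M : ℝ} (hμ : 0 < μ) {h : ℝ → ℝ} (hc : Continuous h)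
    (hM : ∀ x, |h x| ≤ M) (x : ℝ) : |lvP μ h x| ≤ M / μ := by
  have h1 : MeasureTheory.IntegrableOn (fun y => Real.exp (-μ * y) * M) (Set.Ioi x) :=
    (integrableOn_exp_mul_Ioi (by linarith) x).mul_const M
  have h2 : |∫ y in Set.Ioi x, Real.exp (-μ * y) * h y| ≤
      ∫ y in Set.Ioi x, Real.exp (-μ * y) * M := by
    rw [← Real.norm_eq_abs]
    refine MeasureTheory.norm_integral_le_of_norm_le h1 ?_
    refine Filter.Eventually.of_forall fun y => ?_
    rw [Real.norm_eq_abs, abs_mul, abs_of_pos (Real.exp_pos _)]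
    exact mul_le_mul_of_nonneg_left (hM y) (Real.exp_pos _).le
  rw [MeasureTheory.integral_mul_const, integral_exp_mul_Ioi (by linarith)] at h2
  unfold lvP
  rw [abs_mul, abs_of_pos (Real.exp_pos _)]
  calc _ ≤ Real.exp (μ * x) * (-Real.exp (-μ * x) / -μ * M) :=
        mul_le_mul_of_nonneg_left h2 (Real.exp_pos _).le
    _ = (Real.exp (μ * x) * Real.exp (-μ * x)) * (M / μ) := by field_simp
    _ = M / μ := by rw [← Real.exp_add]; simp

lemma lvP_hasDerivAt {μ M : ℝ} (hμ : 0 < μ) {h : ℝ → ℝ} (hc : Continuous h)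
    (hM : ∀ x, |h x| ≤ M) (x : ℝ) : HasDerivAt (lvP μ h) (μ * lvP μ h x - h x) x := by
  have hcont : Continuous (fun y => Real.exp (-μ * y) * h y) := by fun_prop
  have key : ∀ z, ∫ y in Set.Ioi z, Real.exp (-μ * y) * h y =
      (∫ y in Set.Ioi (0:ℝ), Real.exp (-μ * y) * h y) - ∫ y in (0:ℝ)..z, Real.exp (-μ * y) * h y := by
    intro z
    have := intervalIntegral.integral_interval_add_Ioi (lv_integrable hμ hc hM 0)
      (lv_integrable hμ hc hM z)
    linarith
  have e : lvP μ h = fun z => Real.exp (μ * z) *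
      ((∫ y in Set.Ioi (0:ℝ), Real.exp (-μ * y) * h y) - ∫ y in (0:ℝ)..z, Real.exp (-μ * y) * h y) := by
    funext z; unfold lvP; rw [key z]
  have d1 : HasDerivAt (fun z => ∫ y in (0:ℝ)..z, Real.exp (-μ * y) * h y)
      (Real.exp (-μ * x) * h x) x := hcont.integral_hasStrictDerivAt 0 x |>.hasDerivAt
  have d2 : HasDerivAt (fun z : ℝ => Real.exp (μ * z)) (Real.exp (μ * x) * (μ * 1)) x :=
    ((hasDerivAt_id x).const_mul μ).exp
  have d3 := d2.mul (d1.const_sub (∫ y in Set.Ioi (0:ℝ), Real.exp (-μ * y) * h y))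
  rw [e]
  refine d3.congr_deriv ?_
  have : Real.exp (μ * x) * Real.exp (-μ * x) = 1 := by rw [← Real.exp_add]; simp
  linear_combination (-h x) * this

lemma lvP_continuous {μ M : ℝ} (hμ : 0 < μ) {h : ℝ → ℝ} (hc : Continuous h)
    (hM : ∀ x, |h x| ≤ M) : Continuous (lvP μ h) :=
  continuous_iff_continuousAt.2 fun x => (lvP_hasDerivAt hμ hc hM x).continuousAt

lemma lvP_tendsto {μ M : ℝ} (hμ : 0 < μ) {h : ℕ → ℝ → ℝ} {g : ℝ → ℝ} (hc : ∀ n, Continuous (h n))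
    (hM : ∀ n x, |h n x| ≤ M) (ht : ∀ x, Tendsto (fun n => h n x) atTop (nhds (g x))) (x : ℝ) :
    Tendsto (fun n => lvP μ (h n) x) atTop (nhds (lvP μ g x)) := by
  unfold lvP
  refine Tendsto.const_mul _ ?_
  refine MeasureTheory.tendsto_integral_of_dominated_convergence (fun y => Real.exp (-μ * y) * M)
    ?_ ((integrableOn_exp_mul_Ioi (by linarith) x).mul_const M) ?_ ?_
  · intro n
    have := hc n
    fun_prop
  · intro n
    refine Filter.Eventually.of_forall fun y => ?_
    rw [Real.norm_eq_abs, abs_mul, abs_of_pos (Real.exp_pos _)]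
    exact mul_le_mul_of_nonneg_left (hM n y) (Real.exp_pos _).le
  · exact Filter.Eventually.of_forall fun y => (ht y).const_mul _

lemma lvN_bound {μ M : ℝ} (hμ : 0 < μ) {h : ℝ → ℝ} (hc : Continuous h)
    (hM : ∀ x, |h x| ≤ M) (x : ℝ) : |lvN μ h x| ≤ M / μ :=
  lvP_bound hμ (by fun_prop) (fun _ => hM _) _

lemma lvN_hasDerivAt {μ M : ℝ} (hμ : 0 < μ) {h : ℝ → ℝ} (hc : Continuous h)
    (hM : ∀ x, |h x| ≤ M) (x : ℝ) : HasDerivAt (lvN μ h) (h x - μ * lvN μ h x) x := by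
  have h1 := lvP_hasDerivAt hμ (h := fun y => h (-y)) (by fun_prop) (fun _ => hM _) (-x)
  have h2 := HasDerivAt.scomp x h1 (hasDerivAt_neg x)
  refine h2.congr_deriv ?_
  simp [lvN]

lemma lvN_tendsto {μ M : ℝ} (hμ : 0 < μ) {h : ℕ → ℝ → ℝ} {g : ℝ → ℝ} (hc : ∀ n, Continuous (h n))
    (hM : ∀ n x, |h n x| ≤ M) (ht : ∀ x, Tendsto (fun n => h n x) atTop (nhds (g x))) (x : ℝ) :
    Tendsto (fun n => lvN μ (h n) x) atTop (nhds (lvN μ g x)) :=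
  lvP_tendsto hμ (h := fun n y => h n (-y)) (fun n => (hc n).comp continuous_neg)
    (fun _ _ => hM _ _) (fun _ => ht _) (-x)

lemma lvT_tendsto {μ ν M : ℝ} (hμ : 0 < μ) (hν : 0 < ν) {h : ℕ → ℝ → ℝ} {g : ℝ → ℝ}
    (hc : ∀ n, Continuous (h n))
    (hM : ∀ n x, |h n x| ≤ M) (ht : ∀ x, Tendsto (fun n => h n x) atTop (nhds (g x))) (x : ℝ) :
    Tendsto (fun n => lvT μ ν (h n) x) atTop (nhds (lvT μ ν g x)) :=
  lvN_tendsto hν (fun n => lvP_continuous hμ (hc n) (hM n)) (fun n => lvP_bound hμ (hc n) (hM n))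
    (fun x => lvP_tendsto hμ hc hM ht x) x

/-- derivative of `lvT` -/
noncomputable def lvD (μ ν : ℝ) (h : ℝ → ℝ) (x : ℝ) : ℝ := lvP μ h x - ν * lvT μ ν h x

lemma lvT_hasDerivAt {μ ν M : ℝ} (hμ : 0 < μ) (hν : 0 < ν) {h : ℝ → ℝ} (hc : Continuous h)
    (hM : ∀ x, |h x| ≤ M) (x : ℝ) : HasDerivAt (lvT μ ν h) (lvD μ ν h x) x :=
  lvN_hasDerivAt hν (lvP_continuous hμ hc hM) (lvP_bound hμ hc hM) x

lemma lvD_hasDerivAt {μ ν M : ℝ} (hμ : 0 < μ) (hν : 0 < ν) {h : ℝ → ℝ} (hc : Continuous h)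
    (hM : ∀ x, |h x| ≤ M) (x : ℝ) : HasDerivAt (lvD μ ν h)
      ((μ - ν) * lvD μ ν h x + μ * ν * lvT μ ν h x - h x) x := by
  have := (lvP_hasDerivAt hμ hc hM x).sub ((lvT_hasDerivAt hμ hν hc hM x).const_mul ν)
  refine this.congr_deriv ?_
  unfold lvD; ring

lemma lvT_bound {μ ν M : ℝ} (hμ : 0 < μ) (hν : 0 < ν) {h : ℝ → ℝ} (hc : Continuous h)
    (hM : ∀ x, |h x| ≤ M) (x : ℝ) : |lvT μ ν h x| ≤ M / μ / ν :=
  lvN_bound hν (lvP_continuous hμ hc hM) (lvP_bound hμ hc hM) x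

lemma lvD_bound {μ ν M : ℝ} (hμ : 0 < μ) (hν : 0 < ν) {h : ℝ → ℝ} (hc : Continuous h)
    (hM : ∀ x, |h x| ≤ M) (x : ℝ) : |lvD μ ν h x| ≤ 2 * M / μ := by
  have h1 := lvP_bound hμ hc hM x
  have h2 := lvT_bound hμ hν hc hM x
  have h3 : |ν * lvT μ ν h x| ≤ M / μ := by
    rw [abs_mul, abs_of_pos hν]
    calc _ ≤ ν * (M / μ / ν) := mul_le_mul_of_nonneg_left h2 hν.le
      _ = _ := by field_simp
  unfold lvD
  calc _ ≤ |lvP μ h x| + |ν * lvT μ ν h x| := abs_sub _ _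
    _ ≤ M / μ + M / μ := add_le_add h1 h3
    _ = _ := by ring

/-- first order comparison -/
lemma lv_comp1 {μ C p : ℝ} (hμ : 0 < μ) {r r' : ℝ → ℝ} (hc : Continuous r)
    (hd : ∀ x, x ≠ p → HasDerivAt r (r' x) x) (hr : ∀ x, x ≠ p → r' x ≤ μ * r x)
    (hb : ∀ x, C ≤ r x) (x : ℝ) : 0 ≤ r x := by
  set φ : ℝ → ℝ := fun y => Real.exp (-μ * y) * r y with hφ
  have hφc : Continuous φ := by fun_prop
  have hφd : ∀ y, y ≠ p → HasDerivAt φ (Real.exp (-μ * y) * (r' y - μ * r y)) y := by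
    intro y hy
    have d2 : HasDerivAt (fun z : ℝ => Real.exp (-μ * z)) (Real.exp (-μ * y) * (-μ * 1)) y :=
      ((hasDerivAt_id y).const_mul (-μ)).exp
    refine (d2.mul (hd y hy)).congr_deriv ?_
    ring
  have hneg : ∀ y, y ≠ p → deriv φ y ≤ 0 := by
    intro y hy
    rw [(hφd y hy).deriv]
    exact mul_nonpos_of_nonneg_of_nonpos (Real.exp_pos _).le (by linarith [hr y hy])
  have a1 : AntitoneOn φ (Set.Iic p) := by
    refine antitoneOn_of_deriv_nonpos (convex_Iic p) hφc.continuousOn ?_ ?_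
    · intro y hy
      rw [interior_Iic] at hy
      exact (hφd y (ne_of_lt hy)).differentiableAt.differentiableWithinAt
    · intro y hy
      rw [interior_Iic] at hy
      exact hneg y (ne_of_lt hy)
  have a2 : AntitoneOn φ (Set.Ici p) := by
    refine antitoneOn_of_deriv_nonpos (convex_Ici p) hφc.continuousOn ?_ ?_
    · intro y hy
      rw [interior_Ici] at hy
      exact (hφd y (ne_of_gt hy)).differentiableAt.differentiableWithinAt
    · intro y hy
      rw [interior_Ici] at hy
      exact hneg y (ne_of_gt hy)
  have anti : Antitone φ := a1.Iic_union_Ici a2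
  have lim : Tendsto (fun y => Real.exp (-μ * y) * C) atTop (nhds 0) := by
    have : Tendsto (fun y : ℝ => Real.exp (-μ * y)) atTop (nhds 0) :=
      Real.tendsto_exp_atBot.comp (tendsto_id.const_mul_atTop_of_neg (by linarith))
    simpa using this.mul_const C
  have h0 : 0 ≤ φ x := by
    refine le_of_tendsto lim ?_
    filter_upwards [eventually_ge_atTop x] with y hy
    exact (mul_le_mul_of_nonneg_left (hb y) (Real.exp_pos _).le).trans (anti hy)
  exact (mul_nonneg_iff_of_pos_left (Real.exp_pos _)).1 h0

/-- second order comparison -/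
lemma lv_comp2 {μ ν C C' p : ℝ} (hμ : 0 < μ) (hν : 0 < ν) {z z1 z2 : ℝ → ℝ}
    (hz : ∀ x, HasDerivAt z (z1 x) x) (hz1 : Continuous z1)
    (hz2 : ∀ x, x ≠ p → HasDerivAt z1 (z2 x) x)
    (hle : ∀ x, x ≠ p → z2 x ≤ (μ - ν) * z1 x + μ * ν * z x)
    (hb : ∀ x, C ≤ z x) (hb' : ∀ x, C' ≤ z1 x + ν * z x) (x : ℝ) : 0 ≤ z x := by
  have hzc : Continuous z := continuous_iff_continuousAt.2 fun x => (hz x).continuousAt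
  have hr : ∀ x, 0 ≤ z1 x + ν * z x := by
    refine lv_comp1 (p := p) (C := C') hμ (r := fun x => z1 x + ν * z x)
      (r' := fun x => z2 x + ν * z1 x) (by fun_prop) ?_ ?_ hb'
    · intro x hx
      exact (hz2 x hx).add ((hz x).const_mul ν)
    · intro x hx
      have := hle x hx
      linarith
  have := lv_comp1 (p := 0) (C := C) hν (r := fun x => z (-x))
      (r' := fun x => - z1 (-x)) (by fun_prop) ?_ ?_ (fun x => hb _) (-x)
  · simpa using this
  · intro x _
    refine (HasDerivAt.scomp x (hz (-x)) (hasDerivAt_neg x)).congr_deriv ?_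
    simp
  · intro x _
    have := hr (-x)
    linarith

lemma lvT_ge {μ ν A B p M : ℝ} (hμ : 0 < μ) (hν : 0 < ν) {h w w1 w2 : ℝ → ℝ}
    (hc : Continuous h) (hM : ∀ x, |h x| ≤ M)
    (hz : ∀ x, HasDerivAt w (w1 x) x) (hz1 : Continuous w1)
    (hz2 : ∀ x, x ≠ p → HasDerivAt w1 (w2 x) x)
    (hle : ∀ x, x ≠ p → 0 ≤ w2 x - (μ - ν) * w1 x - μ * ν * w x + h x)
    (hb : ∀ x, w x ≤ A) (hb' : ∀ x, w1 x ≤ B) (x : ℝ) : w x ≤ lvT μ ν h x := by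
  have hD : Continuous (lvD μ ν h) :=
    continuous_iff_continuousAt.2 fun x => (lvD_hasDerivAt hμ hν hc hM x).continuousAt
  have := lv_comp2 (p := p) (C := - (M / μ / ν) - A)
    (C' := -(M / μ) - B - ν * A) hμ hν (z := fun x => lvT μ ν h x - w x)
    (z1 := fun x => lvD μ ν h x - w1 x)
    (z2 := fun x => ((μ - ν) * lvD μ ν h x + μ * ν * lvT μ ν h x - h x) - w2 x)
    (fun x => (lvT_hasDerivAt hμ hν hc hM x).sub (hz x)) (by fun_prop)
    (fun x hx => (lvD_hasDerivAt hμ hν hc hM x).sub (hz2 x hx)) ?_ ?_ ?_ x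
  · linarith
  · intro x hx
    have := hle x hx
    linarith
  · intro x
    have := (abs_le.1 (lvT_bound hμ hν hc hM x)).1
    have := hb x
    linarith
  · intro x
    have h1 := (abs_le.1 (lvP_bound hμ hc hM x)).1
    have h2 := hb x
    have h3 := hb' x
    have h4 : ν * w x ≤ ν * A := mul_le_mul_of_nonneg_left h2 hν.le
    simp only [lvD]
    linarith

lemma lvT_le {μ ν M : ℝ} (hμ : 0 < μ) (hν : 0 < ν) {h w w1 w2 : ℝ → ℝ}
    (hc : Continuous h) (hM : ∀ x, |h x| ≤ M)
    (hz : ∀ x, HasDerivAt w (w1 x) x)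
    (hz2 : ∀ x, HasDerivAt w1 (w2 x) x)
    (hle : ∀ x, w2 x - (μ - ν) * w1 x - μ * ν * w x + h x ≤ 0)
    (hb : ∀ x, 0 ≤ w x) (hb' : ∀ x, 0 ≤ w1 x) (x : ℝ) : lvT μ ν h x ≤ w x := by
  have hD : Continuous (lvD μ ν h) :=
    continuous_iff_continuousAt.2 fun x => (lvD_hasDerivAt hμ hν hc hM x).continuousAt
  have hw1 : Continuous w1 :=
    continuous_iff_continuousAt.2 fun x => (hz2 x).continuousAt
  have := lv_comp2 (p := 0) (C := - (M / μ / ν))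
    (C' := -(M / μ)) hμ hν (z := fun x => w x - lvT μ ν h x)
    (z1 := fun x => w1 x - lvD μ ν h x)
    (z2 := fun x => w2 x - ((μ - ν) * lvD μ ν h x + μ * ν * lvT μ ν h x - h x))
    (fun x => (hz x).sub (lvT_hasDerivAt hμ hν hc hM x)) (by fun_prop)
    (fun x hx => (hz2 x).sub (lvD_hasDerivAt hμ hν hc hM x)) ?_ ?_ ?_ x
  · linarith
  · intro x hx
    have := hle x
    linarith
  · intro x
    have := (abs_le.1 (lvT_bound hμ hν hc hM x)).2
    have := hb x
    linarith
  · intro x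
    have h1 := (abs_le.1 (lvP_bound hμ hc hM x)).2
    have h2 := hb x
    have h3 := hb' x
    have h4 : 0 ≤ ν * w x := mul_nonneg hν.le h2
    simp only [lvD]
    linarith

lemma lvT_mono {μ ν M : ℝ} (hμ : 0 < μ) (hν : 0 < ν) {h g : ℝ → ℝ}
    (hc : Continuous h) (hM : ∀ x, |h x| ≤ M) (gc : Continuous g) (gM : ∀ x, |g x| ≤ M)
    (hle : ∀ x, g x ≤ h x) (x : ℝ) : lvT μ ν g x ≤ lvT μ ν h x := by
  refine lvT_ge (p := 0) hμ hν hc hM (lvT_hasDerivAt hμ hν gc gM)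
    (continuous_iff_continuousAt.2 fun x => (lvD_hasDerivAt hμ hν gc gM x).continuousAt)
    (fun x _ => lvD_hasDerivAt hμ hν gc gM x) ?_ (fun x => (abs_le.1 (lvT_bound hμ hν gc gM x)).2)
    (fun x => (abs_le.1 (lvD_bound hμ hν gc gM x)).2) x
  intro x _
  linarith [hle x]

lemma lv_glue {F F1 F2 : ℝ → ℝ} {p : ℝ} (h1 : ∀ x, HasDerivAt F (F1 x) x)
    (h2 : ∀ x, HasDerivAt F1 (F2 x) x) (h0 : F1 p = 0) :
    (∀ x, HasDerivAt (fun y => F (min y p)) (F1 (min x p)) x) ∧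
    Continuous (fun y => F1 (min y p)) ∧
    (∀ x, x ≠ p → HasDerivAt (fun y => F1 (min y p)) (if x < p then F2 x else 0) x) := by
  have gen : ∀ {G G1 : ℝ → ℝ}, (∀ x, HasDerivAt G (G1 x) x) → ∀ x, x ≠ p →
      HasDerivAt (fun y => G (min y p)) (if x < p then G1 x else 0) x := by
    intro G G1 hG x hx
    rcases lt_or_gt_of_ne hx with h | h
    · rw [if_pos h]
      refine (hG x).congr_of_eventuallyEq ?_
      filter_upwards [Iio_mem_nhds h] with y hy
      rw [min_eq_left (le_of_lt hy)]
    · rw [if_neg (not_lt.2 h.le)]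
      refine (hasDerivAt_const x (G p)).congr_of_eventuallyEq ?_
      filter_upwards [Ioi_mem_nhds h] with y hy
      rw [min_eq_right (le_of_lt hy)]
  refine ⟨?_, ?_, gen h2⟩
  · intro x
    by_cases hx : x = p
    · subst hx
      rw [min_self, h0]
      have hl : HasDerivWithinAt (fun y => F (min y x)) 0 (Set.Iic x) x := by
        have := (h1 x).hasDerivWithinAt (s := Set.Iic x)
        rw [h0] at this
        refine this.congr (fun y hy => by rw [min_eq_left hy]) (by simp)
      have hr : HasDerivWithinAt (fun y => F (min y x)) 0 (Set.Ici x) x := by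
        refine (hasDerivWithinAt_const x _ (F x)).congr (fun y hy => by rw [min_eq_right hy]) (by simp)
      have := hl.union hr
      rwa [Set.Iic_union_Ici, hasDerivWithinAt_univ] at this
    · refine (gen h1 x hx).congr_deriv ?_
      split_ifs with h
      · rw [min_eq_left h.le]
      · rw [min_eq_right (not_lt.1 h), h0]
  · have : Continuous F1 := continuous_iff_continuousAt.2 fun x => (h2 x).continuousAt
    fun_prop

structure LvPar (σ α β γ m n l r μ ν : ℝ) : Prop where
  hα : 0 < α
  hβ : 0 < β
  hγ : 0 < γ
  hm : 0 < m
  hn : 0 < n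
  hl : 0 < l
  hr : 0 < r
  hμ : 0 < μ
  hν : 0 < ν
  ham : α = β * m
  root : l ^ 2 - σ * l + α = 0
  hls : 2 * l < σ
  comp : γ * n < α
  hsub : μ - ν = σ
  hmul : μ * ν = 2 * α + γ * n

def LvBox (m l : ℝ) (w : ℝ → ℝ) : Prop :=
  Continuous w ∧ ∀ x, 0 ≤ w x ∧ w x ≤ m ∧ w x ≤ m * Real.exp (l * x)

structure LvSub (σ α β γ m n l r : ℝ) (w : ℝ → ℝ) : Prop where
  box : LvBox m l w
  pos : ∀ x, 0 < w x
  low : ∃ δ Ξ : ℝ, 0 < δ ∧ ∀ x, Ξ ≤ x → δ ≤ w x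
  ex : ∃ (w1 w2 : ℝ → ℝ) (p B : ℝ), (∀ x, HasDerivAt w (w1 x) x) ∧ Continuous w1 ∧
    (∀ x, x ≠ p → HasDerivAt w1 (w2 x) x) ∧ (∀ x, w1 x ≤ B) ∧
    ∀ x, x ≠ p → ∀ z, z ≤ n → z ≤ n * Real.exp (r * x) →
      0 ≤ w2 x - σ * w1 x + w x * (α - β * w x - γ * z)

lemma lv_exists_p {l η k A B : ℝ} (hl : 0 < l) (hη : l < η) (hk : 0 < k) (hB : 0 < B) :
    ∃ p : ℝ, p ≤ 0 ∧ A ≤ k * Real.exp ((l - η) * p) ∧ Real.exp (l * p) ≤ B := by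
  have t1 : Tendsto (fun p : ℝ => k * Real.exp ((l - η) * p)) atBot atTop :=
    (Real.tendsto_exp_atTop.comp (tendsto_id.const_mul_atBot_of_neg (by linarith))).const_mul_atTop hk
  have t2 : Tendsto (fun p : ℝ => Real.exp (l * p)) atBot (nhds 0) :=
    Real.tendsto_exp_atBot.comp (tendsto_id.const_mul_atBot hl)
  obtain ⟨p, h1, h2, h3⟩ := ((eventually_le_atBot (0:ℝ)).and ((t1.eventually_ge_atTop A).and
    (t2.eventually (ge_mem_nhds hB)))).exists
  exact ⟨p, h1, h2, h3⟩

set_option maxHeartbeats 1000000 in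
lemma lv_exists_sub {σ α β γ m n l r μ ν : ℝ} (P : LvPar σ α β γ m n l r μ ν) :
    ∃ w, LvSub σ α β γ m n l r w := by
  obtain ⟨hα, hβ, hγ, hm, hn, hl, hr, hμ, hν, ham, root, hls, comp, -, -⟩ := P
  obtain ⟨η, hη, hη'⟩ : ∃ η, l < η ∧ η < min (min (2 * l) (l + r)) (σ - l) :=
    exists_between (lt_min (lt_min (by linarith) (by linarith)) (by linarith))
  have e1 : η < 2 * l := hη'.trans_le ((min_le_left _ _).trans (min_le_left _ _))
  have e2 : η < l + r := hη'.trans_le ((min_le_left _ _).trans (min_le_right _ _))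
  have e3 : η < σ - l := hη'.trans_le (min_le_right _ _)
  have hη0 : 0 < η := hl.trans hη
  set χ := η ^ 2 - σ * η + α with hχ
  have hχneg : χ < 0 := by
    have : χ = (η - l) * (η - (σ - l)) := by rw [hχ]; linear_combination root
    rw [this]
    exact mul_neg_of_pos_of_neg (by linarith) (by linarith)
  obtain ⟨p, hp, hpA, hpB⟩ := lv_exists_p (l := l) (η := η) (k := l / η * (-χ))
    (A := β * m + γ * n) (B := (α - γ * n) / α) hl hη
    (mul_pos (by positivity) (by linarith)) (div_pos (by linarith) hα)
  set q := l / η * Real.exp ((l - η) * p) with hq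
  have hq0 : 0 < q := by positivity
  have hqA : β * m + γ * n ≤ q * (-χ) := by rw [hq]; linarith
  set F : ℝ → ℝ := fun x => m * (Real.exp (l * x) - q * Real.exp (η * x)) with hF
  set F1 : ℝ → ℝ := fun x => m * (l * Real.exp (l * x) - q * η * Real.exp (η * x)) with hF1
  set F2 : ℝ → ℝ := fun x => m * (l ^ 2 * Real.exp (l * x) - q * η ^ 2 * Real.exp (η * x)) with hF2
  have dexp : ∀ k x : ℝ, HasDerivAt (fun y => Real.exp (k * y)) (k * Real.exp (k * x)) x := by
    intro k x
    refine (((hasDerivAt_id x).const_mul k).exp).congr_deriv ?_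
    simp [mul_comm]
  have d1 : ∀ x, HasDerivAt F (F1 x) x := by
    intro x
    refine (((dexp l x).sub ((dexp η x).const_mul q)).const_mul m).congr_deriv ?_
    simp only [hF1]; ring
  have d2 : ∀ x, HasDerivAt F1 (F2 x) x := by
    intro x
    refine ((((dexp l x).const_mul l).sub ((dexp η x).const_mul (q * η))).const_mul m).congr_deriv ?_
    simp only [hF2]; ring
  have qe : ∀ x, q * Real.exp (η * x) = l / η * Real.exp ((η - l) * (x - p)) * Real.exp (l * x) := by
    intro x
    rw [hq, mul_assoc, mul_assoc, ← Real.exp_add, ← Real.exp_add]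
    ring_nf
  have h0 : F1 p = 0 := by
    have := qe p
    simp only [sub_self, mul_zero, Real.exp_zero, mul_one] at this
    have e : q * η * Real.exp (η * p) = l * Real.exp (l * p) := by
      calc _ = η * (q * Real.exp (η * p)) := by ring
        _ = _ := by rw [this]; field_simp
    simp only [hF1, e]; ring
  obtain ⟨g1, g2, g3⟩ := lv_glue d1 d2 h0
  have Fle : ∀ x, F x ≤ m * Real.exp (l * x) := by
    intro x
    exact mul_le_mul_of_nonneg_left (by have := Real.exp_pos (η * x); nlinarith) hm.le
  have Fpos : ∀ x, x ≤ p → 0 < F x := by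
    intro x hx
    refine mul_pos hm ?_
    rw [qe x]
    have h1 : l / η < 1 := (div_lt_one hη0).2 hη
    have h2 : Real.exp ((η - l) * (x - p)) ≤ 1 :=
      Real.exp_le_one_iff.2 (mul_nonpos_of_nonneg_of_nonpos (by linarith) (by linarith))
    have h3 : l / η * Real.exp ((η - l) * (x - p)) < 1 := by
      have : 0 < l / η := by positivity
      nlinarith
    have h4 := Real.exp_pos (l * x)
    nlinarith
  have hexp1 : ∀ x, x ≤ 0 → Real.exp (l * x) ≤ 1 := fun x hx =>
    Real.exp_le_one_iff.2 (mul_nonpos_of_nonneg_of_nonpos hl.le hx)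
  refine ⟨fun y => F (min y p), ⟨⟨?_, ?_⟩, fun x => Fpos _ (min_le_right _ _),
    ⟨F p, p, Fpos p le_rfl, fun x hx => by simp [min_eq_right hx]⟩,
    ⟨fun y => F1 (min y p), fun x => if x < p then F2 x else 0, p, m * l, g1, g2, g3, ?_, ?_⟩⟩⟩
  · exact continuous_iff_continuousAt.2 fun x => (g1 x).continuousAt
  · intro x
    have a1 := Fle (min x p)
    have a2 := hexp1 (min x p) ((min_le_right _ _).trans hp)
    refine ⟨(Fpos _ (min_le_right _ _)).le, ?_, ?_⟩
    · simp only
      nlinarith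
    · refine a1.trans ?_
      gcongr
      exact min_le_left _ _
  · intro x
    have a2 := hexp1 (min x p) ((min_le_right _ _).trans hp)
    have a3 := Real.exp_pos (η * min x p)
    simp only [hF1]
    refine mul_le_mul_of_nonneg_left ?_ hm.le
    have : 0 ≤ q * η * Real.exp (η * min x p) := by positivity
    nlinarith
  · intro x hx z hz hz'
    rcases lt_or_gt_of_ne hx with h | h
    · simp only [min_eq_left h.le, if_pos h]
      have hx0 : x ≤ 0 := h.le.trans hp
      have b1 := Fle x
      have b2 := Fpos x h.le
      have i1 : F2 x - σ * F1 x + α * F x = m * (q * (-χ)) * Real.exp (η * x) := by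
        simp only [hF, hF1, hF2, hχ]
        linear_combination m * Real.exp (l * x) * root
      have i2 : m * (β * m + γ * n) * Real.exp (η * x) ≤ m * (q * (-χ)) * Real.exp (η * x) := by
        gcongr
      have i3 : Real.exp (l * x) * Real.exp (l * x) ≤ Real.exp (η * x) := by
        rw [← Real.exp_add]; refine Real.exp_le_exp.2 ?_; linarith [mul_nonpos_of_nonneg_of_nonpos (sub_nonneg.2 e1.le) hx0]
      have i4 : Real.exp (l * x) * Real.exp (r * x) ≤ Real.exp (η * x) := by
        rw [← Real.exp_add]; refine Real.exp_le_exp.2 ?_; linarith [mul_nonpos_of_nonneg_of_nonpos (sub_nonneg.2 e2.le) hx0]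
      have i5 : F x * (β * F x + γ * z) ≤
          (m * Real.exp (l * x)) * (β * (m * Real.exp (l * x)) + γ * (n * Real.exp (r * x))) := by
        have c1 : F x * (β * F x + γ * z) ≤
            F x * (β * (m * Real.exp (l * x)) + γ * (n * Real.exp (r * x))) := by gcongr
        refine c1.trans ?_
        gcongr
      have i6 : (m * Real.exp (l * x)) * (β * (m * Real.exp (l * x)) + γ * (n * Real.exp (r * x)))
          ≤ m * (β * m + γ * n) * Real.exp (η * x) := by
        have c1 : m * β * m * (Real.exp (l * x) * Real.exp (l * x)) ≤ m * β * m * Real.exp (η * x) := by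
          gcongr
        have c2 : m * γ * n * (Real.exp (l * x) * Real.exp (r * x)) ≤ m * γ * n * Real.exp (η * x) := by
          gcongr
        linarith
      linarith
    · simp only [min_eq_right h.le, if_neg (not_lt.2 h.le), h0]
      have b1 := Fle p
      have b2 := Fpos p le_rfl
      have b3 : α * Real.exp (l * p) ≤ α - γ * n := by
        rw [le_div_iff₀ hα] at hpB; linarith
      have b4 : β * F p ≤ α * Real.exp (l * p) := by
        rw [ham, mul_assoc]; gcongr
      have b5 : γ * z ≤ γ * n := by gcongr
      have : 0 ≤ F p * (α - β * F p - γ * z) := mul_nonneg b2.le (by linarith)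
      linarith

noncomputable def lvH (μ ν α β γ : ℝ) (w z : ℝ → ℝ) (x : ℝ) : ℝ :=
  w x * (μ * ν + α - β * w x - γ * z x)

section step
variable {σ α β γ m n l r μ ν : ℝ}

lemma lvH_cont {w z : ℝ → ℝ} (hw : Continuous w) (hz : Continuous z) :
    Continuous (lvH μ ν α β γ w z) := by unfold lvH; fun_prop

lemma lvH_mono (P : LvPar σ α β γ m n l r μ ν) {x x' z z' : ℝ} (h0 : 0 ≤ x) (h1 : x ≤ x')
    (h2 : x' ≤ m) (h4 : z' ≤ z) (h5 : z ≤ n) :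
    x * (μ * ν + α - β * x - γ * z) ≤ x' * (μ * ν + α - β * x' - γ * z') := by
  have c1 : γ * z' ≤ γ * n := mul_le_mul_of_nonneg_left (h4.trans h5) P.hγ.le
  have c2 : β * x' ≤ α := by rw [P.ham]; exact mul_le_mul_of_nonneg_left h2 P.hβ.le
  have c3 : β * x ≤ α := by rw [P.ham]; exact mul_le_mul_of_nonneg_left (h1.trans h2) P.hβ.le
  have c4 : 0 ≤ (x' - x) * (μ * ν + α - β * (x + x') - γ * z') :=
    mul_nonneg (by linarith) (by rw [P.hmul]; linarith [P.hα])
  have c5 : 0 ≤ γ * x * (z - z') := mul_nonneg (mul_nonneg P.hγ.le h0) (by linarith)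
  linarith

lemma lvH_bound (P : LvPar σ α β γ m n l r μ ν) {w z : ℝ → ℝ} (hw : LvBox m l w)
    (hz : LvBox n r z) (x : ℝ) : |lvH μ ν α β γ w z x| ≤ m * (μ * ν) := by
  obtain ⟨w0, w1, -⟩ := hw.2 x
  obtain ⟨z0, z1, -⟩ := hz.2 x
  have a1 := lvH_mono P le_rfl w0 w1 z1 le_rfl
  have a2 := lvH_mono P w0 w1 le_rfl z0 z1
  have := P.ham
  rw [abs_of_nonneg]
  · unfold lvH
    refine a2.trans (le_of_eq ?_)
    rw [this]; ring
  · unfold lvH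
    refine mul_nonneg w0 ?_
    have c1 : γ * z x ≤ γ * n := mul_le_mul_of_nonneg_left z1 P.hγ.le
    have c2 : β * w x ≤ α := by rw [P.ham]; exact mul_le_mul_of_nonneg_left w1 P.hβ.le
    rw [P.hmul]; linarith [P.hα]

lemma lv_step_box (P : LvPar σ α β γ m n l r μ ν) {w z : ℝ → ℝ} (hw : LvBox m l w)
    (hz : LvBox n r z) : LvBox m l (lvT μ ν (lvH μ ν α β γ w z)) := by
  have hc : Continuous (lvH μ ν α β γ w z) := lvH_cont hw.1 hz.1
  have hM := lvH_bound P hw hz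
  refine ⟨continuous_iff_continuousAt.2 fun x => (lvT_hasDerivAt P.hμ P.hν hc hM x).continuousAt,
    fun x => ⟨?_, ?_, ?_⟩⟩
  · refine lvT_ge (p := 0) (A := 0) (B := 0) (w := fun _ => 0) (w1 := fun _ => 0) (w2 := fun _ => 0)
      P.hμ P.hν hc hM (fun x => hasDerivAt_const x 0) continuous_const
      (fun x _ => hasDerivAt_const x 0) ?_ (fun _ => le_rfl) (fun _ => le_rfl) x
    intro x _
    obtain ⟨w0, w1, -⟩ := hw.2 x
    obtain ⟨z0, z1, -⟩ := hz.2 x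
    have a1 := lvH_mono P le_rfl w0 w1 z1 le_rfl
    unfold lvH
    linarith
  · refine lvT_le (w := fun _ => m) (w1 := fun _ => 0) (w2 := fun _ => 0)
      P.hμ P.hν hc hM (fun x => hasDerivAt_const x m)
      (fun x => hasDerivAt_const x 0) ?_ (fun _ => P.hm.le) (fun _ => le_rfl) x
    intro x
    have := (abs_le.1 (hM x)).2
    linarith
  · have dexp : ∀ k x : ℝ, HasDerivAt (fun y => Real.exp (k * y)) (k * Real.exp (k * x)) x := by
      intro k x
      refine (((hasDerivAt_id x).const_mul k).exp).congr_deriv ?_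
      simp [mul_comm]
    refine lvT_le (w := fun x => m * Real.exp (l * x)) (w1 := fun x => m * (l * Real.exp (l * x)))
      (w2 := fun x => m * (l * (l * Real.exp (l * x))))
      P.hμ P.hν hc hM (fun x => (dexp l x).const_mul m)
      (fun x => ((dexp l x).const_mul l).const_mul m) ?_ ?_ ?_ x
    · intro x
      obtain ⟨w0, w1, w2⟩ := hw.2 x
      obtain ⟨z0, z1, -⟩ := hz.2 x
      have := P.hα
      have := P.hβ
      have := P.hγ
      have hk : 0 < μ * ν := mul_pos P.hμ P.hν
      have e1 : lvH μ ν α β γ w z x ≤ (m * Real.exp (l * x)) * (μ * ν + α) := by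
        unfold lvH
        have : w x * (μ * ν + α - β * w x - γ * z x) ≤ w x * (μ * ν + α) := by
          have h1 : 0 ≤ β * w x := by positivity
          have h2 : 0 ≤ γ * z x := by positivity
          exact mul_le_mul_of_nonneg_left (by linarith) w0
        refine this.trans ?_
        gcongr
      have e2 := P.root
      rw [P.hsub]
      have e3 : m * Real.exp (l * x) * (l ^ 2 - σ * l + α) = 0 := by rw [e2, mul_zero]
      linarith
    · intro x
      have := P.hm
      positivity
    · intro x
      have := P.hm
      have := P.hl
      positivity

lemma lv_step_sub (P : LvPar σ α β γ m n l r μ ν) {w z y : ℝ → ℝ} (hw : LvBox m l w)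
    (hz : LvBox n r z) (hy : LvSub σ α β γ m n l r y) (hyw : ∀ x, y x ≤ w x) (x : ℝ) :
    y x ≤ lvT μ ν (lvH μ ν α β γ w z) x := by
  have hc : Continuous (lvH μ ν α β γ w z) := lvH_cont hw.1 hz.1
  have hM := lvH_bound P hw hz
  obtain ⟨y1, y2, p, B, d1, c1, d2, hB, hin⟩ := hy.ex
  refine lvT_ge P.hμ P.hν hc hM d1 c1 d2 ?_ (fun x => (hy.box.2 x).2.1) hB x
  intro x hx
  have h1 := hin x hx (z x) (hz.2 x).2.1 (hz.2 x).2.2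
  have h2 := lvH_mono P (hy.pos x).le (hyw x) (hw.2 x).2.1 (le_refl (z x)) (hz.2 x).2.1
  rw [P.hsub]
  unfold lvH
  linarith

lemma lv_step_mono (P : LvPar σ α β γ m n l r μ ν) {w z w' z' : ℝ → ℝ} (hw : LvBox m l w)
    (hz : LvBox n r z) (hw' : LvBox m l w') (hz' : LvBox n r z')
    (h1 : ∀ x, w x ≤ w' x) (h2 : ∀ x, z' x ≤ z x) (x : ℝ) :
    lvT μ ν (lvH μ ν α β γ w z) x ≤ lvT μ ν (lvH μ ν α β γ w' z') x := by
  refine lvT_mono P.hμ P.hν (lvH_cont hw'.1 hz'.1) (lvH_bound P hw' hz') (lvH_cont hw.1 hz.1)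
    (lvH_bound P hw hz) ?_ x
  intro x
  exact lvH_mono P (hw.2 x).1 (h1 x) (hw'.2 x).2.1 (h2 x) (hz.2 x).2.1

lemma lv_step_lip (P : LvPar σ α β γ m n l r μ ν) {w z : ℝ → ℝ} (hw : LvBox m l w)
    (hz : LvBox n r z) (x y : ℝ) :
    |lvT μ ν (lvH μ ν α β γ w z) x - lvT μ ν (lvH μ ν α β γ w z) y|
      ≤ 2 * (m * (μ * ν)) / μ * |x - y| := by
  have hc : Continuous (lvH μ ν α β γ w z) := lvH_cont hw.1 hz.1
  have hM := lvH_bound P hw hz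
  exact Convex.norm_image_sub_le_of_norm_hasDerivWithin_le (s := Set.univ)
    (fun x _ => (lvT_hasDerivAt P.hμ P.hν hc hM x).hasDerivWithinAt)
    (fun x _ => lvD_bound P.hμ P.hν hc hM x) convex_univ (Set.mem_univ y) (Set.mem_univ x)

/-- limit component: fixed point -/
lemma lv_limit (P : LvPar σ α β γ m n l r μ ν) {w z : ℕ → ℝ → ℝ} {W Z : ℝ → ℝ}
    (hw : ∀ k, LvBox m l (w k)) (hz : ∀ k, LvBox n r (z k))
    (hs : ∀ k, w (k + 1) = lvT μ ν (lvH μ ν α β γ (w k) (z k)))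
    (tw : ∀ x, Tendsto (fun k => w k x) atTop (nhds (W x)))
    (tz : ∀ x, Tendsto (fun k => z k x) atTop (nhds (Z x))) :
    LvBox m l W ∧ W = lvT μ ν (lvH μ ν α β γ W Z) := by
  refine ⟨⟨?_, ?_⟩, ?_⟩
  · have lip : ∀ x y, |W x - W y| ≤ 2 * (m * (μ * ν)) / μ * |x - y| := by
      intro x y
      have t : Tendsto (fun k => |w (k+1) x - w (k+1) y|) atTop (nhds |W x - W y|) :=
        (((tendsto_add_atTop_iff_nat 1).2 (tw x)).sub ((tendsto_add_atTop_iff_nat 1).2 (tw y))).abs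
      refine le_of_tendsto' t fun k => ?_
      rw [hs k]
      exact lv_step_lip P (hw k) (hz k) x y
    exact (LipschitzWith.of_dist_le_mul (K := Real.toNNReal (2 * (m * (μ * ν)) / μ)) (by
      intro x y
      rw [Real.dist_eq, Real.dist_eq, Real.coe_toNNReal]
      · exact lip x y
      · have := P.hm
        have := P.hμ
        have := P.hν
        positivity)).continuous
  · intro x
    exact ⟨ge_of_tendsto' (tw x) fun k => ((hw k).2 x).1,
      le_of_tendsto' (tw x) fun k => ((hw k).2 x).2.1,
      le_of_tendsto' (tw x) fun k => ((hw k).2 x).2.2⟩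
  · funext x
    have t1 : Tendsto (fun k => w (k+1) x) atTop (nhds (W x)) := (tendsto_add_atTop_iff_nat 1).2 (tw x)
    have t2 : Tendsto (fun k => w (k+1) x) atTop (nhds (lvT μ ν (lvH μ ν α β γ W Z) x)) := by
      simp only [hs]
      refine lvT_tendsto P.hμ P.hν (fun k => lvH_cont (hw k).1 (hz k).1)
        (fun k => lvH_bound P (hw k) (hz k)) ?_ x
      intro y
      unfold lvH
      exact (tw y).mul (((tw y).const_mul β |>.const_sub (μ * ν + α)).sub ((tz y).const_mul γ))
    exact tendsto_nhds_unique t1 t2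

lemma lv_solves (P : LvPar σ α β γ m n l r μ ν) {W Z : ℝ → ℝ} (hW : LvBox m l W) (hZ : LvBox n r Z)
    (e : W = lvT μ ν (lvH μ ν α β γ W Z)) :
    ContDiff ℝ 2 W ∧ ∀ x, deriv (deriv W) x - σ * deriv W x + W x * (α - β * W x - γ * Z x) = 0 := by
  have hc : Continuous (lvH μ ν α β γ W Z) := lvH_cont hW.1 hZ.1
  have hM := lvH_bound P hW hZ
  have d1 := lvT_hasDerivAt P.hμ P.hν hc hM
  have d2 := lvD_hasDerivAt P.hμ P.hν hc hM
  rw [← e] at d1 d2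
  have e1 : deriv W = lvD μ ν (lvH μ ν α β γ W Z) := funext fun x => (d1 x).deriv
  have e2 : deriv (deriv W) = fun x => (μ - ν) * lvD μ ν (lvH μ ν α β γ W Z) x + μ * ν * W x
      - lvH μ ν α β γ W Z x := by
    rw [e1]; exact funext fun x => (d2 x).deriv
  refine ⟨?_, ?_⟩
  · have hD : Continuous (lvD μ ν (lvH μ ν α β γ W Z)) :=
      continuous_iff_continuousAt.2 fun x => (d2 x).continuousAt
    have hWc := hW.1
    rw [show (2 : WithTop ℕ∞) = 1 + 1 from (by norm_num), contDiff_succ_iff_deriv]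
    refine ⟨fun x => (d1 x).differentiableAt, by simp, ?_⟩
    rw [contDiff_one_iff_deriv]
    refine ⟨?_, ?_⟩
    · rw [e1]; exact fun x => (d2 x).differentiableAt
    · rw [e2]; fun_prop
  · intro x
    rw [e2, e1, P.hsub]
    unfold lvH
    ring

lemma lv_exists_roots (σ k : ℝ) (hk : 0 < k) :
    ∃ μ ν : ℝ, 0 < μ ∧ 0 < ν ∧ μ - ν = σ ∧ μ * ν = k := by
  have h0 : 0 ≤ σ ^ 2 + 4 * k := by positivity
  have hq := Real.sq_sqrt h0
  have : |σ| < Real.sqrt (σ ^ 2 + 4 * k) := by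
    rw [← Real.sqrt_sq_eq_abs]
    exact Real.sqrt_lt_sqrt (sq_nonneg _) (by linarith)
  obtain ⟨h1, h2⟩ := abs_lt.1 this
  refine ⟨(σ + Real.sqrt (σ ^ 2 + 4 * k)) / 2, (-σ + Real.sqrt (σ ^ 2 + 4 * k)) / 2,
    by linarith, by linarith, by ring, by linear_combination hq / 4⟩

lemma lv_box_upper (hm : 0 < m) : LvBox m l (fun x => min m (m * Real.exp (l * x))) :=
  ⟨by fun_prop, fun x => ⟨le_min hm.le (by positivity), min_le_left _ _, min_le_right _ _⟩⟩

end step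

lemma lv_main {σ α β γ m n l r μ ν σ' α' β' γ' μ' ν' : ℝ} (P : LvPar σ α β γ m n l r μ ν)
    (P' : LvPar σ' α' β' γ' n m r l μ' ν') :
    ∃ u v : ℝ → ℝ, LvBox m l u ∧ LvBox n r v ∧
      u = lvT μ ν (lvH μ ν α β γ u v) ∧ v = lvT μ' ν' (lvH μ' ν' α' β' γ' v u) ∧
      (∀ x, 0 < u x) ∧ (∀ x, 0 < v x) ∧
      ∃ δ₁ δ₂ Ξ : ℝ, 0 < δ₁ ∧ 0 < δ₂ ∧ ∀ x, Ξ ≤ x → δ₁ ≤ u x ∧ δ₂ ≤ v x := by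
  obtain ⟨y, hy⟩ := lv_exists_sub P
  obtain ⟨y', hy'⟩ := lv_exists_sub P'
  set S : (ℝ → ℝ) × (ℝ → ℝ) → (ℝ → ℝ) × (ℝ → ℝ) := fun q =>
    (lvT μ ν (lvH μ ν α β γ q.1 q.2), lvT μ' ν' (lvH μ' ν' α' β' γ' q.2 q.1)) with hS
  set X : ℕ → (ℝ → ℝ) × (ℝ → ℝ) := fun k =>
    S^[k] ((fun x => min m (m * Real.exp (l * x))), y') with hX
  have hX0 : X 0 = ((fun x => min m (m * Real.exp (l * x))), y') := rfl
  have hXs : ∀ k, X (k + 1) = S (X k) := fun k => Function.iterate_succ_apply' _ _ _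
  have inv : ∀ k, LvBox m l (X k).1 ∧ LvBox n r (X k).2 ∧ (∀ x, y x ≤ (X k).1 x) ∧
      (∀ x, y' x ≤ (X k).2 x) := by
    intro k
    induction k with
    | zero =>
      rw [hX0]
      exact ⟨lv_box_upper P.hm, hy'.box, fun x => le_min (hy.box.2 x).2.1 (hy.box.2 x).2.2,
        fun x => le_rfl⟩
    | succ k ih =>
      obtain ⟨i1, i2, i3, i4⟩ := ih
      rw [hXs]
      exact ⟨lv_step_box P i1 i2, lv_step_box P' i2 i1, lv_step_sub P i1 i2 hy i3,
        lv_step_sub P' i2 i1 hy' i4⟩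
  have mono : ∀ k, (∀ x, (X (k+1)).1 x ≤ (X k).1 x) ∧ (∀ x, (X k).2 x ≤ (X (k+1)).2 x) := by
    intro k
    induction k with
    | zero =>
      obtain ⟨i1, i2, i3, i4⟩ := inv (0 + 1)
      refine ⟨fun x => ?_, fun x => i4 x⟩
      exact le_min (i1.2 x).2.1 (i1.2 x).2.2
    | succ k ih =>
      obtain ⟨i1, i2, i3, i4⟩ := inv (k + 1)
      obtain ⟨j1, j2, j3, j4⟩ := inv k
      rw [hXs (k + 1)]
      nth_rewrite 2 [hXs k]
      nth_rewrite 2 [hXs k]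
      exact ⟨lv_step_mono P i1 i2 j1 j2 ih.1 ih.2, lv_step_mono P' j2 j1 i2 i1 ih.2 ih.1⟩
  have tu : ∀ x, ∃ L, Tendsto (fun k => (X k).1 x) atTop (nhds L) := by
    intro x
    refine ⟨_, tendsto_atTop_ciInf (antitone_nat_of_succ_le fun k => (mono k).1 x) ⟨0, ?_⟩⟩
    rintro _ ⟨k, rfl⟩
    exact ((inv k).1.2 x).1
  have tv : ∀ x, ∃ L, Tendsto (fun k => (X k).2 x) atTop (nhds L) := by
    intro x
    refine ⟨_, tendsto_atTop_ciSup (monotone_nat_of_le_succ fun k => (mono k).2 x) ⟨n, ?_⟩⟩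
    rintro _ ⟨k, rfl⟩
    exact ((inv k).2.1.2 x).2.1
  choose u hu using tu
  choose v hv using tv
  obtain ⟨bu, eu⟩ := lv_limit P (w := fun k => (X k).1) (z := fun k => (X k).2)
    (fun k => (inv k).1) (fun k => (inv k).2.1) (fun k => by simp only [hXs, hS]) hu hv
  obtain ⟨bv, ev⟩ := lv_limit P' (w := fun k => (X k).2) (z := fun k => (X k).1)
    (fun k => (inv k).2.1) (fun k => (inv k).1) (fun k => by simp only [hXs, hS]) hv hu
  have lu : ∀ x, y x ≤ u x := fun x => ge_of_tendsto' (hu x) fun k => (inv k).2.2.1 x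
  have lv : ∀ x, y' x ≤ v x := fun x => ge_of_tendsto' (hv x) fun k => (inv k).2.2.2 x
  obtain ⟨δ, Ξ, hδ, h1⟩ := hy.low
  obtain ⟨δ', Ξ', hδ', h1'⟩ := hy'.low
  exact ⟨u, v, bu, bv, eu, ev, fun x => (hy.pos x).trans_le (lu x),
    fun x => (hy'.pos x).trans_le (lv x), δ, δ', max Ξ Ξ', hδ, hδ', fun x hx =>
      ⟨(h1 x ((le_max_left _ _).trans hx)).trans (lu x),
        (h1' x ((le_max_right _ _).trans hx)).trans (lv x)⟩⟩

lemma lv_box_tendsto {m l : ℝ} (hl : 0 < l) {w : ℝ → ℝ} (hw : LvBox m l w) :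
    Tendsto w atBot (nhds 0) := by
  have t2 : Tendsto (fun p : ℝ => m * Real.exp (l * p)) atBot (nhds 0) := by
    have : Tendsto (fun p : ℝ => Real.exp (l * p)) atBot (nhds 0) :=
      Real.tendsto_exp_atBot.comp (tendsto_id.const_mul_atBot hl)
    simpa using this.const_mul m
  exact squeeze_zero (fun x => (hw.2 x).1) (fun x => (hw.2 x).2.2) t2

/-- Existence of a positive solution squeezed between the explicit sub- and
super-solutions in the supercritical case `s > s*`, with exponential decay at
`-∞` governed by `λ₁ = (s - √(s²-4))/2` and `λ₂ = (s - √(s²-4ad))/(2d)`. -/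
theorem existence_supercritical_with_bounds
    (a b c d : ℝ) (hd : 0 < d) (hb : 0 < b) (hba : b < a) (hc : 0 < c)
    (hac : a < 1 / c) (s : ℝ) (hs : max 2 (2 * Real.sqrt (a * d)) < s) :
    ∃ u v : ℝ → ℝ, ContDiff ℝ 2 u ∧ ContDiff ℝ 2 v ∧
      (∀ ξ : ℝ, 0 < u ξ) ∧ (∀ ξ : ℝ, 0 < v ξ) ∧
      (∀ ξ : ℝ, deriv (deriv u) ξ - s * deriv u ξ + u ξ * (1 - u ξ - c * v ξ) = 0) ∧
      (∀ ξ : ℝ, d * deriv (deriv v) ξ - s * deriv v ξ + v ξ * (a - b * u ξ - v ξ) = 0) ∧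
      (∀ ξ : ℝ, u ξ ≤ min 1 (Real.exp ((s - Real.sqrt (s ^ 2 - 4)) / 2 * ξ))) ∧
      (∀ ξ : ℝ, v ξ ≤ min a (a * Real.exp ((s - Real.sqrt (s ^ 2 - 4 * a * d)) / (2 * d) * ξ))) ∧
      (∃ δ₁ δ₂ Ξ : ℝ, 0 < δ₁ ∧ 0 < δ₂ ∧
        ∀ ξ : ℝ, Ξ ≤ ξ → δ₁ ≤ u ξ ∧ δ₂ ≤ v ξ) ∧
      Tendsto u atBot (nhds 0) ∧ Tendsto v atBot (nhds 0) := by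
  have ha : 0 < a := hb.trans hba
  have hs2 : 2 < s := (le_max_left _ _).trans_lt hs
  have hs3 : 2 * Real.sqrt (a * d) < s := (le_max_right _ _).trans_lt hs
  have hs0 : 0 < s := by linarith
  have hac' : c * a < 1 := by rw [lt_div_iff₀ hc] at hac; linarith
  have D1 : 0 < s ^ 2 - 4 := by nlinarith
  have D2 : 0 < s ^ 2 - 4 * a * d := by
    have h1 := Real.sq_sqrt (mul_pos ha hd).le
    have h2 := Real.sqrt_nonneg (a * d)
    nlinarith
  have q1 := Real.sq_sqrt D1.le
  have q2 := Real.sq_sqrt D2.le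
  have p1 := Real.sqrt_pos.2 D1
  have p2 := Real.sqrt_pos.2 D2
  have r1 : Real.sqrt (s ^ 2 - 4) < s := (Real.sqrt_lt' hs0).2 (by linarith)
  have r2 : Real.sqrt (s ^ 2 - 4 * a * d) < s :=
    (Real.sqrt_lt' hs0).2 (by have := mul_pos ha hd; linarith)
  set R1 := Real.sqrt (s ^ 2 - 4) with hR1
  set R2 := Real.sqrt (s ^ 2 - 4 * a * d) with hR2
  obtain ⟨μ, ν, hμ, hν, hsub, hmul⟩ := lv_exists_roots s (2 * 1 + c * a) (by positivity)
  obtain ⟨μ', ν', hμ', hν', hsub', hmul'⟩ := lv_exists_roots (s / d) (2 * (a / d) + b / d * 1)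
    (by positivity)
  have hl : 0 < (s - R1) / 2 := by linarith
  have hr : 0 < (s - R2) / (2 * d) := div_pos (by linarith) (by linarith)
  have P : LvPar s 1 1 c 1 a ((s - R1) / 2) ((s - R2) / (2 * d)) μ ν :=
    { hα := one_pos, hβ := one_pos, hγ := hc, hm := one_pos, hn := ha, hl := hl, hr := hr
      hμ := hμ, hν := hν, ham := by norm_num
      root := by linear_combination q1 / 4
      hls := by linarith
      comp := hac', hsub := hsub, hmul := hmul }
  have P' : LvPar (s / d) (a / d) (1 / d) (b / d) a 1 ((s - R2) / (2 * d)) ((s - R1) / 2) μ' ν' :=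
    { hα := by positivity, hβ := by positivity, hγ := by positivity, hm := ha, hn := one_pos
      hl := hr, hr := hl
      hμ := hμ', hν := hν', ham := by ring
      root := by
        field_simp
        linear_combination q2
      hls := by
        have : 2 * ((s - R2) / (2 * d)) = (s - R2) / d := by field_simp
        rw [this]
        exact div_lt_div_of_pos_right (by linarith) hd
      comp := by rw [mul_one]; exact div_lt_div_of_pos_right hba hd
      hsub := hsub', hmul := hmul' }
  obtain ⟨u, v, bu, bv, eu, ev, pu, pv, hlow⟩ := lv_main P P'
  obtain ⟨cu, su⟩ := lv_solves P bu bv eu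
  obtain ⟨cv, sv⟩ := lv_solves P' bv bu ev
  refine ⟨u, v, cu, cv, pu, pv, ?_, ?_, ?_, ?_, hlow, lv_box_tendsto hl bu, lv_box_tendsto hr bv⟩
  · intro x
    have := su x
    linarith
  · intro x
    have := sv x
    have h : d * (deriv (deriv v) x - s / d * deriv v x
      + v x * (a / d - 1 / d * v x - b / d * u x)) = 0 := by rw [this, mul_zero]
    rw [← h]
    field_simp
    ring
  · intro x
    refine le_min (bu.2 x).2.1 ?_
    have := (bu.2 x).2.2
    rwa [one_mul] at this
  · intro x
    exact le_min (bv.2 x).2.1 (bv.2 x).2.2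
end

section
/- Assume d > 0, strict weak competition 0 < b < a < 1/c, a·d < 1, and let s = s* = 2. Set λ₂ := (1 − √(1 − a·d))/d and ĥ₁ := (1/2)·e². Then there exists a positive twice continuously differentiable solution (u, v) of u'' − 2·u' + u·(1 − u − c·v) = 0 and d·v'' − 2·v' + v·(a − b·u − v) = 0 on ℝ satisfying: u(ξ) ≤ 1 for all ξ and u(ξ) ≤ ĥ₁·(−ξ)·e^{ξ} for all ξ ≤ −2; v(ξ) ≤ min{a, a·e^{λ₂·ξ}} for all ξ ∈ ℝ; there exist constants δ₁, δ₂ > 0 and Ξ ∈ ℝ with u(ξ) ≥ δ₁ and v(ξ) ≥ δ₂ for all ξ ≥ Ξ; and lim_{ξ→−∞}(u(ξ), v(ξ)) = (0, 0). -/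
open Filter Real
open scoped Topology

namespace LVW

def IsSub (p : ℝ) (S h : ℝ → ℝ) : Prop :=
  ∀ x, ∃ χ χ1 χ2 : ℝ → ℝ, (∀ y, HasDerivAt χ (χ1 y) y) ∧ (∀ y, HasDerivAt χ1 (χ2 y) y) ∧
    χ x = S x ∧ (∀ᶠ y in 𝓝 x, χ y ≤ S y) ∧ 0 ≤ p * χ2 x - 2 * χ1 x + h x

lemma second_deriv_test {g g1 g2 : ℝ → ℝ} (h1 : ∀ y, HasDerivAt g (g1 y) y)
    (h2 : ∀ y, HasDerivAt g1 (g2 y) y) {x : ℝ} (hx : IsLocalMax g x) :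
    g1 x = 0 ∧ g2 x ≤ 0 := by
  have e1 : deriv g = g1 := funext fun y => (h1 y).deriv
  have e2 : deriv g1 = g2 := funext fun y => (h2 y).deriv
  have h0 : g1 x = 0 := hx.hasDerivAt_eq_zero (h1 x)
  refine ⟨h0, ?_⟩
  by_contra hcon
  push Not at hcon
  have hmin : IsLocalMin g x := by
    apply isLocalMin_of_deriv_deriv_pos
    · rw [e1, e2]; exact hcon
    · rw [e1]; exact h0
    · exact (h1 x).continuousAt
  have hc : g =ᶠ[𝓝 x] fun _ => g x := by
    filter_upwards [hx, hmin] with y a b using le_antisymm a b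
  have hc1 : g1 =ᶠ[𝓝 x] fun _ => 0 := by
    have := hc.deriv
    rw [e1] at this
    simpa using this
  have := hc1.deriv_eq
  rw [e2] at this
  simp at this
  linarith

lemma comparison {p β : ℝ} (hp : 0 < p) (hβ : 0 < β) {S h U U1 U2 f : ℝ → ℝ}
    (hS : IsSub p S h) (hSc : Continuous S)
    (h1 : ∀ y, HasDerivAt U (U1 y) y) (h2 : ∀ y, HasDerivAt U1 (U2 y) y)
    (heq : ∀ y, p * U2 y - 2 * U1 y - β * U y + f y = 0)
    (hle : ∀ y, h y + β * S y ≤ f y) {M : ℝ} (hM : ∀ y, S y - U y ≤ M) (x : ℝ) : S x ≤ U x := by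
  by_contra hcon
  push Not at hcon
  obtain ⟨N, hN0, hN⟩ : ∃ N : ℝ, 0 < N ∧ ∀ y : ℝ, 0 ≤ β * (N + y^2) - 2 * p + 4 * y := by
    refine ⟨(2 * p + 4 / β) / β, by positivity, fun y => ?_⟩
    have : β * ((2 * p + 4 / β) / β + y^2) - 2 * p + 4 * y = β * (y + 2/β)^2 := by
      field_simp; ring
    rw [this]; positivity
  obtain ⟨ε, hε0, hε⟩ : ∃ ε : ℝ, 0 < ε ∧ ε * (N + x^2) < S x - U x := by
    refine ⟨(S x - U x) / 2 / (N + x^2), by have : 0 < S x - U x := by linarith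
                                            positivity, ?_⟩
    have : 0 < N + x^2 := by positivity
    rw [div_mul_cancel₀ _ this.ne']; linarith
  have hUc : Continuous U := continuous_iff_continuousAt.2 fun y => (h1 y).continuousAt
  set w : ℝ → ℝ := fun y => S y - U y - ε * (N + y^2) with hw
  have hwc : Continuous w := by fun_prop
  obtain ⟨z, hz⟩ : ∃ z, ∀ y, w y ≤ w z := by
    apply hwc.exists_forall_ge
    have : Tendsto (fun y : ℝ => M - ε * (N + ‖y‖^2)) (cocompact ℝ) atBot := by
      have t1 : Tendsto (fun y : ℝ => ‖y‖^2) (cocompact ℝ) atTop :=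
        (tendsto_pow_atTop two_ne_zero).comp (tendsto_norm_cocompact_atTop)
      have t2 := (tendsto_atTop_add_const_left _ N t1).const_mul_atTop hε0
      have t3 := tendsto_atBot_add_const_left _ M (tendsto_neg_atTop_atBot.comp t2)
      exact t3.congr fun y => by simp; ring
    refine tendsto_atBot_mono (fun y => ?_) this
    simp only [hw, Real.norm_eq_abs, sq_abs]
    linarith [hM y]
  have hz0 : 0 < w z := lt_of_lt_of_le (by simp only [hw]; linarith) (hz x)
  obtain ⟨χ, χ1, χ2, d1, d2, e, ev, ineq⟩ := hS z
  have key := second_deriv_test (g := fun y => χ y - U y - ε * (N + y^2))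
    (g1 := fun y => χ1 y - U1 y - ε * (2 * y)) (g2 := fun y => χ2 y - U2 y - ε * 2) (x := z)
    (fun y => by
      have := ((d1 y).sub (h1 y)).sub ((((hasDerivAt_id y).pow 2).const_add N).const_mul ε)
      convert this using 1 <;> first | (ext; simp) | simp)
    (fun y => by
      have := ((d2 y).sub (h2 y)).sub ((((hasDerivAt_id y)).const_mul 2).const_mul ε)
      convert this using 1 <;> first | (ext; simp) | simp)
    (by
      filter_upwards [ev] with y hy
      have := hz y
      simp only [hw] at this
      rw [e]; linarith)
  obtain ⟨k1, k2⟩ := key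
  simp only [hw] at hz0
  have := heq z
  have := hle z
  have := mul_nonneg hε0.le (hN z)
  have h3 := mul_pos hβ hz0
  have h4 := mul_nonneg hp.le (neg_nonneg.2 k2)
  nlinarith

lemma comparison_super {p β : ℝ} (hp : 0 < p) (hβ : 0 < β) {S h U U1 U2 f : ℝ → ℝ}
    (hS : IsSub p (fun x => - S x) (fun x => - h x)) (hSc : Continuous S)
    (h1 : ∀ y, HasDerivAt U (U1 y) y) (h2 : ∀ y, HasDerivAt U1 (U2 y) y)
    (heq : ∀ y, p * U2 y - 2 * U1 y - β * U y + f y = 0)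
    (hle : ∀ y, f y ≤ h y + β * S y) {M : ℝ} (hM : ∀ y, U y - S y ≤ M) (x : ℝ) : U x ≤ S x := by
  have := comparison hp hβ hS hSc.neg (U := fun y => - U y) (U1 := fun y => - U1 y)
    (U2 := fun y => - U2 y) (f := fun y => - f y) (fun y => (h1 y).neg) (fun y => (h2 y).neg)
    (fun y => by linarith [heq y]) (fun y => by linarith [hle y]) (M := M)
    (fun y => by linarith [hM y]) x
  linarith

/-- resolvent -/
noncomputable def R (μ : ℝ) (f : ℝ → ℝ) (x : ℝ) : ℝ :=
  exp (μ * x) * ∫ t in Set.Ioi x, exp (-μ * t) * f t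

open MeasureTheory

lemma R_int {μ : ℝ} (hμ : 0 < μ) {f : ℝ → ℝ} (hf : Measurable f) {M : ℝ} (hM : ∀ x, |f x| ≤ M)
    (x : ℝ) : IntegrableOn (fun t => exp (-μ * t) * f t) (Set.Ioi x) := by
  have h := integrableOn_exp_mul_Ioi (a := -μ) (by linarith) x
  refine Integrable.mul_bdd (c := M) h hf.aestronglyMeasurable ?_
  exact Eventually.of_forall fun t => by simpa using hM t

lemma R_bound {μ : ℝ} (hμ : 0 < μ) {f : ℝ → ℝ} {M : ℝ}
    (hM : ∀ x, |f x| ≤ M) (x : ℝ) : |R μ f x| ≤ M / μ := by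
  have h := (integrableOn_exp_mul_Ioi (a := -μ) (by linarith) x).mul_const M
  have h1 : ‖∫ t in Set.Ioi x, exp (-μ * t) * f t‖ ≤ ∫ t in Set.Ioi x, exp (-μ * t) * M := by
    apply norm_integral_le_of_norm_le h
    exact Eventually.of_forall fun t => by
      rw [norm_mul, Real.norm_eq_abs, Real.norm_eq_abs, abs_of_pos (exp_pos _)]
      exact mul_le_mul_of_nonneg_left (hM t) (exp_pos _).le
  rw [integral_mul_const, integral_exp_mul_Ioi (by linarith)] at h1
  rw [R, abs_mul, abs_of_pos (exp_pos _)]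
  calc _ ≤ exp (μ * x) * (-exp (-μ * x) / -μ * M) := mul_le_mul_of_nonneg_left h1 (exp_pos _).le
    _ = (exp (μ * x) * exp (-μ * x)) * (M / μ) := by field_simp
    _ = M / μ := by rw [← exp_add]; simp

lemma R_eq {μ : ℝ} (hμ : 0 < μ) {f : ℝ → ℝ} (hf : Measurable f) {M : ℝ} (hM : ∀ x, |f x| ≤ M) :
    R μ f = fun x => exp (μ * x) * ((∫ t in Set.Ioi 0, exp (-μ * t) * f t) -
      ∫ t in (0:ℝ)..x, exp (-μ * t) * f t) := by
  ext x
  rw [R, ← intervalIntegral.integral_Ioi_sub_Ioi' (R_int hμ hf hM 0) (R_int hμ hf hM x)]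
  ring

lemma R_ii {μ : ℝ} (hμ : 0 < μ) {f : ℝ → ℝ} (hf : Measurable f) {M : ℝ} (hM : ∀ x, |f x| ≤ M)
    (x y : ℝ) : IntervalIntegrable (fun t => exp (-μ * t) * f t) volume x y := by
  rw [intervalIntegrable_iff]
  exact (R_int hμ hf hM (min x y)).mono_set (fun t ht => ht.1)

lemma R_cont {μ : ℝ} (hμ : 0 < μ) {f : ℝ → ℝ} (hf : Measurable f) {M : ℝ} (hM : ∀ x, |f x| ≤ M) :
    Continuous (R μ f) := by
  rw [R_eq hμ hf hM]
  have := intervalIntegral.continuous_primitive (R_ii hμ hf hM) 0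
  fun_prop

lemma R_deriv {μ : ℝ} (hμ : 0 < μ) {f : ℝ → ℝ} (hf : Continuous f) {M : ℝ} (hM : ∀ x, |f x| ≤ M)
    (x : ℝ) : HasDerivAt (R μ f) (μ * R μ f x - f x) x := by
  rw [R_eq hμ hf.measurable hM]
  have hc : Continuous (fun t => exp (-μ * t) * f t) := by fun_prop
  have h1 := intervalIntegral.integral_hasDerivAt_right (R_ii hμ hf.measurable hM 0 x)
    (hc.stronglyMeasurableAtFilter _ _) hc.continuousAt
  have h2 : HasDerivAt (fun x => exp (μ * x)) (exp (μ * x) * μ) x := by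
    simpa using ((hasDerivAt_id x).const_mul μ).exp
  have h3 := h2.mul (h1.const_sub (∫ t in Set.Ioi 0, exp (-μ * t) * f t))
  refine h3.congr_deriv ?_
  have : exp (μ * x) * exp (-μ * x) = 1 := by rw [← exp_add]; simp
  linear_combination (-f x) * this

lemma R_tendsto {μ : ℝ} (hμ : 0 < μ) {f : ℕ → ℝ → ℝ} {g : ℝ → ℝ} (hf : ∀ n, Measurable (f n))
    {M : ℝ} (hM : ∀ n x, |f n x| ≤ M) (hl : ∀ x, Tendsto (fun n => f n x) atTop (𝓝 (g x)))
    (x : ℝ) : Tendsto (fun n => R μ (f n) x) atTop (𝓝 (R μ g x)) := by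
  unfold R
  apply Tendsto.const_mul
  apply tendsto_integral_of_dominated_convergence (fun t => exp (-μ * t) * M)
  · intro n
    have := hf n
    exact Measurable.aestronglyMeasurable (by fun_prop)
  · exact (integrableOn_exp_mul_Ioi (a := -μ) (by linarith) x).mul_const M
  · intro n
    exact Eventually.of_forall fun t => by
      rw [norm_mul, Real.norm_eq_abs, Real.norm_eq_abs, abs_of_pos (exp_pos _)]
      exact mul_le_mul_of_nonneg_left (hM n t) (exp_pos _).le
  · exact Eventually.of_forall fun t => (hl t).const_mul _

lemma exists_K {p β : ℝ} (hp : 0 < p) (hβ : 0 < β) : ∃ K : (ℝ → ℝ) → ℝ → ℝ,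
    (∀ f M, Measurable f → (∀ x, |f x| ≤ M) → Continuous (K f) ∧ ∃ M', ∀ x, |K f x| ≤ M') ∧
    (∀ f M, Continuous f → (∀ x, |f x| ≤ M) → ∃ U1 U2 : ℝ → ℝ,
      (∀ y, HasDerivAt (K f) (U1 y) y) ∧ (∀ y, HasDerivAt U1 (U2 y) y) ∧ 
      ∀ y, p * U2 y - 2 * U1 y - β * K f y + f y = 0) ∧
    (∀ (f : ℕ → ℝ → ℝ) g M, (∀ n, Measurable (f n)) → (∀ n x, |f n x| ≤ M) →
      (∀ x, Tendsto (fun n => f n x) atTop (𝓝 (g x))) →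
      ∀ x, Tendsto (fun n => K (f n) x) atTop (𝓝 (K g x))) := by
  obtain ⟨μ, ν, hμ, hν, e1, e2⟩ : ∃ μ ν : ℝ, 0 < μ ∧ 0 < ν ∧ p * (μ - ν) = 2 ∧ p * (μ * ν) = β := by
    have hs : 1 < √(1 + p * β) := by
      rw [Real.lt_sqrt (by norm_num)]; nlinarith [mul_pos hp hβ]
    have hq : √(1 + p * β) ^ 2 = 1 + p * β := Real.sq_sqrt (by positivity)
    refine ⟨(√(1 + p * β) + 1) / p, (√(1 + p * β) - 1) / p, by positivity,
      div_pos (by linarith) hp, by field_simp; ring, ?_⟩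
    field_simp
    linear_combination hq
  set K : (ℝ → ℝ) → ℝ → ℝ := fun f x => R ν (fun t => R μ f (-t)) (-x) * p⁻¹ with hK
  have bd : ∀ f M, (∀ x, |f x| ≤ M) → ∀ x, |(fun t => R μ f (-t)) x| ≤ M / μ :=
    fun f M hM x => R_bound hμ hM _
  refine ⟨K, ?_, ?_, ?_⟩
  · intro f M hf hM
    have c1 : Continuous (fun t => R μ f (-t)) := (R_cont hμ hf hM).comp continuous_neg
    have c2 := R_cont hν c1.measurable (bd f M hM)
    refine ⟨by fun_prop, M / μ / ν * |p⁻¹|, fun x => ?_⟩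
    simp only [hK, abs_mul]
    gcongr
    exact R_bound hν (bd f M hM) _
  · intro f M hf hM
    have c1 : Continuous (fun t => R μ f (-t)) := (R_cont hμ hf.measurable hM).comp continuous_neg
    have D1 : ∀ y, HasDerivAt (K f) (-(ν * K f y) + R μ f y * p⁻¹) y := by
      intro y
      have := ((R_deriv hν c1 (bd f M hM) (-y)).comp y (hasDerivAt_neg y)).mul_const p⁻¹
      refine this.congr_deriv ?_
      simp only [hK, neg_neg]; ring
    refine ⟨fun y => -(ν * K f y) + R μ f y * p⁻¹,
      fun y => -(ν * (-(ν * K f y) + R μ f y * p⁻¹)) + (μ * R μ f y - f y) * p⁻¹, D1,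
      fun y => (((D1 y).const_mul ν).neg).add ((R_deriv hμ hf hM y).mul_const p⁻¹), fun y => ?_⟩
    have hpp : p * p⁻¹ = 1 := mul_inv_cancel₀ hp.ne'
    rw [← e2, ← e1]
    linear_combination (-f y) * hpp
  · intro f g M hf hM hl x
    refine Tendsto.mul_const _ ?_
    refine R_tendsto hν (f := fun n t => R μ (f n) (-t)) (M := M / μ) (fun n => ?_)
      (fun n t => R_bound hμ (hM n) _) (fun t => ?_) _
    · exact ((R_cont hμ (hf n) (hM n)).comp continuous_neg).measurable
    · exact R_tendsto hμ hf hM hl _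


lemma F_mono {a c u u' v v' : ℝ} (hc : 0 < c) (hca : c * a ≤ 1) (h0 : 0 ≤ u) (h1 : u ≤ u')
    (h2 : u' ≤ 1) (h4 : v' ≤ v) (h5 : v ≤ a) :
    u * (3 - u - c * v) ≤ u' * (3 - u' - c * v') := by
  have hcv : c * v ≤ c * a := mul_le_mul_of_nonneg_left h5 hc.le
  have e1 : 0 ≤ (u' - u) * (3 - u - u' - c * v) :=
    mul_nonneg (by linarith) (by linarith)
  have e2 : 0 ≤ u' * (c * (v - v')) :=
    mul_nonneg (by linarith) (mul_nonneg hc.le (by linarith))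
  nlinarith

lemma G_mono {a b u u' v v' : ℝ} (hb : 0 < b) (hba : b ≤ a) (h0 : 0 ≤ v) (h1 : v ≤ v')
    (h2 : v' ≤ a) (h4 : u' ≤ u) (h5 : u ≤ 1) :
    v * (3 * a - b * u - v) ≤ v' * (3 * a - b * u' - v') := by
  have hcv : b * u ≤ b * 1 := mul_le_mul_of_nonneg_left h5 hb.le
  have e1 : 0 ≤ (v' - v) * (3 * a - v - v' - b * u) :=
    mul_nonneg (by linarith) (by linarith)
  have e2 : 0 ≤ v' * (b * (u - u')) :=
    mul_nonneg (by linarith) (mul_nonneg hb.le (by linarith))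
  nlinarith

lemma contDiff_two {u u1 u2 : ℝ → ℝ} (h1 : ∀ y, HasDerivAt u (u1 y) y)
    (h2 : ∀ y, HasDerivAt u1 (u2 y) y) (hc : Continuous u2) : ContDiff ℝ 2 u := by
  have e1 : deriv u = u1 := funext fun y => (h1 y).deriv
  have e2 : deriv u1 = u2 := funext fun y => (h2 y).deriv
  have c1 : ContDiff ℝ 1 u1 := by
    rw [contDiff_one_iff_deriv, e2]
    exact ⟨fun y => (h2 y).differentiableAt, hc⟩
  have : ContDiff ℝ (1 + 1) u := by
    rw [contDiff_succ_iff_deriv, e1]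
    exact ⟨fun y => (h1 y).differentiableAt, by simp, c1⟩
  simpa [one_add_one_eq_two] using this

theorem abstract_exist {a b c d : ℝ} (hd : 0 < d) (hb : 0 < b) (hba : b ≤ a) (hc : 0 < c)
    (hca : c * a ≤ 1) {ul uu vl vu : ℝ → ℝ} (cul : Continuous ul) (cuu : Continuous uu)
    (cvl : Continuous vl) (cvu : Continuous vu) (u0 : ∀ x, 0 ≤ ul x) (u1 : ∀ x, ul x ≤ uu x)
    (u2 : ∀ x, uu x ≤ 1) (v0 : ∀ x, 0 ≤ vl x) (v1 : ∀ x, vl x ≤ vu x) (v2 : ∀ x, vu x ≤ a)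
    (s1 : IsSub 1 ul (fun x => ul x * (1 - ul x - c * vu x)))
    (s2 : IsSub d vl (fun x => vl x * (a - b * uu x - vl x)))
    (s3 : IsSub 1 (fun x => -uu x) (fun x => -(uu x * (1 - uu x - c * vl x))))
    (s4 : IsSub d (fun x => -vu x) (fun x => -(vu x * (a - b * ul x - vu x)))) :
    ∃ u v : ℝ → ℝ, ContDiff ℝ 2 u ∧ ContDiff ℝ 2 v ∧
      (∀ ξ : ℝ, deriv (deriv u) ξ - 2 * deriv u ξ + u ξ * (1 - u ξ - c * v ξ) = 0) ∧
      (∀ ξ : ℝ, d * deriv (deriv v) ξ - 2 * deriv v ξ + v ξ * (a - b * u ξ - v ξ) = 0) ∧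
      (∀ x, ul x ≤ u x ∧ u x ≤ uu x) ∧ (∀ x, vl x ≤ v x ∧ v x ≤ vu x) := by
  have ha : 0 < a := by linarith
  obtain ⟨K, Ka, Kb, Kc⟩ := exists_K (p := 1) (β := 2) one_pos two_pos
  obtain ⟨J, Ja, Jb, Jc⟩ := exists_K (p := d) (β := 2 * a) hd (by positivity)
  let F : (ℝ → ℝ) × (ℝ → ℝ) → ℝ → ℝ := fun w x => w.1 x * (3 - w.1 x - c * w.2 x)
  let G : (ℝ → ℝ) × (ℝ → ℝ) → ℝ → ℝ := fun w x => w.2 x * (3 * a - b * w.1 x - w.2 x)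
  let Bd : (ℝ → ℝ) × (ℝ → ℝ) → Prop := fun w =>
    (∀ x, ul x ≤ w.1 x ∧ w.1 x ≤ uu x) ∧ (∀ x, vl x ≤ w.2 x ∧ w.2 x ≤ vu x)
  let Inv : (ℝ → ℝ) × (ℝ → ℝ) → Prop := fun w => Continuous w.1 ∧ Continuous w.2 ∧ Bd w
  have Fb : ∀ w, Bd w → ∀ x, |F w x| ≤ 3 := by
    intro w hw x
    have a1 := hw.1 x; have a2 := hw.2 x
    have := u0 x; have := u2 x; have := v0 x; have := v2 x
    have h1 := F_mono (a := a) (u := 0) (u' := w.1 x) (v := a) (v' := w.2 x) hc hca le_rfl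
      (by linarith) (by linarith) (by linarith) le_rfl
    have h2 := F_mono (a := a) (u := w.1 x) (u' := 1) (v := w.2 x) (v' := 0) hc hca 
      (by linarith) (by linarith) le_rfl (by linarith) (by linarith)
    rw [abs_le]
    constructor <;> simp only [F] <;> linarith
  have Gb : ∀ w, Bd w → ∀ x, |G w x| ≤ 2 * a * a := by
    intro w hw x
    have a1 := hw.1 x; have a2 := hw.2 x
    have := u0 x; have := u2 x; have := v0 x; have := v2 x
    have h1 := G_mono (a := a) (b := b) (v := 0) (v' := w.2 x) (u := 1) (u' := w.1 x) hb hba le_rfl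
      (by linarith) (by linarith) (by linarith) le_rfl
    have h2 := G_mono (a := a) (b := b) (v := w.2 x) (v' := a) (u := w.1 x) (u' := 0) hb hba
      (by linarith) (by linarith) le_rfl (by linarith) (by linarith)
    have : 0 < a * a := by positivity
    rw [abs_le]
    constructor <;> simp only [G] <;> linarith
  have Fc : ∀ w, Continuous w.1 → Continuous w.2 → Continuous (F w) := by
    intro w h1 h2; simp only [F]; fun_prop
  have Gc : ∀ w, Continuous w.1 → Continuous w.2 → Continuous (G w) := by
    intro w h1 h2; simp only [G]; fun_prop
  let T : (ℝ → ℝ) × (ℝ → ℝ) → (ℝ → ℝ) × (ℝ → ℝ) := fun w => (K (F w), J (G w))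
  have TInv : ∀ w, Inv w → Inv (T w) := by
    rintro w ⟨c1, c2, hB⟩
    obtain ⟨k1, M, hM⟩ := Ka (F w) _ (Fc w c1 c2).measurable (Fb w hB)
    obtain ⟨j1, M', hM'⟩ := Ja (G w) _ (Gc w c1 c2).measurable (Gb w hB)
    obtain ⟨U1, U2, d1, d2, e⟩ := Kb (F w) _ (Fc w c1 c2) (Fb w hB)
    obtain ⟨V1, V2, d3, d4, e'⟩ := Jb (G w) _ (Gc w c1 c2) (Gb w hB)
    refine ⟨k1, j1, fun x => ⟨?_, ?_⟩, fun x => ⟨?_, ?_⟩⟩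
    · refine comparison one_pos two_pos s1 cul d1 d2 e (fun y => ?_) (M := 1 + M) (fun y => ?_) x
      · have := F_mono hc hca (u0 y) (hB.1 y).1 ((hB.1 y).2.trans (u2 y)) (hB.2 y).2 (v2 y)
        simp only [F]; linarith
      · linarith [u1 y, u2 y, (abs_le.1 (hM y)).1]
    · refine comparison_super one_pos two_pos (h := fun x => uu x * (1 - uu x - c * vl x)) s3 cuu
        d1 d2 e (fun y => ?_) (M := M) (fun y => ?_) x
      · have := F_mono hc hca ((u0 y).trans (hB.1 y).1) (hB.1 y).2 (u2 y) (hB.2 y).1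
          ((hB.2 y).2.trans (v2 y))
        simp only [F]; linarith
      · linarith [u1 y, u0 y, (abs_le.1 (hM y)).2]
    · refine comparison hd (by positivity) s2 cvl d3 d4 e' (fun y => ?_) (M := a + M')
        (fun y => ?_) x
      · have := G_mono hb hba (v0 y) (hB.2 y).1 ((hB.2 y).2.trans (v2 y)) (hB.1 y).2 (u2 y)
        simp only [G]; linarith
      · linarith [v1 y, v2 y, (abs_le.1 (hM' y)).1]
    · refine comparison_super hd (by positivity) (h := fun x => vu x * (a - b * ul x - vu x)) s4 cvu
        d3 d4 e' (fun y => ?_) (M := M') (fun y => ?_) x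
      · have := G_mono hb hba ((v0 y).trans (hB.2 y).1) (hB.2 y).2 (v2 y) (hB.1 y).1
          ((hB.1 y).2.trans (u2 y))
        simp only [G]; linarith
      · linarith [v1 y, v0 y, (abs_le.1 (hM' y)).2]
  have TMono : ∀ w w', Inv w → Inv w' → (∀ x, w.1 x ≤ w'.1 x) → (∀ x, w'.2 x ≤ w.2 x) →
      (∀ x, (T w).1 x ≤ (T w').1 x) ∧ (∀ x, (T w').2 x ≤ (T w).2 x) := by
    rintro w w' ⟨c1, c2, hB⟩ ⟨c1', c2', hB'⟩ o1 o2
    obtain ⟨k1, M, hM⟩ := Ka (F w) _ (Fc w c1 c2).measurable (Fb w hB)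
    obtain ⟨j1, M', hM'⟩ := Ja (G w) _ (Gc w c1 c2).measurable (Gb w hB)
    obtain ⟨U1, U2, d1, d2, e⟩ := Kb (F w) _ (Fc w c1 c2) (Fb w hB)
    obtain ⟨V1, V2, d3, d4, e'⟩ := Jb (G w) _ (Gc w c1 c2) (Gb w hB)
    obtain ⟨k1', N, hN⟩ := Ka (F w') _ (Fc w' c1' c2').measurable (Fb w' hB')
    obtain ⟨j1', N', hN'⟩ := Ja (G w') _ (Gc w' c1' c2').measurable (Gb w' hB')
    obtain ⟨X1, X2, d5, d6, e5⟩ := Kb (F w') _ (Fc w' c1' c2') (Fb w' hB')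
    obtain ⟨Y1, Y2, d7, d8, e6⟩ := Jb (G w') _ (Gc w' c1' c2') (Gb w' hB')
    constructor
    · refine comparison one_pos two_pos (S := K (F w)) (h := fun x => F w x - 2 * K (F w) x) ?_ k1
        d5 d6 e5 (fun y => ?_) (M := M + N) (fun y => ?_)
      · exact fun x => ⟨_, U1, U2, d1, d2, rfl, Eventually.of_forall fun _ => le_rfl,
          by linarith [e x]⟩
      · have := F_mono hc hca ((u0 y).trans (hB.1 y).1) (o1 y) ((hB'.1 y).2.trans (u2 y)) (o2 y)
          ((hB.2 y).2.trans (v2 y))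
        simp only [F] at this ⊢; linarith
      · linarith [(abs_le.1 (hM y)).2, (abs_le.1 (hN y)).1]
    · refine comparison hd (by positivity : 0 < 2 * a) (S := J (G w'))
        (h := fun x => G w' x - 2 * a * J (G w') x) ?_ j1'
        d3 d4 e' (fun y => ?_) (M := N' + M') (fun y => ?_)
      · exact fun x => ⟨_, Y1, Y2, d7, d8, rfl, Eventually.of_forall fun _ => le_rfl,
          by linarith [e6 x]⟩
      · have := G_mono hb hba ((v0 y).trans (hB'.2 y).1) (o2 y) ((hB.2 y).2.trans (v2 y)) (o1 y)
          ((hB'.1 y).2.trans (u2 y))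
        simp only [G] at this ⊢; linarith
      · linarith [(abs_le.1 (hN' y)).2, (abs_le.1 (hM' y)).1]
  let W : ℕ → (ℝ → ℝ) × (ℝ → ℝ) := fun n => T^[n] (uu, vl)
  have Wsucc : ∀ n, W (n + 1) = T (W n) := fun n => Function.iterate_succ_apply' T n _
  have WInv : ∀ n, Inv (W n) := by
    intro n
    induction n with
    | zero => exact ⟨cuu, cvl, fun x => ⟨u1 x, le_rfl⟩, fun x => ⟨le_rfl, v1 x⟩⟩
    | succ n ih => rw [Wsucc]; exact TInv _ ih
  have Wmono : ∀ n, (∀ x, (W (n+1)).1 x ≤ (W n).1 x) ∧ (∀ x, (W n).2 x ≤ (W (n+1)).2 x) := by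
    intro n
    induction n with
    | zero => exact ⟨fun x => ((WInv 1).2.2.1 x).2, fun x => ((WInv 1).2.2.2 x).1⟩
    | succ n ih =>
      have := TMono _ _ (WInv (n+1)) (WInv n) ih.1 ih.2
      rw [← Wsucc, ← Wsucc] at this
      exact this
  have lim1 : ∀ x, ∃ l, Tendsto (fun n => (W n).1 x) atTop (𝓝 l) := fun x =>
    ⟨_, tendsto_atTop_ciInf (antitone_nat_of_succ_le fun n => (Wmono n).1 x)
      ⟨ul x, by rintro _ ⟨n, rfl⟩; exact ((WInv n).2.2.1 x).1⟩⟩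
  have lim2 : ∀ x, ∃ l, Tendsto (fun n => (W n).2 x) atTop (𝓝 l) := fun x =>
    ⟨_, tendsto_atTop_ciSup (monotone_nat_of_le_succ fun n => (Wmono n).2 x)
      ⟨vu x, by rintro _ ⟨n, rfl⟩; exact ((WInv n).2.2.2 x).2⟩⟩
  choose u hu using lim1
  choose v hv using lim2
  have hB : Bd (u, v) := by
    refine ⟨fun x => ⟨?_, ?_⟩, fun x => ⟨?_, ?_⟩⟩
    · exact ge_of_tendsto' (hu x) fun n => ((WInv n).2.2.1 x).1
    · exact le_of_tendsto' (hu x) fun n => ((WInv n).2.2.1 x).2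
    · exact ge_of_tendsto' (hv x) fun n => ((WInv n).2.2.2 x).1
    · exact le_of_tendsto' (hv x) fun n => ((WInv n).2.2.2 x).2
  have mu : Measurable u := measurable_of_tendsto_metrizable (fun n => (WInv n).1.measurable)
    (tendsto_pi_nhds.2 hu)
  have mv : Measurable v := measurable_of_tendsto_metrizable (fun n => (WInv n).2.1.measurable)
    (tendsto_pi_nhds.2 hv)
  have eu : K (F (u, v)) = u := by
    ext x
    refine tendsto_nhds_unique (Kc (fun n => F (W n)) (F (u,v)) 3
      (fun n => (Fc _ (WInv n).1 (WInv n).2.1).measurable) (fun n => Fb _ (WInv n).2.2)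
      (fun x => (hu x).mul (((hu x).const_sub 3).sub ((hv x).const_mul c))) x) ?_
    have := (tendsto_add_atTop_iff_nat 1).2 (hu x)
    exact this.congr fun n => by rw [Wsucc]
  have ev : J (G (u, v)) = v := by
    ext x
    refine tendsto_nhds_unique (Jc (fun n => G (W n)) (G (u,v)) (2 * a * a)
      (fun n => (Gc _ (WInv n).1 (WInv n).2.1).measurable) (fun n => Gb _ (WInv n).2.2)
      (fun x => (hv x).mul ((((hu x).const_mul b).const_sub (3 * a)).sub (hv x))) x) ?_
    have := (tendsto_add_atTop_iff_nat 1).2 (hv x)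
    exact this.congr fun n => by rw [Wsucc]
  have cu : Continuous u := by
    rw [← eu]
    exact (Ka (F (u, v)) 3 (by simp only [F]; fun_prop) (Fb _ hB)).1
  have cv : Continuous v := by
    rw [← ev]
    exact (Ja (G (u, v)) _ (by simp only [G]; fun_prop) (Gb _ hB)).1
  obtain ⟨U1, U2, d1, d2, e⟩ := Kb (F (u,v)) _ (Fc _ cu cv) (Fb _ hB)
  obtain ⟨V1, V2, d3, d4, e'⟩ := Jb (G (u,v)) _ (Gc _ cu cv) (Gb _ hB)
  rw [eu] at d1 e
  rw [ev] at d3 e'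
  have cU1 : Continuous U1 := continuous_iff_continuousAt.2 fun y => (d2 y).continuousAt
  have cV1 : Continuous V1 := continuous_iff_continuousAt.2 fun y => (d4 y).continuousAt
  have cU2 : Continuous U2 := by
    have : U2 = fun y => 2 * U1 y + 2 * u y - F (u, v) y := by
      ext y; linarith [e y]
    rw [this]; have := Fc (u,v) cu cv; fun_prop
  have cV2 : Continuous V2 := by
    have : V2 = fun y => (2 * V1 y + 2 * a * v y - G (u, v) y) / d := by
      ext y; rw [eq_div_iff hd.ne']; linarith [e' y]
    rw [this]; have := Gc (u,v) cu cv; fun_prop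
  have f1 : deriv u = U1 := funext fun y => (d1 y).deriv
  have f2 : deriv U1 = U2 := funext fun y => (d2 y).deriv
  have f3 : deriv v = V1 := funext fun y => (d3 y).deriv
  have f4 : deriv V1 = V2 := funext fun y => (d4 y).deriv
  refine ⟨u, v, contDiff_two d1 d2 cU2, contDiff_two d3 d4 cV2, fun y => ?_, fun y => ?_,
    hB.1, hB.2⟩
  · rw [f1, f2]; have := e y; simp only [F] at this; linarith
  · rw [f3, f4]; have := e' y; simp only [G] at this; linarith


lemma glue {p m : ℝ} {ψ ψ1 ψ2 h : ℝ → ℝ} (d1 : ∀ y, HasDerivAt ψ (ψ1 y) y)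
    (d2 : ∀ y, HasDerivAt ψ1 (ψ2 y) y) (hm : ψ1 m < 0)
    (h1 : ∀ x, x < m → 0 ≤ p * ψ2 x - 2 * ψ1 x + h x) (h2 : ∀ x, m ≤ x → 0 ≤ h x) :
    IsSub p (fun x => if x ≤ m then ψ x else ψ m) h := by
  intro x
  rcases lt_or_ge x m with hx | hx
  · refine ⟨ψ, ψ1, ψ2, d1, d2, by simp [hx.le], ?_, h1 x hx⟩
    filter_upwards [Iio_mem_nhds hx] with y hy
    simp [le_of_lt (show y < m from hy)]
  · refine ⟨fun _ => ψ m, fun _ => 0, fun _ => 0, fun y => hasDerivAt_const _ _,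
      fun y => hasDerivAt_const _ _, ?_, ?_, by simpa using h2 x hx⟩
    · rcases hx.eq_or_lt with rfl | hx
      · simp
      · simp [hx]
    · rcases hx.eq_or_lt with rfl | hx
      · have hc : ContinuousAt ψ1 m := (d2 m).continuousAt
        obtain ⟨r, hr, hball⟩ := Metric.eventually_nhds_iff.1 (hc.eventually_lt_const hm)
        have hanti : AntitoneOn ψ (Set.Ioo (m - r) (m + r)) := by
          apply antitoneOn_of_deriv_nonpos (convex_Ioo _ _)
          · exact fun y _ => (d1 y).continuousAt.continuousWithinAt
          · exact fun y _ => (d1 y).differentiableAt.differentiableWithinAt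
          · intro y hy
            rw [interior_Ioo] at hy
            rw [(d1 y).deriv]
            refine (hball ?_).le
            rw [Real.dist_eq, abs_lt]; constructor <;> linarith [hy.1, hy.2]
        filter_upwards [Ioo_mem_nhds (show m - r < m by linarith) (show m < m + r by linarith)]
          with y hy
        split_ifs with hym
        · exact hanti hy ⟨by linarith, by linarith⟩ hym
        · exact le_rfl
      · filter_upwards [Ioi_mem_nhds hx] with y hy
        simp [not_le.2 (show m < y from hy)]

lemma glue_cont {m : ℝ} {ψ : ℝ → ℝ} (h : Continuous ψ) :
    Continuous (fun x => if x ≤ m then ψ x else ψ m) :=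
  Continuous.if_le h continuous_const continuous_id continuous_const (by rintro x rfl; rfl)

lemma dexp (k x : ℝ) : HasDerivAt (fun x => exp (k * x)) (k * exp (k * x)) x := by
  have := ((hasDerivAt_id x).const_mul k).exp
  simpa [mul_comm] using this

lemma tend_pow (n : ℕ) {k : ℝ} (hk : 0 < k) :
    Tendsto (fun t : ℝ => t ^ n * exp (-k * t)) atTop (𝓝 0) := by
  have h := (Real.tendsto_pow_mul_exp_neg_atTop_nhds_zero n).comp (tendsto_id.const_mul_atTop hk)
  have h2 := h.const_mul ((k ^ n)⁻¹)
  rw [mul_zero] at h2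
  refine h2.congr fun t => ?_
  simp only [Function.comp, id, mul_pow, neg_mul]
  field_simp

lemma tend_exp {k : ℝ} (hk : 0 < k) : Tendsto (fun t : ℝ => exp (-k * t)) atTop (𝓝 0) := by
  simpa using tend_pow 0 hk

/-- the upper barrier for `u` -/
noncomputable def uu (x : ℝ) : ℝ := if x ≤ -2 then (1 / 2) * exp 2 * (-x) * exp x else 1

lemma uu_cont : Continuous uu := by
  refine Continuous.if_le (by fun_prop) continuous_const continuous_id continuous_const ?_
  rintro x rfl
  have : exp 2 * exp (-2) = 1 := by rw [← exp_add]; simp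
  linear_combination this

lemma uu_le_one (x : ℝ) : uu x ≤ 1 := by
  unfold uu
  split_ifs with h
  · have h1 : exp 2 * exp x * exp (-x - 2) = 1 := by
      rw [← exp_add, ← exp_add, exp_eq_one_iff]; ring
    have h2 := add_one_le_exp (-x - 2)
    have h3 : 0 < exp 2 * exp x := by positivity
    nlinarith
  · exact le_rfl

lemma uu_sub {k : ℝ → ℝ} (hk : ∀ x, 0 ≤ k x) :
    IsSub 1 (fun x => -uu x) (fun x => -(uu x * (1 - uu x - k x))) := by
  intro x
  rcases lt_or_ge x (-2) with hx | hx
  · refine ⟨fun x => -((1 / 2) * exp 2 * (-x) * exp x), fun x => -((1 / 2) * exp 2 * ((-x - 1) * exp x)),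
      fun x => -((1 / 2) * exp 2 * ((-x - 2) * exp x)), fun y => ?_, fun y => ?_, ?_, ?_, ?_⟩
    · have := ((((hasDerivAt_id y).neg).const_mul ((1 / 2) * exp 2)).mul (Real.hasDerivAt_exp y)).neg
      refine this.congr_deriv ?_
      simp; ring
    · have := (((((hasDerivAt_id y).neg).sub_const 1).mul (Real.hasDerivAt_exp y)).const_mul
        ((1 / 2) * exp 2)).neg
      refine this.congr_deriv ?_
      simp; ring
    · simp [uu, hx.le]
    · filter_upwards [Iio_mem_nhds hx] with y hy
      simp [uu, le_of_lt (show y < -2 from hy)]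
    · have e : uu x = (1 / 2) * exp 2 * (-x) * exp x := by simp [uu, hx.le]
      have h0 : 0 ≤ uu x := by
        rw [e]
        have : 0 ≤ -x := by linarith
        positivity
      have h1 := mul_nonneg h0 h0
      have h2 := mul_nonneg h0 (hk x)
      have : -(uu x * (1 - uu x - k x)) = - uu x + uu x * uu x + uu x * k x := by ring
      simp only [this]
      have e2 : -uu x = -((1 / 2) * exp 2 * (-x) * exp x) := by rw [e]
      linarith
  · have e : uu x = 1 := by
      rcases hx.eq_or_lt with h | h
      · subst h
        have : exp 2 * exp (-2) = 1 := by rw [← exp_add]; simp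
        simp only [uu, le_refl, if_true]
        linear_combination this
      · simp [uu, h]
    refine ⟨fun _ => -1, fun _ => 0, fun _ => 0, fun y => hasDerivAt_const _ _,
      fun y => hasDerivAt_const _ _, by simp only [e],
      Eventually.of_forall fun y => by linarith [uu_le_one y], ?_⟩
    simp [e, hk x]

lemma vu_sub {a d l : ℝ} (ha : 0 < a) (hl : 0 < l) (hP : d * l ^ 2 - 2 * l + a = 0)
    {k : ℝ → ℝ} (hk : ∀ x, 0 ≤ k x) :
    IsSub d (fun x => -min a (a * exp (l * x)))
      (fun x => -(min a (a * exp (l * x)) * (a - k x - min a (a * exp (l * x))))) := by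
  intro x
  rcases lt_or_ge x 0 with hx | hx
  · have e : min a (a * exp (l * x)) = a * exp (l * x) := by
      apply min_eq_right
      have : exp (l * x) ≤ 1 := exp_le_one_iff.2 (mul_nonpos_of_nonneg_of_nonpos hl.le hx.le)
      nlinarith
    refine ⟨fun x => -(a * exp (l * x)), fun x => -(a * (l * exp (l * x))),
      fun x => -(a * (l * (l * exp (l * x)))), fun y => ((dexp l y).const_mul a).neg,
      fun y => (((dexp l y).const_mul l).const_mul a).neg, by simp only [e],
      Eventually.of_forall fun y => neg_le_neg (min_le_right _ _), ?_⟩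
    simp only [e]
    have h0 : 0 ≤ a * exp (l * x) := by positivity
    have h1 := mul_nonneg h0 h0
    have h2 := mul_nonneg h0 (hk x)
    have : d * -(a * (l * (l * exp (l * x)))) - 2 * -(a * (l * exp (l * x))) +
      -(a * exp (l * x) * (a - k x - a * exp (l * x))) =
      (a * exp (l * x)) * (a * exp (l * x)) + a * exp (l * x) * k x := by
      linear_combination (-a * exp (l * x)) * hP
    rw [this]; linarith
  · have e : min a (a * exp (l * x)) = a := by
      apply min_eq_left
      have : 1 ≤ exp (l * x) := one_le_exp (mul_nonneg hl.le hx)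
      nlinarith
    refine ⟨fun _ => -a, fun _ => 0, fun _ => 0, fun y => hasDerivAt_const _ _,
      fun y => hasDerivAt_const _ _, by simp only [e],
      Eventually.of_forall fun y => neg_le_neg (min_le_left _ _), ?_⟩
    simp only [e]
    nlinarith [mul_nonneg ha.le (hk x)]

lemma exists_ul {a c l η m : ℝ} (hc : 0 < c) (ha : 0 < a) (hca : c * a < 1) (hη : 0 < η)
    (hη1 : η < 1) (hm : 2 ≤ m)
    (E1 : ∀ t, m ≤ t → (1 + t) * ((1 + t) * exp (-t) + exp (-l * t)) ≤ η ^ 2 * exp (-η * t))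
    (E3 : exp (-m) ≤ 1 - c * a) (E4 : 2 * exp (-η * m) < 1) :
    ∃ ul : ℝ → ℝ, Continuous ul ∧ (∀ x, 0 < ul x) ∧ (∀ x, ul x ≤ uu x) ∧
      (∃ δ > 0, ∀ x, 0 ≤ x → δ ≤ ul x) ∧
      IsSub 1 ul (fun x => ul x * (1 - ul x - c * min a (a * exp (l * x)))) := by
  set ψ : ℝ → ℝ := fun x => exp x * (-x - m + exp (η * x)) with hψ
  set ψ1 : ℝ → ℝ := fun x => exp x * (-x - m - 1 + (1 + η) * exp (η * x)) with hψ1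
  set ψ2 : ℝ → ℝ := fun x => exp x * (-x - m - 2 + (1 + η) ^ 2 * exp (η * x)) with hψ2
  have d1 : ∀ y, HasDerivAt ψ (ψ1 y) y := by
    intro y
    have := (Real.hasDerivAt_exp y).mul ((((hasDerivAt_id y).neg).sub_const m).add (dexp η y))
    refine this.congr_deriv ?_
    simp [hψ1]; ring
  have d2 : ∀ y, HasDerivAt ψ1 (ψ2 y) y := by
    intro y
    have := (Real.hasDerivAt_exp y).mul (((((hasDerivAt_id y).neg).sub_const m).sub_const 1).add
      ((dexp η y).const_mul (1 + η)))
    refine this.congr_deriv ?_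
    simp [hψ2]; ring
  have pos : ∀ x, x ≤ -m → 0 < ψ x := by
    intro x hx
    have : 0 < -x - m + exp (η * x) := by have := exp_pos (η * x); linarith
    simp only [hψ]; positivity
  have δ1 : ψ (-m) ≤ exp (-m) := by
    simp only [hψ]
    have : exp (η * -m) = exp (-η * m) := by ring_nf
    rw [this]
    nlinarith [exp_pos (-m), exp_pos (-η * m)]
  have hg : ∀ x, x ≤ -m → exp (η * x) ≤ 1 := fun x hx =>
    exp_le_one_iff.2 (mul_nonpos_of_nonneg_of_nonpos hη.le (by linarith))
  refine ⟨fun x => if x ≤ -m then ψ x else ψ (-m), glue_cont (by simp only [hψ]; fun_prop), ?_, ?_,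
    ⟨ψ (-m), pos _ le_rfl, ?_⟩, glue d1 d2 ?_ ?_ ?_⟩
  · intro x
    dsimp only
    split_ifs with h
    · exact pos x h
    · exact pos _ le_rfl
  · intro x
    have e2 : 1 ≤ 1 / 2 * exp 2 := by linarith [add_one_le_exp (2:ℝ)]
    have hx0 := exp_pos x
    dsimp only
    split_ifs with h
    · have := hg x h
      have h' : x ≤ -2 := by linarith
      simp only [uu, h', if_true, hψ]
      calc exp x * (-x - m + exp (η * x)) ≤ exp x * (-x) := by gcongr; linarith
        _ ≤ (1 / 2 * exp 2) * (exp x * (-x)) :=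
          le_mul_of_one_le_left (mul_nonneg hx0.le (by linarith)) e2
        _ = _ := by ring
    · push Not at h
      refine δ1.trans ?_
      unfold uu
      split_ifs with h'
      · calc exp (-m) ≤ exp x := exp_le_exp.2 h.le
          _ ≤ exp x * (-x) := le_mul_of_one_le_right hx0.le (by linarith)
          _ ≤ (1 / 2 * exp 2) * (exp x * (-x)) :=
            le_mul_of_one_le_left (mul_nonneg hx0.le (by linarith)) e2
          _ = _ := by ring
      · exact exp_le_one_iff.2 (by linarith)
  · intro x hx
    have : ¬ x ≤ -m := by linarith
    simp [this]
  · simp only [hψ1]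
    have : exp (η * -m) = exp (-η * m) := by ring_nf
    rw [this]
    have := exp_pos (-m)
    have h3 : (- -m - m - 1 + (1 + η) * exp (-η * m)) < 0 := by nlinarith [exp_pos (-η * m)]
    exact mul_neg_of_pos_of_neg this h3
  · intro x hx
    simp only [hx.le, if_true]
    have h0 := pos x hx.le
    have h1 := hg x hx.le
    have E := E1 (-x) (by linarith)
    have e1 : exp (- -x) = exp x := by simp
    have e2 : exp (-l * -x) = exp (l * x) := by ring_nf
    have e3 : exp (-η * -x) = exp (η * x) := by ring_nf
    rw [e1, e2, e3] at E
    have id1 : ψ2 x - 2 * ψ1 x + ψ x = exp x * (η ^ 2 * exp (η * x)) := by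
      simp only [hψ, hψ1, hψ2]; ring
    have hmin : c * min a (a * exp (l * x)) ≤ exp (l * x) := by
      have : c * min a (a * exp (l * x)) ≤ c * (a * exp (l * x)) :=
        mul_le_mul_of_nonneg_left (min_le_right _ _) hc.le
      nlinarith [exp_pos (l * x)]
    have hψle : ψ x ≤ exp x * (1 + -x) := by
      exact mul_le_mul_of_nonneg_left (by linarith) (exp_pos x).le
    have : ψ x * (ψ x + c * min a (a * exp (l * x))) ≤
        (exp x * (1 + -x)) * ((1 + -x) * exp x + exp (l * x)) := by
      have hm0 : 0 ≤ c * min a (a * exp (l * x)) :=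
        mul_nonneg hc.le (le_min ha.le (by positivity))
      apply mul_le_mul hψle (by linarith) (by linarith) (by linarith)
    have := mul_le_mul_of_nonneg_left E (exp_pos x).le
    linarith
  · intro x hx
    have e : (if x ≤ -m then ψ x else ψ (-m)) = ψ (-m) := by
      split_ifs with h
      · rw [le_antisymm h hx]
      · rfl
    simp only [e]
    apply mul_nonneg (pos _ le_rfl).le
    have : c * min a (a * exp (l * x)) ≤ c * a :=
        mul_le_mul_of_nonneg_left (min_le_left _ _) hc.le
    linarith

lemma exists_vl {a b d l η m κ θ : ℝ} (ha : 0 < a) (hb : 0 < b) (hl : 0 < l) (hη : 0 < η)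
    (hm : 2 ≤ m) (hθ0 : 0 < θ) (hθ1 : θ < 1) (hθ : l < θ * (l + η)) (hκ0 : 0 < κ)
    (hP : d * l ^ 2 - 2 * l + a = 0) (hκ : d * (l + η) ^ 2 - 2 * (l + η) + a = -κ)
    (E2 : ∀ t, m ≤ t → b * ((1 / 2) * exp 2 * t * exp (-t)) + a * exp (-l * t) ≤
      θ * κ * exp (-η * t))
    (E5 : a * exp (-l * m) ≤ a - b) :
    ∃ vl : ℝ → ℝ, Continuous vl ∧ (∀ x, 0 < vl x) ∧ (∀ x, vl x ≤ min a (a * exp (l * x))) ∧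
      (∃ δ > 0, ∀ x, 0 ≤ x → δ ≤ vl x) ∧
      IsSub d vl (fun x => vl x * (a - b * uu x - vl x)) := by
  set q := θ * exp (η * m) with hq
  set ψ : ℝ → ℝ := fun x => a * (exp (l * x) - q * exp ((l + η) * x)) with hψ
  set ψ1 : ℝ → ℝ := fun x => a * (l * exp (l * x) - q * ((l + η) * exp ((l + η) * x))) with hψ1
  set ψ2 : ℝ → ℝ := fun x => a * (l * (l * exp (l * x)) -
    q * ((l + η) * ((l + η) * exp ((l + η) * x)))) with hψ2
  have d1 : ∀ y, HasDerivAt ψ (ψ1 y) y := fun y =>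
    ((dexp l y).sub ((dexp (l + η) y).const_mul q)).const_mul a
  have d2 : ∀ y, HasDerivAt ψ1 (ψ2 y) y := fun y =>
    (((dexp l y).const_mul l).sub (((dexp (l + η) y).const_mul (l + η)).const_mul q)).const_mul a
  have qe : ∀ x, q * exp ((l + η) * x) = exp (l * x) * (θ * exp (η * (x + m))) := by
    intro x
    have : exp (η * m) * exp ((l + η) * x) = exp (l * x) * exp (η * (x + m)) := by
      rw [← exp_add, ← exp_add]; ring_nf
    rw [hq]; linear_combination θ * this
  have ψe : ∀ x, ψ x = a * exp (l * x) * (1 - θ * exp (η * (x + m))) := by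
    intro x; simp only [hψ, qe]; ring
  have hle : ∀ x, x ≤ -m → exp (η * (x + m)) ≤ 1 := fun x hx =>
    exp_le_one_iff.2 (mul_nonpos_of_nonneg_of_nonpos hη.le (by linarith))
  have pos : ∀ x, x ≤ -m → 0 < ψ x := by
    intro x hx
    have : 0 < 1 - θ * exp (η * (x + m)) := by nlinarith [hle x hx]
    rw [ψe]; positivity
  have up : ∀ x, ψ x ≤ a * exp (l * x) := by
    intro x
    rw [ψe]
    have : 0 ≤ θ * exp (η * (x + m)) := by positivity
    exact mul_le_of_le_one_right (by positivity) (by linarith)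
  refine ⟨fun x => if x ≤ -m then ψ x else ψ (-m), glue_cont (by simp only [hψ]; fun_prop), ?_, ?_,
    ⟨ψ (-m), pos _ le_rfl, ?_⟩, glue d1 d2 ?_ ?_ ?_⟩
  · intro x
    dsimp only
    split_ifs with h
    · exact pos x h
    · exact pos _ le_rfl
  · intro x
    have aux : ∀ y, y ≤ -m → ψ y ≤ a := fun y hy => by
      have : exp (l * y) ≤ 1 := exp_le_one_iff.2 (mul_nonpos_of_nonneg_of_nonpos hl.le (by linarith))
      have := up y
      nlinarith
    dsimp only
    split_ifs with h
    · exact le_min (aux x h) (up x)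
    · push Not at h
      refine le_min (aux _ le_rfl) ((up _).trans ?_)
      gcongr
  · intro x hx
    have : ¬ x ≤ -m := by linarith
    simp [this]
  · have e : ψ1 (-m) = a * exp (l * -m) * (l - θ * (l + η)) := by
      have := qe (-m)
      simp only [neg_add_cancel, mul_zero, exp_zero, mul_one] at this
      simp only [hψ1]
      linear_combination (-a * (l + η)) * this
    rw [e]
    exact mul_neg_of_pos_of_neg (by positivity) (by linarith)
  · intro x hx
    simp only [hx.le, if_true]
    have h0 := pos x hx.le
    have E := E2 (-x) (by linarith)
    have e1 : exp (- -x) = exp x := by simp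
    have e2 : exp (-l * -x) = exp (l * x) := by ring_nf
    have e3 : exp (-η * -x) = exp (η * x) := by ring_nf
    rw [e1, e2, e3] at E
    have eu : uu x = (1 / 2) * exp 2 * (-x) * exp x := by
      have : x ≤ -2 := by linarith
      simp [uu, this]
    rw [← eu] at E
    have id1 : d * ψ2 x - 2 * ψ1 x + a * ψ x =
        a * exp (l * x) * (θ * κ * exp (η * (x + m))) := by
      have := qe x
      simp only [hψ, hψ1, hψ2]
      linear_combination (a * exp (l * x)) * hP + (-a * q * exp ((l + η) * x)) * hκ
        + (a * κ) * this
    have h3 : exp (η * x) ≤ exp (η * (x + m)) := exp_le_exp.2 (by nlinarith)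
    have h4 : θ * κ * exp (η * x) ≤ θ * κ * exp (η * (x + m)) := by gcongr
    have h5 := up x
    have hu0 : 0 ≤ uu x := by
      rw [eu]
      have : 0 ≤ -x := by linarith
      positivity
    have : ψ x * (b * uu x + ψ x) ≤ (a * exp (l * x)) * (θ * κ * exp (η * (x + m))) := by
      apply mul_le_mul h5 (by linarith) (by positivity) (by positivity)
    linarith
  · intro x hx
    have e : (if x ≤ -m then ψ x else ψ (-m)) = ψ (-m) := by
      split_ifs with h
      · rw [le_antisymm h hx]
      · rfl
    simp only [e]
    apply mul_nonneg (pos _ le_rfl).le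
    have h1 := up (-m)
    have : exp (l * -m) = exp (-l * m) := by ring_nf
    rw [this] at h1
    have := mul_le_mul_of_nonneg_left (uu_le_one x) hb.le
    linarith

end LVW

open Filter Real

/-- Existence of a positive solution at the critical speed `s = s* = 2` (case
`a·d < 1`), squeezed between explicit sub- and super-solutions: `u` is bounded
by `ĥ₁·(-ξ)·e^{ξ}` with `ĥ₁ = e²/2` for `ξ ≤ -2`, and `v` decays like
`a·e^{λ₂ ξ}` with `λ₂ = (1 - √(1 - a d))/d`. -/
theorem existence_critical_speed_with_bounds
    (a b c d : ℝ) (hd : 0 < d) (hb : 0 < b) (hba : b < a) (hc : 0 < c)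
    (hac : a < 1 / c) (had : a * d < 1) :
    ∃ u v : ℝ → ℝ, ContDiff ℝ 2 u ∧ ContDiff ℝ 2 v ∧
      (∀ ξ : ℝ, 0 < u ξ) ∧ (∀ ξ : ℝ, 0 < v ξ) ∧
      (∀ ξ : ℝ, deriv (deriv u) ξ - 2 * deriv u ξ + u ξ * (1 - u ξ - c * v ξ) = 0) ∧
      (∀ ξ : ℝ, d * deriv (deriv v) ξ - 2 * deriv v ξ + v ξ * (a - b * u ξ - v ξ) = 0) ∧
      (∀ ξ : ℝ, u ξ ≤ 1) ∧
      (∀ ξ : ℝ, ξ ≤ -2 → u ξ ≤ (1 / 2) * Real.exp 2 * (-ξ) * Real.exp ξ) ∧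
      (∀ ξ : ℝ, v ξ ≤ min a (a * Real.exp ((1 - Real.sqrt (1 - a * d)) / d * ξ))) ∧
      (∃ δ₁ δ₂ Ξ : ℝ, 0 < δ₁ ∧ 0 < δ₂ ∧
        ∀ ξ : ℝ, Ξ ≤ ξ → δ₁ ≤ u ξ ∧ δ₂ ≤ v ξ) ∧
      Tendsto u atBot (nhds 0) ∧ Tendsto v atBot (nhds 0) := by
  have ha : 0 < a := by linarith
  have hca : c * a < 1 := by rw [lt_div_iff₀ hc] at hac; linarith
  set r := Real.sqrt (1 - a * d) with hr
  have hr2 : r ^ 2 = 1 - a * d := Real.sq_sqrt (by linarith)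
  have hr0 : 0 < r := Real.sqrt_pos.2 (by linarith)
  have had0 : 0 < a * d := by positivity
  have hr1 : r < 1 := by nlinarith
  set l := (1 - r) / d with hl
  have hl0 : 0 < l := div_pos (by linarith) hd
  have hdl : d * l = 1 - r := by rw [hl]; field_simp
  have hP : d * l ^ 2 - 2 * l + a = 0 := by
    have : d * (d * l ^ 2 - 2 * l + a) = 0 := by
      linear_combination (d * l - 1 - r) * hdl + hr2
    exact (mul_eq_zero.1 this).resolve_left hd.ne'
  obtain ⟨η, hη0, hη1, hηl, hηr⟩ : ∃ η : ℝ, 0 < η ∧ η < 1 ∧ η < l ∧ d * η ≤ r := by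
    refine ⟨min (min (1/2) (l/2)) (r / d), by positivity, ?_, ?_, ?_⟩
    · exact lt_of_le_of_lt ((min_le_left _ _).trans (min_le_left _ _)) (by norm_num)
    · exact lt_of_le_of_lt ((min_le_left _ _).trans (min_le_right _ _)) (by linarith)
    · calc _ ≤ d * (r / d) := by gcongr; exact min_le_right _ _
        _ = r := by field_simp
  set κ := η * (2 * r - d * η) with hκd
  have hκ0 : 0 < κ := mul_pos hη0 (by linarith)
  have hκ : d * (l + η) ^ 2 - 2 * (l + η) + a = -κ := by
    rw [hκd]; linear_combination hP + 2 * η * hdl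
  set θ := (l + η / 2) / (l + η) with hθd
  have hθ0 : 0 < θ := by positivity
  have hθ1 : θ < 1 := by rw [hθd, div_lt_one (by positivity)]; linarith
  have hθ : l < θ * (l + η) := by
    rw [hθd, div_mul_cancel₀ _ (by positivity)]; linarith
  -- eventual inequalities
  have ev1 : ∀ᶠ t : ℝ in atTop,
      (1 + t) * ((1 + t) * exp (-t) + exp (-l * t)) ≤ η ^ 2 * exp (-η * t) := by
    have k1 : 0 < 1 - η := by linarith
    have k2 : 0 < l - η := by linarith
    have T := (((LVW.tend_pow 0 k1).add ((LVW.tend_pow 1 k1).const_mul 2)).add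
      (LVW.tend_pow 2 k1)).add ((LVW.tend_pow 0 k2).add (LVW.tend_pow 1 k2))
    simp only [mul_zero, add_zero] at T
    have := T.eventually_le_const (show (0:ℝ) < η ^ 2 by positivity)
    filter_upwards [this] with t ht
    have e1 : exp (-t) = exp (-(1 - η) * t) * exp (-η * t) := by rw [← exp_add]; ring_nf
    have e2 : exp (-l * t) = exp (-(l - η) * t) * exp (-η * t) := by rw [← exp_add]; ring_nf
    have := mul_le_mul_of_nonneg_right ht (exp_pos (-η * t)).le
    rw [e1, e2]
    refine le_trans (le_of_eq ?_) this
    ring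
  have ev2 : ∀ᶠ t : ℝ in atTop, b * ((1 / 2) * exp 2 * t * exp (-t)) + a * exp (-l * t) ≤
      θ * κ * exp (-η * t) := by
    have k1 : 0 < 1 - η := by linarith
    have k2 : 0 < l - η := by linarith
    have T := ((LVW.tend_pow 1 k1).const_mul (b * ((1 / 2) * exp 2))).add
      ((LVW.tend_pow 0 k2).const_mul a)
    simp only [mul_zero, add_zero] at T
    have := T.eventually_le_const (show (0:ℝ) < θ * κ by positivity)
    filter_upwards [this] with t ht
    have e1 : exp (-t) = exp (-(1 - η) * t) * exp (-η * t) := by rw [← exp_add]; ring_nf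
    have e2 : exp (-l * t) = exp (-(l - η) * t) * exp (-η * t) := by rw [← exp_add]; ring_nf
    have := mul_le_mul_of_nonneg_right ht (exp_pos (-η * t)).le
    rw [e1, e2]
    refine le_trans (le_of_eq ?_) this
    ring
  have ev3 : ∀ᶠ t : ℝ in atTop, exp (-t) ≤ 1 - c * a := by
    have := (LVW.tend_exp one_pos).eventually_le_const (show (0:ℝ) < 1 - c * a by linarith)
    simpa using this
  have ev4 : ∀ᶠ t : ℝ in atTop, 2 * exp (-η * t) < 1 := by
    have := ((LVW.tend_exp hη0).const_mul 2)
    rw [mul_zero] at this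
    exact this.eventually_lt_const one_pos
  have ev5 : ∀ᶠ t : ℝ in atTop, a * exp (-l * t) ≤ a - b := by
    have := ((LVW.tend_exp hl0).const_mul a)
    rw [mul_zero] at this
    exact this.eventually_le_const (by linarith)
  obtain ⟨m, hm⟩ := eventually_atTop.1
    ((((ev1.and ev2).and (ev3.and ev4)).and ev5).and (eventually_ge_atTop 2))
  obtain ⟨⟨⟨-, E3, E4⟩, E5⟩, hm2⟩ := hm m le_rfl
  obtain ⟨ul, cul, pul, ulu, ⟨δ₁, hδ₁, lul⟩, sul⟩ := LVW.exists_ul (l := l) hc ha hca hη0 hη1 hm2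
    (fun t ht => (hm t ht).1.1.1.1) E3 E4
  obtain ⟨vl, cvl, pvl, vlu, ⟨δ₂, hδ₂, lvl⟩, svl⟩ := LVW.exists_vl ha hb hl0 hη0 hm2 hθ0 hθ1 hθ hκ0
    hP hκ (fun t ht => (hm t ht).1.1.1.2) E5
  obtain ⟨u, v, hu, hv, equ, eqv, bu, bv⟩ := LVW.abstract_exist hd hb hba.le hc hca.le cul
    LVW.uu_cont cvl (vu := fun x => min a (a * exp (l * x))) (by fun_prop) (fun x => (pul x).le) ulu
    LVW.uu_le_one (fun x => (pvl x).le) vlu (fun x => min_le_left _ _) sul svl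
    (LVW.uu_sub fun x => mul_nonneg hc.le (pvl x).le)
    (LVW.vu_sub ha hl0 hP fun x => mul_nonneg hb.le (pul x).le)
  have ub : ∀ ξ : ℝ, ξ ≤ -2 → u ξ ≤ (1 / 2) * Real.exp 2 * (-ξ) * Real.exp ξ := by
    intro ξ hξ
    have := (bu ξ).2
    simpa only [LVW.uu, hξ, if_true] using this
  refine ⟨u, v, hu, hv, fun ξ => (pul ξ).trans_le (bu ξ).1, fun ξ => (pvl ξ).trans_le (bv ξ).1,
    equ, eqv, fun ξ => (bu ξ).2.trans (LVW.uu_le_one ξ), ub, fun ξ => (bv ξ).2,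
    ⟨δ₁, δ₂, 0, hδ₁, hδ₂, fun ξ h => ⟨(lul ξ h).trans (bu ξ).1, (lvl ξ h).trans (bv ξ).1⟩⟩, ?_, ?_⟩
  · have T := ((LVW.tend_pow 1 one_pos).comp tendsto_neg_atBot_atTop).const_mul ((1 / 2) * exp 2)
    rw [mul_zero] at T
    refine tendsto_of_tendsto_of_tendsto_of_le_of_le' tendsto_const_nhds T
      (Eventually.of_forall fun ξ => ((pul ξ).trans_le (bu ξ).1).le) ?_
    filter_upwards [eventually_le_atBot (-2)] with ξ hξ
    have := ub ξ hξ
    simp only [Function.comp, pow_one, neg_mul, one_mul, neg_neg]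
    linarith
  · have T := ((LVW.tend_exp hl0).comp tendsto_neg_atBot_atTop).const_mul a
    rw [mul_zero] at T
    refine tendsto_of_tendsto_of_tendsto_of_le_of_le tendsto_const_nhds T
      (fun ξ => ((pvl ξ).trans_le (bv ξ).1).le) ?_
    intro ξ
    have := (bv ξ).2.trans (min_le_right _ _)
    simpa only [Function.comp, neg_mul, mul_neg, neg_neg] using this
end
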